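/- arXiv:1912.00983 — 7 statements merged into one kernel-verified Lean document; each statement's English description precedes it below -/
import Mathlib

section
/- Let E and Φ be positive, trace-preserving linear maps on d×d complex matrices with Φ ∘ E = E. Let ρ be a density on ℂ^d such that E(ρ) is positive definite, and let ζ ∈ (0,1) and c ≥ 1 satisfy Φ(ρ) ≤ c·E(ρ) in the Loewner order. Then D(ρ ‖ (1−ζ)E(ρ) + ζΦ(ρ)) ≥ β_{c,ζ} · D(ρ ‖ E(ρ)), where β_{c,ζ} := (1/(1 + ζ(c+1) + 2ζ²(c−1))) · (1 − 3ζ(2+ζ)·(c−1)²/(c(ln c − 1) + 1) − 8ζ − 2ζ²), with the convention that (c−1)²/(c(ln c − 1) + 1) = 0 when c = 1. -/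
open Matrix
open scoped ComplexOrder

/-- Matrix logarithm of a Hermitian matrix via functional calculus
(junk value `0` for non-Hermitian input). -/
noncomputable def matLog {d : ℕ} (A : Matrix (Fin d) (Fin d) ℂ) : Matrix (Fin d) (Fin d) ℂ :=
  if hA : A.IsHermitian then hA.cfc Real.log else 0

/-- Umegaki relative entropy `D(ρ‖σ) = Re tr (ρ (log ρ - log σ))`. -/
noncomputable def relEnt {d : ℕ} (ρ σ : Matrix (Fin d) (Fin d) ℂ) : ℝ :=
  ((ρ * (matLog ρ - matLog σ)).trace).re

/-- A density matrix: positive semidefinite with trace one. -/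
def IsDensity {d : ℕ} (ρ : Matrix (Fin d) (Fin d) ℂ) : Prop :=
  ρ.PosSemidef ∧ ρ.trace = 1

/-- `ρ` majorizes `σ`: for every `k`, the maximum over `k`-element index sets of the
sum of corresponding eigenvalues of `ρ` dominates the analogous maximum for `σ`. -/
def Majorizes {d : ℕ} {ρ σ : Matrix (Fin d) (Fin d) ℂ}
    (hρ : ρ.IsHermitian) (hσ : σ.IsHermitian) : Prop :=
  ∀ k : ℕ, k ≤ d → ∀ T : Finset (Fin d), T.card = k →
    ∃ S : Finset (Fin d), S.card = k ∧ ∑ i ∈ T, hσ.eigenvalues i ≤ ∑ i ∈ S, hρ.eigenvalues i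


section

open MeasureTheory Filter Topology Set

namespace Matrix

variable {n : Type*} [Fintype n] [DecidableEq n]

/-- The matrix whose columns are the chosen eigenvectors of `A`. -/
noncomputable abbrev IsHermitian.eigU {A : Matrix n n ℂ} (hA : A.IsHermitian) : Matrix n n ℂ :=
  (hA.eigenvectorUnitary : Matrix n n ℂ)

lemma IsHermitian.eigU_mul {A : Matrix n n ℂ} (hA : A.IsHermitian) : hA.eigUᴴ * hA.eigU = 1 :=
  Unitary.coe_star_mul_self hA.eigenvectorUnitary

lemma IsHermitian.mul_eigU {A : Matrix n n ℂ} (hA : A.IsHermitian) : hA.eigU * hA.eigUᴴ = 1 :=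
  Unitary.coe_mul_star_self hA.eigenvectorUnitary

lemma IsHermitian.cfc_eq_mul {A : Matrix n n ℂ} (hA : A.IsHermitian) (f : ℝ → ℝ) :
    hA.cfc f = hA.eigU * diagonal (fun i => ((f (hA.eigenvalues i) : ℝ) : ℂ)) * hA.eigUᴴ := by
  rw [IsHermitian.cfc, Unitary.conjStarAlgAut_apply]
  rfl

lemma IsHermitian.eq_eigU_mul {A : Matrix n n ℂ} (hA : A.IsHermitian) :
    A = hA.eigU * diagonal (fun i => (hA.eigenvalues i : ℂ)) * hA.eigUᴴ := by
  conv_lhs => rw [hA.spectral_theorem, Unitary.conjStarAlgAut_apply]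
  rfl

lemma IsHermitian.eigU_conj {A : Matrix n n ℂ} (hA : A.IsHermitian) :
    hA.eigUᴴ * A * hA.eigU = diagonal (fun i => (hA.eigenvalues i : ℂ)) := by
  calc _ = hA.eigUᴴ * (hA.eigU * diagonal (fun i => (hA.eigenvalues i : ℂ)) * hA.eigUᴴ)
        * hA.eigU := by rw [← hA.eq_eigU_mul]
    _ = (hA.eigUᴴ * hA.eigU) * diagonal (fun i => (hA.eigenvalues i : ℂ))
        * (hA.eigUᴴ * hA.eigU) := by simp only [mul_assoc]
    _ = _ := by rw [hA.eigU_mul]; simp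

/-- The diagonal of `Z` in an eigenbasis of `A`. -/
noncomputable def IsHermitian.diagIn {A : Matrix n n ℂ} (hA : A.IsHermitian) (Z : Matrix n n ℂ)
    (i : n) : ℝ :=
  ((hA.eigUᴴ * Z * hA.eigU) i i).re

lemma IsHermitian.diagIn_add {A : Matrix n n ℂ} (hA : A.IsHermitian) (Y Z : Matrix n n ℂ) (i : n) :
    hA.diagIn (Y + Z) i = hA.diagIn Y i + hA.diagIn Z i := by
  simp [diagIn, mul_add, add_mul]

lemma IsHermitian.diagIn_smul {A : Matrix n n ℂ} (hA : A.IsHermitian) (r : ℝ) (Z : Matrix n n ℂ)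
    (i : n) : hA.diagIn (r • Z) i = r * hA.diagIn Z i := by
  simp [diagIn]

lemma IsHermitian.diagIn_self {A : Matrix n n ℂ} (hA : A.IsHermitian) (i : n) :
    hA.diagIn A i = hA.eigenvalues i := by
  simp [diagIn, hA.eigU_conj]

lemma IsHermitian.diagIn_nonneg {A : Matrix n n ℂ} (hA : A.IsHermitian) {Z : Matrix n n ℂ}
    (hZ : Z.PosSemidef) (i : n) : 0 ≤ hA.diagIn Z i := by
  have := (hZ.conjTranspose_mul_mul_same hA.eigU).diag_nonneg (i := i)
  exact (Complex.le_def.1 this).1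

lemma IsHermitian.sum_diagIn {A : Matrix n n ℂ} (hA : A.IsHermitian) (Z : Matrix n n ℂ) :
    ∑ i, hA.diagIn Z i = Z.trace.re := by
  have : (hA.eigUᴴ * Z * hA.eigU).trace = Z.trace := by
    rw [trace_mul_comm, ← mul_assoc, hA.mul_eigU, one_mul]
  rw [← this, trace, Complex.re_sum]
  rfl

lemma IsHermitian.trace_mul_cfc {A : Matrix n n ℂ} (hA : A.IsHermitian) (Z : Matrix n n ℂ)
    (f : ℝ → ℝ) : (Z * hA.cfc f).trace.re = ∑ i, hA.diagIn Z i * f (hA.eigenvalues i) := by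
  rw [hA.cfc_eq_mul, ← mul_assoc, trace_mul_comm, ← mul_assoc, ← mul_assoc, trace, Complex.re_sum]
  refine Finset.sum_congr rfl fun i _ => ?_
  simp [diagIn, mul_diagonal]

lemma IsHermitian.sum_eigenvalues {A : Matrix n n ℂ} (hA : A.IsHermitian) :
    ∑ i, hA.eigenvalues i = A.trace.re := by
  rw [← hA.sum_diagIn]
  simp [hA.diagIn_self]

/-- The trace of the negative part of a Hermitian matrix. -/
noncomputable def trNeg (A : Matrix n n ℂ) : ℝ :=
  if hA : A.IsHermitian then ∑ i, max (-hA.eigenvalues i) 0 else 0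

lemma IsHermitian.trNeg_eq {A : Matrix n n ℂ} (hA : A.IsHermitian) :
    A.trNeg = ∑ i, max (-hA.eigenvalues i) 0 := dif_pos hA

lemma trNeg_nonneg (A : Matrix n n ℂ) : 0 ≤ A.trNeg := by
  unfold trNeg
  split_ifs
  · exact Finset.sum_nonneg fun i _ => le_max_right _ _
  · exact le_rfl

lemma trNeg_le {A Z : Matrix n n ℂ} (hZ : Z.PosSemidef) (hAZ : (A + Z).PosSemidef) :
    A.trNeg ≤ Z.trace.re := by
  have hA : A.IsHermitian := by simpa using hAZ.1.sub hZ.1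
  rw [hA.trNeg_eq, ← hA.sum_diagIn]
  refine Finset.sum_le_sum fun i _ => max_le ?_ (hA.diagIn_nonneg hZ i)
  have := hA.diagIn_nonneg hAZ i
  rw [hA.diagIn_add, hA.diagIn_self] at this
  linarith

lemma IsHermitian.exists_trNeg {A : Matrix n n ℂ} (hA : A.IsHermitian) :
    ∃ Z : Matrix n n ℂ, Z.PosSemidef ∧ (A + Z).PosSemidef ∧ Z.trace.re = A.trNeg := by
  refine ⟨hA.cfc fun x => max (-x) 0, ?_, ?_, ?_⟩
  · rw [hA.cfc_eq_mul]
    refine PosSemidef.mul_mul_conjTranspose_same (.diagonal fun i => ?_) _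
    exact Complex.zero_le_real.2 (le_max_right _ _)
  · have : A + hA.cfc (fun x => max (-x) 0) = hA.eigU *
        diagonal (fun i => ((max (hA.eigenvalues i) 0 : ℝ) : ℂ)) * hA.eigUᴴ := by
      nth_rw 1 [hA.eq_eigU_mul]
      rw [hA.cfc_eq_mul, ← add_mul, ← mul_add, diagonal_add]
      congr 3
      ext i
      rw [← Complex.ofReal_add]
      congr 1
      rcases le_total (hA.eigenvalues i) 0 with h | h
      · rw [max_eq_left (by linarith), max_eq_right h]; ring
      · rw [max_eq_right (by linarith), max_eq_left h]; ring
    rw [this]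
    refine PosSemidef.mul_mul_conjTranspose_same (.diagonal fun i => ?_) _
    exact Complex.zero_le_real.2 (le_max_right _ _)
  · have := hA.trace_mul_cfc 1 (fun x => max (-x) 0)
    rw [one_mul] at this
    rw [this, hA.trNeg_eq]
    refine Finset.sum_congr rfl fun i _ => ?_
    simp [diagIn, hA.eigU_mul]

lemma trNeg_add_le {A B : Matrix n n ℂ} (hA : A.IsHermitian) (hB : B.IsHermitian) :
    (A + B).trNeg ≤ A.trNeg + B.trNeg := by
  obtain ⟨Y, hY, hAY, hYt⟩ := hA.exists_trNeg
  obtain ⟨Z, hZ, hBZ, hZt⟩ := hB.exists_trNeg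
  rw [← hYt, ← hZt, ← Complex.add_re, ← trace_add]
  refine trNeg_le (hY.add hZ) ?_
  convert hAY.add hBZ using 1
  abel

lemma trNeg_smul_le {A : Matrix n n ℂ} (hA : A.IsHermitian) {r : ℝ} (hr : 0 ≤ r) :
    (r • A).trNeg ≤ r * A.trNeg := by
  obtain ⟨Y, hY, hAY, hYt⟩ := hA.exists_trNeg
  have : (r • Y).trace.re = r * A.trNeg := by rw [← hYt]; simp
  rw [← this]
  refine trNeg_le (hY.smul hr) ?_
  rw [← smul_add]
  exact hAY.smul hr

lemma trNeg_map_le {Φ : Matrix n n ℂ →ₗ[ℂ] Matrix n n ℂ}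
    (hpos : ∀ X : Matrix n n ℂ, X.PosSemidef → (Φ X).PosSemidef)
    (htr : ∀ X : Matrix n n ℂ, (Φ X).trace = X.trace) {A : Matrix n n ℂ} (hA : A.IsHermitian) :
    (Φ A).trNeg ≤ A.trNeg := by
  obtain ⟨Y, hY, hAY, hYt⟩ := hA.exists_trNeg
  rw [← hYt, ← htr]
  refine trNeg_le (hpos _ hY) ?_
  rw [← map_add]
  exact hpos _ hAY

lemma trNeg_eq_zero {A : Matrix n n ℂ} (hA : A.PosSemidef) : A.trNeg = 0 := by
  refine le_antisymm ?_ A.trNeg_nonneg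
  simpa using trNeg_le (A := A) .zero (by simpa using hA)

lemma IsHermitian.trNeg_neg {A : Matrix n n ℂ} (hA : A.IsHermitian) :
    (-A).trNeg = A.trNeg + A.trace.re := by
  refine le_antisymm ?_ ?_
  · obtain ⟨Z, hZ, hAZ, hZt⟩ := hA.exists_trNeg
    have := trNeg_le (A := -A) hAZ (by simpa using hZ)
    rw [trace_add, Complex.add_re, hZt] at this
    linarith
  · obtain ⟨Z, hZ, hAZ, hZt⟩ := hA.neg.exists_trNeg
    have := trNeg_le (A := A) hAZ (by simpa using hZ)
    rw [trace_add, Complex.add_re, hZt, trace_neg, Complex.neg_re] at this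
    linarith

lemma IsHermitian.re_quadForm {A : Matrix n n ℂ} (hA : A.IsHermitian) (c : n → ℂ) :
    (star (hA.eigU *ᵥ c) ⬝ᵥ (A *ᵥ (hA.eigU *ᵥ c))).re
      = ∑ i, hA.eigenvalues i * Complex.normSq (c i) := by
  have : star (hA.eigU *ᵥ c) ⬝ᵥ (A *ᵥ (hA.eigU *ᵥ c))
      = star c ⬝ᵥ (diagonal (fun i => (hA.eigenvalues i : ℂ)) *ᵥ c) := by
    rw [← hA.eigU_conj, star_mulVec, dotProduct_mulVec, dotProduct_mulVec, dotProduct_mulVec,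
      vecMul_vecMul, vecMul_vecMul, mul_assoc]
  rw [this, dotProduct, Complex.re_sum]
  refine Finset.sum_congr rfl fun i _ => ?_
  simp only [mulVec_diagonal, Pi.star_apply, RCLike.star_def, Complex.mul_re, Complex.mul_im,
    Complex.conj_re, Complex.conj_im, Complex.ofReal_re, Complex.ofReal_im, Complex.normSq_apply]
  ring

lemma IsHermitian.re_norm_eigU {A : Matrix n n ℂ} (hA : A.IsHermitian) (c : n → ℂ) :
    (star (hA.eigU *ᵥ c) ⬝ᵥ (hA.eigU *ᵥ c)).re = ∑ i, Complex.normSq (c i) := by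
  have : star (hA.eigU *ᵥ c) ⬝ᵥ (hA.eigU *ᵥ c) = star c ⬝ᵥ c := by
    rw [star_mulVec, dotProduct_mulVec, vecMul_vecMul, hA.eigU_mul, vecMul_one]
  rw [this, dotProduct, Complex.re_sum]
  refine Finset.sum_congr rfl fun i _ => ?_
  simp [Complex.normSq_apply]

/-- The number of eigenvalues of `A` (with multiplicity) below `x`. -/
noncomputable def IsHermitian.countLT {A : Matrix n n ℂ} (hA : A.IsHermitian) (x : ℝ) : ℕ :=
  (Finset.univ.filter fun i => hA.eigenvalues i < x).card

lemma IsHermitian.countLT_le {A B : Matrix n n ℂ} (hA : A.IsHermitian) (hB : B.IsHermitian)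
    (C : Matrix n n ℂ) {x y : ℝ}
    (h : ∀ v : n → ℂ, (star v ⬝ᵥ (A *ᵥ v)).re < x * (star v ⬝ᵥ v).re →
      (star (C *ᵥ v) ⬝ᵥ (B *ᵥ (C *ᵥ v))).re < y * (star (C *ᵥ v) ⬝ᵥ (C *ᵥ v)).re) :
    hA.countLT x ≤ hB.countLT y := by
  by_contra! hlt
  let S := {i // hA.eigenvalues i < x}
  let T := {i // hB.eigenvalues i < y}
  let M : Matrix T S ℂ := (hB.eigUᴴ * C * hA.eigU).submatrix Subtype.val Subtype.val
  have hcard : Module.finrank ℂ (T → ℂ) < Module.finrank ℂ (S → ℂ) := by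
    rw [Module.finrank_fintype_fun_eq_card, Module.finrank_fintype_fun_eq_card]
    simpa [countLT, S, T, Fintype.card_subtype] using hlt
  obtain ⟨c, hc, hc0⟩ := (Submodule.ne_bot_iff _).1
    (LinearMap.ker_ne_bot_of_finrank_lt (f := M.mulVecLin) hcard)
  let c' : n → ℂ := fun i => if hi : hA.eigenvalues i < x then c ⟨i, hi⟩ else 0
  have hc' : ∀ i : S, c' i = c i := fun i => by simp [c', i.2]
  have hcz : ∀ i, ¬ hA.eigenvalues i < x → c' i = 0 := fun i hi => by simp [c', hi]
  have h1 := h (hA.eigU *ᵥ c') (by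
    rw [hA.re_quadForm, hA.re_norm_eigU, Finset.mul_sum]
    obtain ⟨i, hi⟩ := Function.ne_iff.1 hc0
    refine Finset.sum_lt_sum (fun i _ => ?_) ⟨i, Finset.mem_univ _, ?_⟩
    · by_cases hi : hA.eigenvalues i < x
      · exact mul_le_mul_of_nonneg_right hi.le (Complex.normSq_nonneg _)
      · simp [hcz i hi]
    · exact mul_lt_mul_of_pos_right i.2 (Complex.normSq_pos.2 (by simpa [hc'] using hi)))
  let d : n → ℂ := (hB.eigUᴴ * C * hA.eigU) *ᵥ c'
  have hd : C *ᵥ (hA.eigU *ᵥ c') = hB.eigU *ᵥ d := by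
    simp only [d, mulVec_mulVec, ← mul_assoc, hB.mul_eigU, one_mul]
  have hd0 : ∀ j, hB.eigenvalues j < y → d j = 0 := by
    intro j hj
    have h2 : (M *ᵥ c) ⟨j, hj⟩ = 0 := by
      have := LinearMap.mem_ker.1 hc
      rw [mulVecLin_apply] at this
      rw [this]; rfl
    rw [← h2]
    simp only [d, mulVec, dotProduct, M, submatrix_apply]
    rw [← Finset.sum_subset (Finset.subset_univ (Finset.univ.filter fun i => hA.eigenvalues i < x))]
    · rw [Finset.sum_subtype (p := fun i => hA.eigenvalues i < x)
        (Finset.univ.filter fun i => hA.eigenvalues i < x) (by simp)]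
      exact Finset.sum_congr rfl fun i _ => by rw [hc']
    · intro i _ hi
      rw [hcz i (by simpa using hi), mul_zero]
  rw [hd, hB.re_quadForm, hB.re_norm_eigU, Finset.mul_sum] at h1
  refine absurd h1 (not_lt.2 (Finset.sum_le_sum fun j _ => ?_))
  by_cases hj : hB.eigenvalues j < y
  · simp [hd0 j hj]
  · exact mul_le_mul_of_nonneg_right (not_lt.1 hj) (Complex.normSq_nonneg _)

lemma IsHermitian.ofReal_trNeg {A : Matrix n n ℂ} (hA : A.IsHermitian) :
    ENNReal.ofReal A.trNeg = ∫⁻ y in Ioi (0 : ℝ), (hA.countLT (-y) : ENNReal) := by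
  have h1 : ∀ y : ℝ, (hA.countLT (-y) : ENNReal)
      = ∑ i, (Iio (-hA.eigenvalues i)).indicator (fun _ => (1 : ENNReal)) y := by
    intro y
    simp only [countLT, Finset.card_filter, indicator, mem_Iio]
    push_cast
    exact Finset.sum_congr rfl fun i _ => by simp only [lt_neg]
  simp_rw [h1]
  rw [lintegral_finsetSum _ fun i _ => measurable_const.indicator measurableSet_Iio, hA.trNeg_eq,
    ENNReal.ofReal_sum_of_nonneg fun i _ => le_max_right _ _]
  refine Finset.sum_congr rfl fun i _ => ?_
  rw [lintegral_indicator measurableSet_Iio, Measure.restrict_restrict measurableSet_Iio]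
  simp [Iio_inter_Ioi]

lemma PosDef.exists_conj_eq_one {σ : Matrix n n ℂ} (hσ : σ.PosDef) :
    ∃ C D : Matrix n n ℂ, Cᴴ * σ * C = 1 ∧ C * D = 1 := by
  have hs := hσ.eigenvalues_pos
  let f : n → ℂ := fun i => ((√(hσ.1.eigenvalues i))⁻¹ : ℝ)
  let g : n → ℂ := fun i => (√(hσ.1.eigenvalues i) : ℝ)
  have hfg : ∀ i, f i * g i = 1 := fun i => by
    simp only [f, g]
    rw [← Complex.ofReal_mul, inv_mul_cancel₀ (Real.sqrt_pos.2 (hs i)).ne', Complex.ofReal_one]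
  have hfsf : ∀ i, f i * hσ.1.eigenvalues i * f i = 1 := fun i => by
    have h : (hσ.1.eigenvalues i : ℂ) = g i * g i := by
      simp only [g]
      rw [← Complex.ofReal_mul, Real.mul_self_sqrt (hs i).le]
    rw [h]
    linear_combination (f i * g i + 1) * hfg i
  refine ⟨hσ.1.eigU * diagonal f, diagonal g * hσ.1.eigUᴴ, ?_, ?_⟩
  · have : (diagonal f)ᴴ = diagonal f := by
      rw [diagonal_conjTranspose]
      congr 1
      ext i
      simp [f]
    rw [conjTranspose_mul, this]
    calc _ = diagonal f * (hσ.1.eigUᴴ * σ * hσ.1.eigU) * diagonal f := by simp only [mul_assoc]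
      _ = 1 := by
        rw [hσ.1.eigU_conj, diagonal_mul_diagonal, diagonal_mul_diagonal]
        simp [hfsf]
  · calc _ = hσ.1.eigU * (diagonal f * diagonal g) * hσ.1.eigUᴴ := by simp only [mul_assoc]
      _ = 1 := by
        rw [diagonal_mul_diagonal]
        simp [hfg, hσ.1.mul_eigU]

lemma countLT_pencil {ρ σ C D : Matrix n n ℂ} (hC : Cᴴ * σ * C = 1) (hCD : C * D = 1) (s y : ℝ)
    (h1 : (ρ - s • σ).IsHermitian) (h2 : (Cᴴ * (ρ + y • 1) * C).IsHermitian) :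
    h1.countLT (-y) = h2.countLT s := by
  have hq : ∀ v, star v ⬝ᵥ ((Cᴴ * (ρ + y • 1) * C) *ᵥ v)
      = star (C *ᵥ v) ⬝ᵥ (ρ *ᵥ (C *ᵥ v)) + y • (star (C *ᵥ v) ⬝ᵥ (C *ᵥ v)) := by
    intro v
    rw [← mulVec_mulVec, ← mulVec_mulVec, dotProduct_mulVec, ← star_mulVec, add_mulVec,
      smul_mulVec, one_mulVec, dotProduct_add, dotProduct_smul]
  have hn : ∀ v, star v ⬝ᵥ v = star (C *ᵥ v) ⬝ᵥ (σ *ᵥ (C *ᵥ v)) := by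
    intro v
    nth_rw 2 [← one_mulVec v]
    rw [← hC, ← mulVec_mulVec, ← mulVec_mulVec, dotProduct_mulVec, ← star_mulVec]
  have hs : ∀ w, star w ⬝ᵥ ((ρ - s • σ) *ᵥ w)
      = star w ⬝ᵥ (ρ *ᵥ w) - s • (star w ⬝ᵥ (σ *ᵥ w)) := by
    intro w
    rw [sub_mulVec, smul_mulVec, dotProduct_sub, dotProduct_smul]
  refine le_antisymm (h1.countLT_le h2 D fun w hw => ?_) (h2.countLT_le h1 C fun v hv => ?_)
  · have hCw : C *ᵥ (D *ᵥ w) = w := by rw [mulVec_mulVec, hCD, one_mulVec]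
    rw [hq, hn (D *ᵥ w), hCw]
    rw [hs] at hw
    simp only [Complex.add_re, Complex.sub_re, Complex.smul_re, smul_eq_mul] at hw ⊢
    linarith
  · rw [hq, hn v] at hv
    rw [hs]
    simp only [Complex.add_re, Complex.sub_re, Complex.smul_re, smul_eq_mul] at hv ⊢
    linarith

lemma IsHermitian.det_add_smul_one {A : Matrix n n ℂ} (hA : A.IsHermitian) (x : ℝ) :
    (A + x • (1 : Matrix n n ℂ)).det = ((∏ i, (hA.eigenvalues i + x) : ℝ) : ℂ) := by
  have h : A + x • (1 : Matrix n n ℂ)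
      = hA.eigU * diagonal (fun i => ((hA.eigenvalues i + x : ℝ) : ℂ)) * hA.eigUᴴ := by
    have h1 : x • (1 : Matrix n n ℂ) = hA.eigU * (x • (1 : Matrix n n ℂ)) * hA.eigUᴴ := by
      rw [mul_smul_comm, mul_one, smul_mul_assoc, hA.mul_eigU]
    rw [h1]
    nth_rw 1 [hA.eq_eigU_mul]
    rw [← add_mul, ← mul_add]
    congr 2
    ext i j
    by_cases hij : i = j
    · subst hij; simp
    · simp [hij]
  rw [h, det_mul_right_comm, hA.mul_eigU, one_mul, det_diagonal]
  push_cast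
  rfl

lemma sum_log_pencil {ρ σ C : Matrix n n ℂ} (hρ : ρ.PosSemidef) (hσ : σ.PosDef)
    (hC : Cᴴ * σ * C = 1) {y : ℝ} (hy : 0 < y) {x : ℝ} (hx : 0 ≤ x)
    (h1 : (ρ + x • σ).IsHermitian) (h2 : (Cᴴ * (ρ + y • 1) * C).IsHermitian)
    (h3 : ∀ i, 0 < h2.eigenvalues i) :
    ∑ i, Real.log (h2.eigenvalues i + x)
      = ∑ i, Real.log (h1.eigenvalues i + y) + Real.log (Complex.normSq C.det) := by
  have hC0 : C.det ≠ 0 := by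
    intro h
    have := congrArg det hC
    rw [det_mul, h, mul_zero, det_one] at this
    exact zero_ne_one this
  have h1' : (ρ + x • σ).PosSemidef := hρ.add (hσ.posSemidef.smul hx)
  rw [← Real.log_prod fun i _ => (add_pos_of_pos_of_nonneg (h3 i) hx).ne',
    ← Real.log_prod fun i _ => (add_pos_of_nonneg_of_pos (h1'.eigenvalues_nonneg i) hy).ne',
    ← Real.log_mul (Finset.prod_ne_zero_iff.2 fun i _ =>
      (add_pos_of_nonneg_of_pos (h1'.eigenvalues_nonneg i) hy).ne') (by simpa using hC0)]
  congr 1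
  have e1 := h1.det_add_smul_one y
  have e2 := h2.det_add_smul_one x
  have : Cᴴ * (ρ + y • 1) * C + x • 1 = Cᴴ * (ρ + x • σ + y • 1) * C := by
    rw [← hC]
    simp only [mul_add, add_mul, mul_smul_comm, smul_mul_assoc]
    abel
  rw [this, det_mul, det_mul, e1, det_conjTranspose] at e2
  have h4 : star C.det * C.det = ((Complex.normSq C.det : ℝ) : ℂ) := by
    rw [Complex.normSq_eq_conj_mul_self]; rfl
  have e3 : ((∏ i, (h1.eigenvalues i + y) : ℝ) : ℂ) * ((Complex.normSq C.det : ℝ) : ℂ)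
      = ((∏ i, (h2.eigenvalues i + x) : ℝ) : ℂ) := by
    rw [← e2, ← h4]; ring
  exact_mod_cast e3.symm

end Matrix

lemma lintegral_Ioi_of_hasDerivAt_of_nonneg {g g' : ℝ → ℝ} {a l : ℝ}
    (hcont : ContinuousWithinAt g (Ici a) a) (hderiv : ∀ x ∈ Ioi a, HasDerivAt g (g' x) x)
    (hpos : ∀ x ∈ Ioi a, 0 ≤ g' x) (hg : Tendsto g atTop (𝓝 l)) :
    0 ≤ l - g a ∧ ∫⁻ x in Ioi a, ENNReal.ofReal (g' x) = ENNReal.ofReal (l - g a) := by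
  rw [← integral_Ioi_of_hasDerivAt_of_nonneg hcont hderiv hpos hg,
    ofReal_integral_eq_lintegral_ofReal
      (integrableOn_Ioi_deriv_of_nonneg hcont hderiv hpos hg)]
  · exact ⟨setIntegral_nonneg measurableSet_Ioi hpos, rfl⟩
  exact (ae_restrict_iff' measurableSet_Ioi).2 (ae_of_all _ hpos)

/-- Second difference of `x ↦ 1 / (s + x)` at the points `0, z, 2z`. -/
noncomputable def diffKernel (z s : ℝ) : ℝ := 1 / s - 2 / (s + z) + 1 / (s + 2 * z)

lemma diffKernel_eq {z s : ℝ} (hz : 0 ≤ z) (hs : 0 < s) :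
    diffKernel z s = 2 * z ^ 2 / (s * (s + z) * (s + 2 * z)) := by
  have h1 : s + z ≠ 0 := by positivity
  have h2 : s + 2 * z ≠ 0 := by positivity
  unfold diffKernel
  field_simp
  ring

lemma diffKernel_nonneg {z s : ℝ} (hz : 0 ≤ z) (hs : 0 < s) : 0 ≤ diffKernel z s := by
  rw [diffKernel_eq hz hs]
  positivity

lemma lintegral_diffKernel {z r : ℝ} (hz : 0 ≤ z) (hr : 0 < r) :
    ∫⁻ s in Ioi r, ENNReal.ofReal (diffKernel z s)
      = ENNReal.ofReal (-Real.log r + 2 * Real.log (r + z) - Real.log (r + 2 * z)) := by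
  have hd : ∀ x : ℝ, 0 < x → HasDerivAt
      (fun s => Real.log s - 2 * Real.log (s + z) + Real.log (s + 2 * z)) (diffKernel z x) x := by
    intro x hx
    have h0 := Real.hasDerivAt_log hx.ne'
    have h1 := ((hasDerivAt_id x).add_const z).log (by simp only [id]; positivity)
    have h2 := ((hasDerivAt_id x).add_const (2 * z)).log (by simp only [id]; positivity)
    refine ((h0.sub (h1.const_mul 2)).add h2).congr_deriv ?_
    simp only [diffKernel, id]
    ring
  rw [(lintegral_Ioi_of_hasDerivAt_of_nonneg (l := 0) (hd r hr).continuousAt.continuousWithinAt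
    (fun x hx => hd x (hr.trans hx)) (fun x hx => diffKernel_nonneg hz (hr.trans hx)) ?_).2]
  · congr 1; ring
  · have := ((Real.tendsto_log_comp_add_sub_log z).const_mul (-2)).add
      (Real.tendsto_log_comp_add_sub_log (2 * z))
    simp only [mul_zero, add_zero] at this
    refine this.congr fun x => ?_
    ring

lemma two_mul_log_sub_nonneg {z r : ℝ} (hz : 0 ≤ z) (hr : 0 < r) :
    0 ≤ -Real.log r + 2 * Real.log (r + z) - Real.log (r + 2 * z) := by
  have : Real.log (r * (r + 2 * z)) ≤ Real.log ((r + z) ^ 2) :=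
    Real.log_le_log (by positivity) (by nlinarith [sq_nonneg z])
  rw [Real.log_mul hr.ne' (by positivity), Real.log_pow] at this
  push_cast at this
  linarith

/-- The primitive `x log x - x` of the logarithm. -/
noncomputable def entFun (x : ℝ) : ℝ := x * Real.log x - x

lemma continuous_entFun : Continuous entFun := Real.continuous_mul_log.sub continuous_id

lemma hasDerivAt_entFun {x : ℝ} (hx : x ≠ 0) : HasDerivAt entFun (Real.log x) x := by
  exact ((Real.hasDerivAt_mul_log hx).sub (hasDerivAt_id x)).congr_deriv (by ring)

lemma tendsto_entFun_add_sub (a : ℝ) :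
    Tendsto (fun y => entFun (a + y) - entFun y - a * Real.log y) atTop (𝓝 0) := by
  have h1 := (Real.tendsto_log_comp_add_sub_log a).const_mul a
  have h2 := (Real.tendsto_mul_log_one_add_div_atTop a).sub_const a
  have h3 := h1.add h2
  simp only [mul_zero, sub_self, add_zero] at h3
  refine h3.congr' ?_
  filter_upwards [eventually_gt_atTop 0, eventually_gt_atTop (-a)] with y hy hya
  have : Real.log (1 + a / y) = Real.log (y + a) - Real.log y := by
    rw [← Real.log_div (by linarith) hy.ne']
    congr 1
    field_simp
  rw [this, entFun, entFun, add_comm a y]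
  ring

lemma lintegral_sum_log_second_diff {n : Type*} [Fintype n] {a b c : n → ℝ} (ha : ∀ i, 0 ≤ a i)
    (hb : ∀ i, 0 ≤ b i) (hc : ∀ i, 0 ≤ c i) (hsum : ∑ i, a i - 2 * ∑ i, b i + ∑ i, c i = 0)
    (hpos : ∀ y, 0 < y →
      0 ≤ ∑ i, (-Real.log (a i + y) + 2 * Real.log (b i + y) - Real.log (c i + y))) :
    0 ≤ ∑ i, entFun (a i) - 2 * ∑ i, entFun (b i) + ∑ i, entFun (c i) ∧
    ∫⁻ y in Ioi (0 : ℝ), ENNReal.ofReal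
        (∑ i, (-Real.log (a i + y) + 2 * Real.log (b i + y) - Real.log (c i + y)))
      = ENNReal.ofReal (∑ i, entFun (a i) - 2 * ∑ i, entFun (b i) + ∑ i, entFun (c i)) := by
  have hd : ∀ u : ℝ, 0 ≤ u → ∀ y : ℝ, 0 < y →
      HasDerivAt (fun y => entFun (u + y)) (Real.log (u + y)) y := fun u hu y hy =>
    (hasDerivAt_entFun (by positivity)).comp_const_add u y
  have hcont : Continuous fun y =>
      ∑ i, (-entFun (a i + y) + 2 * entFun (b i + y) - entFun (c i + y)) := by
    have := continuous_entFun
    fun_prop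
  have hval : 0 - ∑ i, (-entFun (a i + 0) + 2 * entFun (b i + 0) - entFun (c i + 0))
      = ∑ i, entFun (a i) - 2 * ∑ i, entFun (b i) + ∑ i, entFun (c i) := by
    simp only [add_zero, Finset.sum_sub_distrib, Finset.sum_add_distrib, Finset.sum_neg_distrib,
      ← Finset.mul_sum]
    ring
  rw [← hval]
  refine lintegral_Ioi_of_hasDerivAt_of_nonneg (l := 0)
    (g := fun y => ∑ i, (-entFun (a i + y) + 2 * entFun (b i + y) - entFun (c i + y)))
    hcont.continuousWithinAt ?_ hpos ?_
  · intro y hy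
    exact HasDerivAt.fun_sum fun i _ => (((hd _ (ha i) y hy).neg.add
      ((hd _ (hb i) y hy).const_mul 2)).sub (hd _ (hc i) y hy))
  · have h : Tendsto (fun y => ∑ i, (-(entFun (a i + y) - entFun y - a i * Real.log y)
        + 2 * (entFun (b i + y) - entFun y - b i * Real.log y)
        - (entFun (c i + y) - entFun y - c i * Real.log y))) atTop (𝓝 (∑ _i : n, (-0 + 2 * 0 - 0))) :=
      tendsto_finsetSum _ fun i _ => (((tendsto_entFun_add_sub (a i)).neg.add
        ((tendsto_entFun_add_sub (b i)).const_mul 2)).sub (tendsto_entFun_add_sub (c i)))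
    simp only [neg_zero, mul_zero, add_zero, sub_zero, Finset.sum_const_zero] at h
    refine h.congr fun y => ?_
    have h2 : ∑ i, (a i * Real.log y - 2 * (b i * Real.log y) + c i * Real.log y) = 0 := by
      rw [Finset.sum_add_distrib, Finset.sum_sub_distrib, ← Finset.mul_sum, ← Finset.sum_mul,
        ← Finset.sum_mul, ← Finset.sum_mul]
      linear_combination Real.log y * hsum
    rw [← add_zero (∑ i, (-entFun (a i + y) + 2 * entFun (b i + y) - entFun (c i + y))), ← h2,
      ← Finset.sum_add_distrib]
    exact Finset.sum_congr rfl fun i _ => by ring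

namespace Matrix

variable {n : Type*} [Fintype n] [DecidableEq n]

/-- The trace of `A log A - A`. -/
noncomputable def trEnt (A : Matrix n n ℂ) : ℝ :=
  if hA : A.IsHermitian then ∑ i, entFun (hA.eigenvalues i) else 0

lemma IsHermitian.trEnt_eq {A : Matrix n n ℂ} (hA : A.IsHermitian) :
    A.trEnt = ∑ i, entFun (hA.eigenvalues i) := dif_pos hA

lemma IsHermitian.exists_countLT_eq {A : Matrix n n ℂ} (hA : A.IsHermitian) (y : ℝ) :
    ∃ q : ℚ, y < q ∧ hA.countLT (-y) ≤ hA.countLT (-q) := by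
  have h : ∀ᶠ x in 𝓝 y, ∀ i, hA.eigenvalues i < -y → hA.eigenvalues i < -x := by
    refine eventually_all.2 fun i => ?_
    by_cases hi : hA.eigenvalues i < -y
    · filter_upwards [eventually_lt_nhds (lt_neg.1 hi)] with x hx _
      exact lt_neg.1 hx
    · exact Eventually.of_forall fun x hx => absurd hx hi
  obtain ⟨u, hu, hsub⟩ := exists_Ico_subset_of_mem_nhds h (exists_gt y)
  obtain ⟨q, hq1, hq2⟩ := exists_rat_btwn hu
  refine ⟨q, hq1, Finset.card_le_card fun i => ?_⟩
  simpa using hsub ⟨hq1.le, hq2⟩ i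

lemma IsHermitian.countLT_mono {A : Matrix n n ℂ} (hA : A.IsHermitian) : Monotone hA.countLT := by
  intro x y hxy
  refine Finset.card_le_card fun i => ?_
  simpa using fun h : hA.eigenvalues i < x => h.trans_le hxy

lemma measurable_countLT_sub_smul {ρ σ : Matrix n n ℂ} (hσ : σ.PosSemidef)
    (h : ∀ s : ℝ, (ρ - s • σ).IsHermitian) :
    Measurable fun p : ℝ × ℝ => (h p.1).countLT (-p.2) := by
  refine measurable_of_Ici fun k => ?_
  have hmono : ∀ y : ℝ, Monotone fun s => (h s).countLT (-y) := by
    intro y s t hst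
    refine (h s).countLT_le (h t) 1 fun v hv => ?_
    rw [one_mulVec]
    refine lt_of_le_of_lt ?_ hv
    have h1 : 0 ≤ (star v ⬝ᵥ (σ *ᵥ v)).re := (Complex.le_def.1 (hσ.dotProduct_mulVec_nonneg v)).1
    simp only [sub_mulVec, smul_mulVec, dotProduct_sub, dotProduct_smul, Complex.sub_re,
      Complex.smul_re, smul_eq_mul]
    nlinarith
  have : (fun p : ℝ × ℝ => (h p.1).countLT (-p.2)) ⁻¹' Ici k
      = ⋃ q : ℚ, {s | k ≤ (h s).countLT (-q)} ×ˢ Iio (q : ℝ) := by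
    ext ⟨s, y⟩
    simp only [mem_preimage, mem_Ici, mem_iUnion, mem_prod, mem_ofPred_eq, mem_Iio]
    constructor
    · intro hk
      obtain ⟨q, hq, hle⟩ := (h s).exists_countLT_eq y
      exact ⟨q, hk.trans hle, hq⟩
    · rintro ⟨q, hk, hq⟩
      exact hk.trans ((h s).countLT_mono (neg_le_neg hq.le))
  rw [this]
  refine MeasurableSet.iUnion fun q => MeasurableSet.prod ?_ measurableSet_Iio
  exact measurableSet_le measurable_const (hmono q).measurable

lemma measurable_diffKernel (z : ℝ) : Measurable (diffKernel z) := by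
  unfold diffKernel
  fun_prop

lemma lintegral_diffKernel_mul_countLT {B : Matrix n n ℂ} (hB : B.IsHermitian)
    (hpos : ∀ i, 0 < hB.eigenvalues i) {z : ℝ} (hz : 0 ≤ z) :
    ∫⁻ s in Ioi (0 : ℝ), ENNReal.ofReal (diffKernel z s) * (hB.countLT s : ENNReal)
      = ENNReal.ofReal (∑ i, (-Real.log (hB.eigenvalues i) + 2 * Real.log (hB.eigenvalues i + z)
        - Real.log (hB.eigenvalues i + 2 * z))) := by
  have h1 : ∀ s : ℝ, ENNReal.ofReal (diffKernel z s) * (hB.countLT s : ENNReal)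
      = ∑ i, (Ioi (hB.eigenvalues i)).indicator (fun s => ENNReal.ofReal (diffKernel z s)) s := by
    intro s
    simp only [IsHermitian.countLT, Finset.card_filter, indicator, mem_Ioi]
    push_cast
    rw [Finset.mul_sum]
    exact Finset.sum_congr rfl fun i _ => by split_ifs <;> simp
  simp_rw [h1]
  rw [lintegral_finsetSum _ fun i _ =>
      (measurable_diffKernel z).ennreal_ofReal.indicator measurableSet_Ioi,
    ENNReal.ofReal_sum_of_nonneg fun i _ => two_mul_log_sub_nonneg hz (hpos i)]
  refine Finset.sum_congr rfl fun i _ => ?_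
  rw [lintegral_indicator measurableSet_Ioi, Measure.restrict_restrict measurableSet_Ioi,
    Ioi_inter_Ioi, max_eq_left (hpos i).le, lintegral_diffKernel hz (hpos i)]

lemma lintegral_diffKernel_mul_trNeg {ρ σ : Matrix n n ℂ} (hρ : ρ.PosSemidef) (hσ : σ.PosDef)
    {z : ℝ} (hz : 0 ≤ z) :
    0 ≤ ρ.trEnt - 2 * (ρ + z • σ).trEnt + (ρ + (2 * z) • σ).trEnt ∧
    ∫⁻ s in Ioi (0 : ℝ), ENNReal.ofReal (diffKernel z s) * ENNReal.ofReal (ρ - s • σ).trNeg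
      = ENNReal.ofReal (ρ.trEnt - 2 * (ρ + z • σ).trEnt + (ρ + (2 * z) • σ).trEnt) := by
  obtain ⟨C, D, hC, hCD⟩ := hσ.exists_conj_eq_one
  have hDC : D * C = 1 := mul_eq_one_comm.1 hCD
  have h : ∀ s : ℝ, (ρ - s • σ).IsHermitian := fun s => hρ.1.sub (hσ.1.smul (.all s))
  have hp : ∀ x : ℝ, 0 ≤ x → (ρ + x • σ).PosSemidef := fun x hx =>
    hρ.add (hσ.posSemidef.smul hx)
  have hB : ∀ y : ℝ, 0 < y → (Cᴴ * (ρ + y • 1) * C).PosDef := fun y hy => by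
    refine PosDef.conjTranspose_mul_mul_same (PosDef.posSemidef_add hρ (PosDef.one.smul hy)) ?_
    refine Function.LeftInverse.injective (g := D.mulVec) fun v => ?_
    rw [mulVec_mulVec, hDC, one_mulVec]
  have hm : Measurable fun p : ℝ × ℝ => (((h p.1).countLT (-p.2) : ℕ) : ENNReal) :=
    measurable_from_top.comp (measurable_countLT_sub_smul hσ.posSemidef h)
  simp_rw [(h _).ofReal_trNeg]
  have hswap : ∀ s : ℝ, ENNReal.ofReal (diffKernel z s)
        * ∫⁻ y in Ioi (0 : ℝ), ((h s).countLT (-y) : ENNReal)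
      = ∫⁻ y in Ioi (0 : ℝ), ENNReal.ofReal (diffKernel z s) * ((h s).countLT (-y) : ENNReal) :=
    fun s => (lintegral_const_mul _ (hm.comp measurable_prodMk_left)).symm
  simp_rw [hswap]
  rw [lintegral_lintegral_swap
    (((measurable_diffKernel z).ennreal_ofReal.comp measurable_fst).mul hm).aemeasurable]
  have hlog : ∀ y : ℝ, 0 < y → ∀ hy : (Cᴴ * (ρ + y • 1) * C).IsHermitian,
      ∑ i, (-Real.log (hy.eigenvalues i) + 2 * Real.log (hy.eigenvalues i + z)
        - Real.log (hy.eigenvalues i + 2 * z))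
      = ∑ i, (-Real.log (hρ.1.eigenvalues i + y) + 2 * Real.log ((hp z hz).1.eigenvalues i + y)
        - Real.log ((hp (2 * z) (by positivity)).1.eigenvalues i + y)) := by
    intro y hy0 hy
    have hpos := (hB y hy0).eigenvalues_pos
    have e0 := sum_log_pencil hρ hσ hC hy0 le_rfl (by simpa using hρ.1) hy hpos
    have e1 := sum_log_pencil hρ hσ hC hy0 hz (hp z hz).1 hy hpos
    have e2 := sum_log_pencil hρ hσ hC hy0 (by positivity : 0 ≤ 2 * z) (hp (2 * z) (by positivity)).1
      hy hpos
    simp only [add_zero, zero_smul] at e0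
    simp only [Finset.sum_sub_distrib, Finset.sum_add_distrib, Finset.sum_neg_distrib,
      ← Finset.mul_sum]
    linarith
  have key := lintegral_sum_log_second_diff hρ.eigenvalues_nonneg (hp z hz).eigenvalues_nonneg
      (hp (2 * z) (by positivity)).eigenvalues_nonneg ?_ ?_
  · rw [hρ.1.trEnt_eq, (hp z hz).1.trEnt_eq, (hp (2 * z) (by positivity)).1.trEnt_eq, ← key.2]
    refine ⟨key.1, setLIntegral_congr_fun measurableSet_Ioi fun y hy => ?_⟩
    simp only [mem_Ioi] at hy
    rw [← hlog y hy (hB y hy).1, ← lintegral_diffKernel_mul_countLT (hB y hy).1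
      (hB y hy).eigenvalues_pos hz]
    exact setLIntegral_congr_fun measurableSet_Ioi fun s _ => by
      simp only [countLT_pencil hC hCD s y (h s) (hB y hy).1]
  · simp only [IsHermitian.sum_eigenvalues, trace_add, Complex.add_re, trace_smul, Complex.smul_re,
      smul_eq_mul]
    ring
  · intro y hy
    rw [← hlog y hy (hB y hy).1]
    exact Finset.sum_nonneg fun i _ => two_mul_log_sub_nonneg hz ((hB y hy).eigenvalues_pos i)

end Matrix

lemma entFun_bregman_nonneg {a b : ℝ} (ha : 0 ≤ a) (hb : 0 < b) :
    0 ≤ entFun a - entFun b - (a - b) * Real.log b := by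
  rcases ha.eq_or_lt with rfl | ha
  · simp only [entFun]
    nlinarith
  · have := Real.log_le_sub_one_of_pos (div_pos hb ha)
    rw [Real.log_div hb.ne' ha.ne'] at this
    have h2 := mul_le_mul_of_nonneg_left this ha.le
    have : a * (b / a - 1) = b - a := by field_simp
    simp only [entFun]
    nlinarith

lemma entFun_bregman_le {a b : ℝ} (ha : 0 ≤ a) (hb : 0 < b) :
    entFun a - entFun b - (a - b) * Real.log b ≤ (a - b) ^ 2 / b := by
  have hsq : (a - b) ^ 2 / b = a * (a / b - 1) - a + b := by field_simp; ring
  rw [hsq]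
  rcases ha.eq_or_lt with rfl | ha
  · simp only [entFun]
    nlinarith
  · have := Real.log_le_sub_one_of_pos (div_pos ha hb)
    rw [Real.log_div ha.ne' hb.ne'] at this
    have h2 := mul_le_mul_of_nonneg_left this ha.le
    simp only [entFun]
    nlinarith

namespace Matrix

variable {n : Type*} [Fintype n] [DecidableEq n]

/-- The transition probabilities between the eigenbases of `A` and `B`. -/
noncomputable def IsHermitian.overlap {A B : Matrix n n ℂ} (hA : A.IsHermitian)
    (hB : B.IsHermitian) (i j : n) : ℝ :=
  Complex.normSq ((hA.eigUᴴ * hB.eigU) i j)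

lemma re_conjTranspose_mul_diagonal_mul (W : Matrix n n ℂ) (f : n → ℝ) (j : n) :
    ((Wᴴ * diagonal (fun i => (f i : ℂ)) * W) j j).re = ∑ i, Complex.normSq (W i j) * f i := by
  rw [mul_apply, Complex.re_sum]
  refine Finset.sum_congr rfl fun i _ => ?_
  simp only [mul_diagonal, conjTranspose_apply, RCLike.star_def, Complex.mul_re, Complex.mul_im,
    Complex.conj_re, Complex.conj_im, Complex.ofReal_re, Complex.ofReal_im, Complex.normSq_apply]
  ring

lemma IsHermitian.diagIn_eq_sum_overlap {A B : Matrix n n ℂ} (hA : A.IsHermitian)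
    (hB : B.IsHermitian) (j : n) :
    hB.diagIn A j = ∑ i, hA.overlap hB i j * hA.eigenvalues i := by
  unfold overlap
  rw [← re_conjTranspose_mul_diagonal_mul, diagIn]
  nth_rw 1 [hA.eq_eigU_mul]
  simp only [conjTranspose_mul, conjTranspose_conjTranspose, mul_assoc]

lemma IsHermitian.sum_overlap_left {A B : Matrix n n ℂ} (hA : A.IsHermitian)
    (hB : B.IsHermitian) (j : n) : ∑ i, hA.overlap hB i j = 1 := by
  have h := re_conjTranspose_mul_diagonal_mul (hA.eigUᴴ * hB.eigU) (fun _ => 1) j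
  have h2 : (hA.eigUᴴ * hB.eigU)ᴴ * (hA.eigUᴴ * hB.eigU) = 1 := by
    rw [conjTranspose_mul, conjTranspose_conjTranspose, mul_assoc, ← mul_assoc hA.eigU,
      hA.mul_eigU, one_mul, hB.eigU_mul]
  simp only [Complex.ofReal_one, diagonal_one, mul_one, h2, one_apply_eq, Complex.one_re] at h
  exact h.symm

lemma IsHermitian.overlap_comm {A B : Matrix n n ℂ} (hA : A.IsHermitian)
    (hB : B.IsHermitian) (i j : n) : hA.overlap hB i j = hB.overlap hA j i := by
  have : hA.eigUᴴ * hB.eigU = (hB.eigUᴴ * hA.eigU)ᴴ := by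
    rw [conjTranspose_mul, conjTranspose_conjTranspose]
  rw [overlap, overlap, this, conjTranspose_apply, RCLike.star_def, Complex.normSq_conj]

lemma IsHermitian.sum_overlap_right {A B : Matrix n n ℂ} (hA : A.IsHermitian)
    (hB : B.IsHermitian) (i : n) : ∑ j, hA.overlap hB i j = 1 := by
  simp_rw [hA.overlap_comm hB]
  exact hB.sum_overlap_left hA i

lemma IsHermitian.overlap_mul_sq {A B : Matrix n n ℂ} (hA : A.IsHermitian) (hB : B.IsHermitian)
    (z : ℝ) (i j : n) :
    hA.overlap hB i j * (hA.eigenvalues i - z * hB.eigenvalues j) ^ 2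
      = Complex.normSq ((hA.eigUᴴ * (A - z • B) * hB.eigU) i j) := by
  have h1 : hA.eigUᴴ * A = diagonal (fun i => (hA.eigenvalues i : ℂ)) * hA.eigUᴴ := by
    rw [← hA.eigU_conj, mul_assoc _ hA.eigU, hA.mul_eigU, mul_one]
  have h2 : B * hB.eigU = hB.eigU * diagonal (fun i => (hB.eigenvalues i : ℂ)) := by
    rw [← hB.eigU_conj, ← mul_assoc, ← mul_assoc, hB.mul_eigU, one_mul]
  have h3 : hA.eigUᴴ * (A - z • B) * hB.eigU
      = diagonal (fun i => (hA.eigenvalues i : ℂ)) * (hA.eigUᴴ * hB.eigU)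
        - z • (hA.eigUᴴ * hB.eigU * diagonal (fun i => (hB.eigenvalues i : ℂ))) := by
    rw [mul_sub, sub_mul, h1, mul_smul_comm, smul_mul_assoc, mul_assoc _ B, h2]
    simp only [mul_assoc]
  have h4 : (hA.eigUᴴ * (A - z • B) * hB.eigU) i j
      = (hA.eigUᴴ * hB.eigU) i j * ((hA.eigenvalues i - z * hB.eigenvalues j : ℝ) : ℂ) := by
    rw [h3, sub_apply, smul_apply, diagonal_mul, mul_diagonal, Complex.real_smul]
    push_cast
    ring
  rw [h4, Complex.normSq_mul, Complex.normSq_ofReal, overlap]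
  ring

lemma IsHermitian.sum_normSq_conj {A B : Matrix n n ℂ} (hA : A.IsHermitian) (hB : B.IsHermitian)
    (Z : Matrix n n ℂ) :
    ∑ i, ∑ j, Complex.normSq ((hA.eigUᴴ * Z * hB.eigU) i j) = (Zᴴ * Z).trace.re := by
  have h : ((hA.eigUᴴ * Z * hB.eigU)ᴴ * (hA.eigUᴴ * Z * hB.eigU)).trace = (Zᴴ * Z).trace := by
    calc _ = (hB.eigUᴴ * (Zᴴ * (hA.eigU * hA.eigUᴴ) * Z * hB.eigU)).trace := by
          simp only [conjTranspose_mul, conjTranspose_conjTranspose, mul_assoc]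
      _ = _ := by
          rw [trace_mul_comm, hA.mul_eigU, mul_one, mul_assoc, hB.mul_eigU, mul_one]
  rw [← h, trace, Complex.re_sum, Finset.sum_comm]
  refine Finset.sum_congr rfl fun j _ => ?_
  have := re_conjTranspose_mul_diagonal_mul (hA.eigUᴴ * Z * hB.eigU) (fun _ => 1) j
  simp only [Complex.ofReal_one, diagonal_one, mul_one] at this
  rw [diag_apply, this]

lemma tendsto_trEnt_add_smul {ρ σ : Matrix n n ℂ} (hρ : ρ.PosSemidef) (hσ : σ.PosDef) :
    Tendsto (fun z : ℝ => (ρ + z • σ).trEnt - ∑ j, (entFun (z * hσ.1.eigenvalues j)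
      + hσ.1.diagIn ρ j * Real.log (z * hσ.1.eigenvalues j))) atTop (𝓝 0) := by
  have hs := hσ.eigenvalues_pos
  have hbound : ∀ z : ℝ, 0 < z →
      0 ≤ (ρ + z • σ).trEnt - ∑ j, (entFun (z * hσ.1.eigenvalues j)
        + hσ.1.diagIn ρ j * Real.log (z * hσ.1.eigenvalues j)) ∧
      (ρ + z • σ).trEnt - ∑ j, (entFun (z * hσ.1.eigenvalues j)
        + hσ.1.diagIn ρ j * Real.log (z * hσ.1.eigenvalues j))
        ≤ (ρᴴ * ρ).trace.re * (∑ j, (hσ.1.eigenvalues j)⁻¹) * z⁻¹ := by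
    intro z hz
    have hA : (ρ + z • σ).PosSemidef := hρ.add (hσ.posSemidef.smul hz.le)
    have hexp : (ρ + z • σ).trEnt - ∑ j, (entFun (z * hσ.1.eigenvalues j)
        + hσ.1.diagIn ρ j * Real.log (z * hσ.1.eigenvalues j))
        = ∑ i, ∑ j, hA.1.overlap hσ.1 i j * (entFun (hA.1.eigenvalues i)
          - entFun (z * hσ.1.eigenvalues j) - (hA.1.eigenvalues i - z * hσ.1.eigenvalues j)
            * Real.log (z * hσ.1.eigenvalues j)) := by
      have e1 : (ρ + z • σ).trEnt
          = ∑ i, ∑ j, hA.1.overlap hσ.1 i j * entFun (hA.1.eigenvalues i) := by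
        rw [hA.1.trEnt_eq]
        refine Finset.sum_congr rfl fun i _ => ?_
        rw [← Finset.sum_mul, hA.1.sum_overlap_right, one_mul]
      have e2 : ∑ j, (entFun (z * hσ.1.eigenvalues j)
          + hσ.1.diagIn ρ j * Real.log (z * hσ.1.eigenvalues j))
          = ∑ i, ∑ j, hA.1.overlap hσ.1 i j * (entFun (z * hσ.1.eigenvalues j)
            + (hA.1.eigenvalues i - z * hσ.1.eigenvalues j)
              * Real.log (z * hσ.1.eigenvalues j)) := by
        rw [Finset.sum_comm]
        refine Finset.sum_congr rfl fun j _ => ?_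
        have h1 : hσ.1.diagIn ρ j
            = ∑ i, hA.1.overlap hσ.1 i j * (hA.1.eigenvalues i - z * hσ.1.eigenvalues j) := by
          have h2 := hA.1.diagIn_eq_sum_overlap hσ.1 j
          rw [IsHermitian.diagIn_add, IsHermitian.diagIn_smul, IsHermitian.diagIn_self] at h2
          simp only [mul_sub]
          rw [Finset.sum_sub_distrib, ← h2, ← Finset.sum_mul, hA.1.sum_overlap_left]
          ring
        simp only [mul_add, ← mul_assoc]
        rw [Finset.sum_add_distrib, ← Finset.sum_mul, ← Finset.sum_mul, ← h1,
          hA.1.sum_overlap_left, one_mul]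
      rw [e1, e2, ← Finset.sum_sub_distrib]
      refine Finset.sum_congr rfl fun i _ => ?_
      rw [← Finset.sum_sub_distrib]
      exact Finset.sum_congr rfl fun j _ => by ring
    rw [hexp]
    refine ⟨Finset.sum_nonneg fun i _ => Finset.sum_nonneg fun j _ =>
      mul_nonneg (Complex.normSq_nonneg _)
        (entFun_bregman_nonneg (hA.eigenvalues_nonneg i) (mul_pos hz (hs j))), ?_⟩
    rw [← hA.1.sum_normSq_conj hσ.1, Finset.sum_mul, Finset.sum_mul]
    refine Finset.sum_le_sum fun i _ => ?_
    rw [Finset.sum_mul, Finset.sum_mul]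
    refine Finset.sum_le_sum fun j _ => ?_
    have h1 := hA.1.overlap_mul_sq hσ.1 z i j
    rw [add_sub_cancel_right] at h1
    rw [← h1]
    calc _ ≤ hA.1.overlap hσ.1 i j * ((hA.1.eigenvalues i - z * hσ.1.eigenvalues j) ^ 2
          / (z * hσ.1.eigenvalues j)) := mul_le_mul_of_nonneg_left
            (entFun_bregman_le (hA.eigenvalues_nonneg i) (mul_pos hz (hs j)))
            (Complex.normSq_nonneg _)
      _ = hA.1.overlap hσ.1 i j * (hA.1.eigenvalues i - z * hσ.1.eigenvalues j) ^ 2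
          * (hσ.1.eigenvalues j)⁻¹ * z⁻¹ := by
        rw [div_eq_mul_inv, mul_inv]; ring
      _ ≤ _ := by
        refine mul_le_mul_of_nonneg_right (mul_le_mul_of_nonneg_left ?_
          (mul_nonneg (Complex.normSq_nonneg _) (sq_nonneg _))) (inv_pos.2 hz).le
        exact Finset.single_le_sum (f := fun j => (hσ.1.eigenvalues j)⁻¹)
          (fun j _ => (inv_pos.2 (hs j)).le) (Finset.mem_univ j)
  refine squeeze_zero' (g := fun z : ℝ =>
    (ρᴴ * ρ).trace.re * (∑ j, (hσ.1.eigenvalues j)⁻¹) * z⁻¹) ?_ ?_ ?_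
  · filter_upwards [eventually_gt_atTop 0] with z hz using (hbound z hz).1
  · filter_upwards [eventually_gt_atTop 0] with z hz using (hbound z hz).2
  · simpa using tendsto_inv_atTop_zero.const_mul
      ((ρᴴ * ρ).trace.re * ∑ j, (hσ.1.eigenvalues j)⁻¹)

end Matrix

namespace Matrix

lemma IsHermitian.sub_smul {n : Type*} {ρ σ : Matrix n n ℂ} (hρ : ρ.IsHermitian)
    (hσ : σ.IsHermitian) (s : ℝ) : (ρ - s • σ).IsHermitian := hρ.sub (hσ.smul (.all s))

variable {n : Type*} [Fintype n] [DecidableEq n]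

/-- The excess of the trace of the negative part of `ρ - s • σ` over its classical minimum
`max (s - 1) 0` for matrices of trace one. -/
noncomputable def relGap (ρ σ : Matrix n n ℂ) (s : ℝ) : ℝ := (ρ - s • σ).trNeg - max (s - 1) 0

lemma relGap_nonneg {ρ σ : Matrix n n ℂ} (hρ : ρ.IsHermitian) (hσ : σ.IsHermitian)
    (hρ1 : ρ.trace = 1) (hσ1 : σ.trace = 1) (s : ℝ) : 0 ≤ relGap ρ σ s := by
  have h1 := (hρ.sub_smul hσ s).trNeg_neg
  have h2 := trNeg_nonneg (-(ρ - s • σ))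
  rw [h1, trace_sub, trace_smul, hρ1, hσ1] at h2
  simp only [Complex.sub_re, Complex.smul_re, Complex.one_re, smul_eq_mul, mul_one] at h2
  rw [relGap, sub_nonneg]
  exact max_le (by linarith) (trNeg_nonneg _)

lemma monotone_trNeg_sub_smul {ρ σ : Matrix n n ℂ} (hρ : ρ.IsHermitian) (hσ : σ.PosSemidef) :
    Monotone fun s : ℝ => (ρ - s • σ).trNeg := by
  intro s t hst
  have h1 : (ρ - s • σ) = (ρ - t • σ) + (t - s) • σ := by rw [sub_smul]; abel
  have h2 : ((t - s) • σ).PosSemidef := hσ.smul (sub_nonneg.2 hst)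
  simp only
  rw [h1, ← add_zero (ρ - t • σ).trNeg, ← trNeg_eq_zero h2]
  exact trNeg_add_le (hρ.sub_smul hσ.1 t) h2.1

lemma measurable_relGap {ρ σ : Matrix n n ℂ} (hρ : ρ.IsHermitian) (hσ : σ.PosSemidef) :
    Measurable (relGap ρ σ) :=
  (monotone_trNeg_sub_smul hρ hσ).measurable.sub (by fun_prop)

lemma trNeg_sub_smul_self {σ : Matrix n n ℂ} (hσ : σ.PosSemidef) (hσ1 : σ.trace = 1) (s : ℝ) :
    (σ - s • σ).trNeg = max (s - 1) 0 := by
  have h : σ - s • σ = (1 - s) • σ := by rw [sub_smul, one_smul]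
  rcases le_total s 1 with hs | hs
  · rw [h, max_eq_right (by linarith)]
    exact trNeg_eq_zero (hσ.smul (sub_nonneg.2 hs))
  · have h2 : ((s - 1) • σ).PosSemidef := hσ.smul (sub_nonneg.2 hs)
    have h3 : (1 - s) • σ = -((s - 1) • σ) := by rw [← neg_smul, neg_sub]
    rw [h, h3, h2.1.trNeg_neg, trNeg_eq_zero h2, max_eq_left (by linarith), trace_smul, hσ1]
    simp

lemma diffKernel_mono {z w s : ℝ} (hz : 0 ≤ z) (hzw : z ≤ w) (hs : 0 < s) :
    diffKernel z s ≤ diffKernel w s := by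
  have hw : 0 ≤ w := hz.trans hzw
  rw [diffKernel_eq hz hs, diffKernel_eq hw hs, div_le_div_iff₀ (by positivity) (by positivity)]
  have h1 : z * (s + w) ≤ w * (s + z) := by nlinarith
  have h2 : z * (s + 2 * w) ≤ w * (s + 2 * z) := by nlinarith
  have := mul_le_mul h1 h2 (by positivity) (by positivity)
  nlinarith

lemma tendsto_diffKernel (s : ℝ) : Tendsto (fun z => diffKernel z s) atTop (𝓝 (1 / s)) := by
  have h1 : Tendsto (fun z : ℝ => 2 / (s + z)) atTop (𝓝 0) :=
    (tendsto_atTop_add_const_left _ s tendsto_id).const_div_atTop 2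
  have h2 : Tendsto (fun z : ℝ => 1 / (s + 2 * z)) atTop (𝓝 0) :=
    (tendsto_atTop_add_const_left _ s (tendsto_id.const_mul_atTop two_pos)).const_div_atTop 1
  have h3 := ((tendsto_const_nhds (x := 1 / s)).sub h1).add h2
  rwa [sub_zero, add_zero] at h3

lemma lintegral_diffKernel_mul_relGap {ρ σ : Matrix n n ℂ} (hρ : ρ.PosSemidef) (hσ : σ.PosDef)
    (hρ1 : ρ.trace = 1) (hσ1 : σ.trace = 1) {z : ℝ} (hz : 0 ≤ z) :
    let T : ℝ := ρ.trEnt - 2 * (ρ + z • σ).trEnt + (ρ + (2 * z) • σ).trEnt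
      - (σ.trEnt - 2 * (σ + z • σ).trEnt + (σ + (2 * z) • σ).trEnt)
    0 ≤ T ∧ ∫⁻ s in Ioi (0 : ℝ), ENNReal.ofReal (diffKernel z s) * ENNReal.ofReal (relGap ρ σ s)
      = ENNReal.ofReal T := by
  intro T
  obtain ⟨hρ0, hρI⟩ := lintegral_diffKernel_mul_trNeg hρ hσ hz
  obtain ⟨hσ0, hσI⟩ := lintegral_diffKernel_mul_trNeg hσ.posSemidef hσ hz
  have hm := (measurable_diffKernel z).ennreal_ofReal
  have hsum : ∫⁻ s in Ioi (0 : ℝ), ENNReal.ofReal (diffKernel z s) * ENNReal.ofReal (ρ - s • σ).trNeg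
      = (∫⁻ s in Ioi (0 : ℝ), ENNReal.ofReal (diffKernel z s) * ENNReal.ofReal (relGap ρ σ s))
        + ∫⁻ s in Ioi (0 : ℝ), ENNReal.ofReal (diffKernel z s)
          * ENNReal.ofReal (σ - s • σ).trNeg := by
    rw [← lintegral_add_left (by
      exact hm.mul (measurable_relGap hρ.1 hσ.posSemidef).ennreal_ofReal)]
    refine lintegral_congr fun s => ?_
    rw [← mul_add, ← ENNReal.ofReal_add (relGap_nonneg hρ.1 hσ.1 hρ1 hσ1 s) (trNeg_nonneg _),
      trNeg_sub_smul_self hσ.posSemidef hσ1, relGap, sub_add_cancel]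
  rw [hρI, hσI] at hsum
  have hle : σ.trEnt - 2 * (σ + z • σ).trEnt + (σ + (2 * z) • σ).trEnt
      ≤ ρ.trEnt - 2 * (ρ + z • σ).trEnt + (ρ + (2 * z) • σ).trEnt := by
    rw [← ENNReal.ofReal_le_ofReal_iff hρ0, hsum]
    exact le_add_self
  refine ⟨sub_nonneg.2 hle, ?_⟩
  rw [ENNReal.ofReal_sub _ hσ0, hsum, ENNReal.add_sub_cancel_right ENNReal.ofReal_ne_top]

lemma IsHermitian.matLog_eq {d : ℕ} {A : Matrix (Fin d) (Fin d) ℂ} (hA : A.IsHermitian) :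
    matLog A = hA.cfc Real.log := dif_pos hA

lemma relEnt_eq {d : ℕ} {ρ σ : Matrix (Fin d) (Fin d) ℂ} (hρ : ρ.IsHermitian)
    (hσ : σ.IsHermitian) :
    relEnt ρ σ = ∑ i, hρ.eigenvalues i * Real.log (hρ.eigenvalues i)
      - ∑ j, hσ.diagIn ρ j * Real.log (hσ.eigenvalues j) := by
  rw [relEnt, mul_sub, trace_sub, Complex.sub_re, hρ.matLog_eq, hσ.matLog_eq, hρ.trace_mul_cfc,
    hσ.trace_mul_cfc]
  simp only [hρ.diagIn_self]

lemma relEnt_nonneg_and_lintegral {d : ℕ} {ρ σ : Matrix (Fin d) (Fin d) ℂ} (hρ : ρ.PosSemidef)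
    (hσ : σ.PosDef) (hρ1 : ρ.trace = 1) (hσ1 : σ.trace = 1) :
    0 ≤ relEnt ρ σ ∧
    ∫⁻ s in Ioi (0 : ℝ), ENNReal.ofReal (relGap ρ σ s / s) = ENNReal.ofReal (relEnt ρ σ) := by
  have hs := hσ.eigenvalues_pos
  have hgap := relGap_nonneg hρ.1 hσ.1 hρ1 hσ1
  have hlim : Tendsto (fun z : ℝ => ρ.trEnt - 2 * (ρ + z • σ).trEnt + (ρ + (2 * z) • σ).trEnt
      - (σ.trEnt - 2 * (σ + z • σ).trEnt + (σ + (2 * z) • σ).trEnt)) atTop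
      (𝓝 (relEnt ρ σ)) := by
    have h2 : Tendsto (fun z : ℝ => 2 * z) atTop atTop := tendsto_id.const_mul_atTop two_pos
    have tρ := tendsto_trEnt_add_smul hρ hσ
    have tσ := tendsto_trEnt_add_smul hσ.posSemidef hσ
    have t := ((tρ.sub tσ).const_mul (-2)).add ((tρ.comp h2).sub (tσ.comp h2))
    have t' := t.add_const (relEnt ρ σ)
    simp only [sub_self, mul_zero, add_zero, zero_add] at t'
    refine t'.congr' ?_
    filter_upwards [eventually_gt_atTop 0] with z hz
    have hG : ∀ z : ℝ, 0 < z → ∑ j, (entFun (z * hσ.1.eigenvalues j)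
          + hσ.1.diagIn ρ j * Real.log (z * hσ.1.eigenvalues j))
        - ∑ j, (entFun (z * hσ.1.eigenvalues j)
          + hσ.1.diagIn σ j * Real.log (z * hσ.1.eigenvalues j))
        = ∑ j, hσ.1.diagIn ρ j * Real.log (hσ.1.eigenvalues j)
          - ∑ j, hσ.1.eigenvalues j * Real.log (hσ.1.eigenvalues j) := by
      intro z hz
      have e1 : ∑ j, hσ.1.diagIn ρ j * Real.log z - ∑ j, hσ.1.eigenvalues j * Real.log z = 0 := by
        rw [← Finset.sum_mul, ← Finset.sum_mul, hσ.1.sum_diagIn, hσ.1.sum_eigenvalues, hρ1, hσ1,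
          sub_self]
      rw [← sub_eq_zero, ← e1]
      simp only [← Finset.sum_sub_distrib, hσ.1.diagIn_self]
      refine Finset.sum_congr rfl fun j _ => ?_
      rw [Real.log_mul hz.ne' (hs j).ne']
      ring
    have hT : ρ.trEnt - σ.trEnt = ∑ i, hρ.1.eigenvalues i * Real.log (hρ.1.eigenvalues i)
        - ∑ j, hσ.1.eigenvalues j * Real.log (hσ.1.eigenvalues j) := by
      rw [hρ.1.trEnt_eq, hσ.1.trEnt_eq]
      simp only [entFun, Finset.sum_sub_distrib, IsHermitian.sum_eigenvalues, hρ1, hσ1]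
      ring
    have g1 := hG z hz
    have g2 := hG (2 * z) (by positivity)
    have g3 := relEnt_eq hρ.1 hσ.1
    simp only [Function.comp]
    linarith
  refine ⟨ge_of_tendsto hlim ?_, ?_⟩
  · filter_upwards [eventually_ge_atTop 0] with z hz using
      (lintegral_diffKernel_mul_relGap hρ hσ hρ1 hσ1 hz).1
  have hmono := lintegral_tendsto_of_tendsto_of_monotone (μ := volume.restrict (Ioi (0 : ℝ)))
    (f := fun (k : ℕ) s => ENNReal.ofReal (diffKernel k s) * ENNReal.ofReal (relGap ρ σ s))
    (F := fun s => ENNReal.ofReal (relGap ρ σ s / s))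
    (fun k => ((measurable_diffKernel k).ennreal_ofReal.mul
      (measurable_relGap hρ.1 hσ.posSemidef).ennreal_ofReal).aemeasurable)
    ((ae_restrict_iff' measurableSet_Ioi).2 <| ae_of_all _ fun s hs k l hkl =>
      mul_le_mul_left (ENNReal.ofReal_le_ofReal
        (diffKernel_mono k.cast_nonneg (Nat.cast_le.2 hkl) hs)) _)
    ((ae_restrict_iff' measurableSet_Ioi).2 <| ae_of_all _ fun s hs => by
      have h := ((tendsto_diffKernel s).comp tendsto_natCast_atTop_atTop).mul_const (relGap ρ σ s)
      have h' := ENNReal.tendsto_ofReal h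
      rw [one_div_mul_eq_div] at h'
      refine h'.congr fun k => ?_
      simp only [Function.comp]
      rw [ENNReal.ofReal_mul (diffKernel_nonneg k.cast_nonneg hs)])
  refine tendsto_nhds_unique hmono ?_
  refine (ENNReal.tendsto_ofReal (hlim.comp tendsto_natCast_atTop_atTop)).congr fun k => ?_
  exact (lintegral_diffKernel_mul_relGap hρ hσ hρ1 hσ1 k.cast_nonneg).2.symm

end Matrix

namespace Matrix

variable {n : Type*} [Fintype n] [DecidableEq n]

lemma relGap_of_le_one (ρ σ : Matrix n n ℂ) {s : ℝ} (hs : s ≤ 1) :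
    relGap ρ σ s = (ρ - s • σ).trNeg := by
  rw [relGap, max_eq_right (by linarith), sub_zero]

lemma relGap_of_one_le {ρ σ : Matrix n n ℂ} (hρ : ρ.IsHermitian) (hσ : σ.IsHermitian)
    (hρ1 : ρ.trace = 1) (hσ1 : σ.trace = 1) {s : ℝ} (hs : 1 ≤ s) :
    relGap ρ σ s = (-(ρ - s • σ)).trNeg := by
  rw [relGap, max_eq_left (by linarith), (hρ.sub_smul hσ s).trNeg_neg, trace_sub, trace_smul,
    hρ1, hσ1]
  simp only [Complex.sub_re, Complex.smul_re, Complex.one_re, smul_eq_mul]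
  ring

lemma relGap_map_le {Φ : Matrix n n ℂ →ₗ[ℂ] Matrix n n ℂ}
    (hpos : ∀ X : Matrix n n ℂ, X.PosSemidef → (Φ X).PosSemidef)
    (htr : ∀ X : Matrix n n ℂ, (Φ X).trace = X.trace) {ρ σ : Matrix n n ℂ} (hρ : ρ.IsHermitian)
    (hσ : σ.IsHermitian) (s : ℝ) : relGap (Φ ρ) (Φ σ) s ≤ relGap ρ σ s := by
  have h := trNeg_map_le hpos htr (hρ.sub_smul hσ s)
  rw [map_sub, LinearMap.map_smul_of_tower] at h
  exact sub_le_sub_right h _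

lemma relGap_eq_zero_of_le {ρ σ : Matrix n n ℂ} (hρ : ρ.IsHermitian) (hσ : σ.IsHermitian)
    (hρ1 : ρ.trace = 1) (hσ1 : σ.trace = 1) {c : ℝ} (hc : 1 ≤ c) (h : (c • σ - ρ).PosSemidef) :
    relGap ρ σ c = 0 := by
  rw [relGap_of_one_le hρ hσ hρ1 hσ1 hc, neg_sub, trNeg_eq_zero h]

variable {ρ ω η : Matrix n n ℂ}

lemma sub_smul_mix {m : Type*} (ρ ω η : Matrix m m ℂ) (ζ s t : ℝ) :
    ρ - (s * (1 - ζ + ζ * t)) • ω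
      = (ρ - s • ((1 - ζ) • ω + ζ • η)) + (s * ζ) • (η - t • ω) := by
  simp only [smul_add, smul_sub, smul_smul]
  have : (s * (1 - ζ + ζ * t)) • ω = (s * (1 - ζ)) • ω + (s * ζ * t) • ω := by
    rw [← add_smul]; congr 1; ring
  rw [this]
  abel

lemma relGap_mix_le_of_le_one (hρ : ρ.IsHermitian) (hω : ω.IsHermitian) (hη : η.IsHermitian)
    {ζ s t : ℝ} (hζ : 0 ≤ ζ) (hs : 0 ≤ s) (hs1 : s ≤ 1) (ht1 : t ≤ 1) :
    relGap ρ ω (s * (1 - ζ + ζ * t))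
      ≤ relGap ρ ((1 - ζ) • ω + ζ • η) s + s * ζ * relGap η ω t := by
  have hσ : ((1 - ζ) • ω + ζ • η).IsHermitian := (hω.smul (.all _)).add (hη.smul (.all _))
  have h1 : s * (1 - ζ + ζ * t) ≤ 1 := by
    have : 1 - ζ + ζ * t ≤ 1 := by nlinarith
    nlinarith
  rw [relGap_of_le_one _ _ h1, relGap_of_le_one _ _ hs1, relGap_of_le_one _ _ ht1,
    sub_smul_mix ρ ω η]
  have h2 := hη.sub_smul hω t
  exact (trNeg_add_le (hρ.sub_smul hσ s) (h2.smul (.all _))).trans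
    (add_le_add_right (trNeg_smul_le h2 (mul_nonneg hs hζ)) _)

lemma relGap_mix_le_of_one_le (hρ : ρ.IsHermitian) (hω : ω.IsHermitian) (hη : η.IsHermitian)
    (hρ1 : ρ.trace = 1) (hω1 : ω.trace = 1) (hη1 : η.trace = 1)
    {ζ s t : ℝ} (hζ : 0 ≤ ζ) (hs : 1 ≤ s) (ht : 1 ≤ t) :
    relGap ρ ω (s * (1 - ζ + ζ * t))
      ≤ relGap ρ ((1 - ζ) • ω + ζ • η) s + s * ζ * relGap η ω t := by
  have hσ : ((1 - ζ) • ω + ζ • η).IsHermitian := (hω.smul (.all _)).add (hη.smul (.all _))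
  have hσ1 : ((1 - ζ) • ω + ζ • η).trace = 1 := by
    rw [trace_add, trace_smul, trace_smul, hω1, hη1, ← add_smul, sub_add_cancel, one_smul]
  have h1 : 1 ≤ s * (1 - ζ + ζ * t) := by
    have : 1 ≤ 1 - ζ + ζ * t := by nlinarith
    nlinarith
  rw [relGap_of_one_le hρ hω hρ1 hω1 h1, relGap_of_one_le hρ hσ hρ1 hσ1 hs,
    relGap_of_one_le hη hω hη1 hω1 ht, sub_smul_mix ρ ω η, neg_add, ← smul_neg]
  have h2 := (hη.sub_smul hω t).neg
  exact (trNeg_add_le (hρ.sub_smul hσ s).neg (h2.smul (.all _))).trans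
    (add_le_add_right (trNeg_smul_le h2 (mul_nonneg (by linarith) hζ)) _)

end Matrix

lemma lintegral_image_le_of_deriv_le {f g : ℝ → ℝ} {A B : Set ℝ} (hA : MeasurableSet A)
    {u u' : ℝ → ℝ} (hu : ∀ s ∈ A, HasDerivAt u (u' s) s) (hinj : InjOn u A) (hB : B ⊆ u '' A)
    {R : ℝ} (hR : 0 ≤ R) (hle : ∀ s ∈ A, R * (|u' s| * f (u s)) ≤ g s) :
    ENNReal.ofReal R * ∫⁻ x in B, ENNReal.ofReal (f x) ≤ ∫⁻ s in A, ENNReal.ofReal (g s) := by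
  calc _ ≤ ENNReal.ofReal R * ∫⁻ x in u '' A, ENNReal.ofReal (f x) := by
        gcongr
    _ = ∫⁻ s in A, ENNReal.ofReal R * (ENNReal.ofReal |u' s| * ENNReal.ofReal (f (u s))) := by
        rw [lintegral_image_eq_lintegral_abs_deriv_mul hA
          (fun s hs => (hu s hs).hasDerivWithinAt) hinj, lintegral_const_mul' _ _
          ENNReal.ofReal_ne_top]
    _ ≤ _ := by
        refine setLIntegral_mono' hA fun s hs => ?_
        rw [← ENNReal.ofReal_mul (abs_nonneg _), ← ENNReal.ofReal_mul hR]
        exact ENNReal.ofReal_le_ofReal (hle s hs)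

lemma mul_le_of_lintegral_pieces {J0 J1 J2 K0 K1 K2 : ENNReal} {DP DQ r0 R x y β : ℝ}
    (hx : 0 ≤ x) (hy : 0 ≤ y) (hr0 : 0 ≤ r0) (hR : 0 ≤ R) (hR1 : R ≤ 1) (hDP : 0 ≤ DP)
    (hDQ : 0 ≤ DQ) (hJ : ENNReal.ofReal DP = J0 + (J1 + J2))
    (hK : ENNReal.ofReal DQ = K0 + (K1 + K2))
    (h0 : ENNReal.ofReal r0 * J0 ≤ K0 + ENNReal.ofReal x * J0)
    (h1 : ENNReal.ofReal R * J1 ≤ K1 + ENNReal.ofReal y * (J1 + J2)) (h2 : J2 ≤ K2)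
    (hβ0 : β ≤ r0 - x) (hβ1 : β ≤ R - y) : β * DP ≤ DQ := by
  have hJt : J0 + (J1 + J2) ≠ ⊤ := by rw [← hJ]; exact ENNReal.ofReal_ne_top
  have hKt : K0 + (K1 + K2) ≠ ⊤ := by rw [← hK]; exact ENNReal.ofReal_ne_top
  simp only [ne_eq, ENNReal.add_eq_top, not_or] at hJt hKt
  obtain ⟨j0, j1, j2⟩ := hJt
  obtain ⟨k0, k1, k2⟩ := hKt
  lift J0 to NNReal using j0
  lift J1 to NNReal using j1
  lift J2 to NNReal using j2
  lift K0 to NNReal using k0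
  lift K1 to NNReal using k1
  lift K2 to NNReal using k2
  lift DP to NNReal using hDP
  lift DQ to NNReal using hDQ
  lift r0 to NNReal using hr0
  lift R to NNReal using hR
  lift x to NNReal using hx
  lift y to NNReal using hy
  simp only [ENNReal.ofReal_coe_nnreal] at hJ hK h0 h1
  have e0 : (DP : ℝ) = J0 + (J1 + J2) := by exact_mod_cast hJ
  have e1 : (DQ : ℝ) = K0 + (K1 + K2) := by exact_mod_cast hK
  have e2 : (r0 : ℝ) * J0 ≤ K0 + x * J0 := by exact_mod_cast h0
  have e3 : (R : ℝ) * J1 ≤ K1 + y * (J1 + J2) := by exact_mod_cast h1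
  have e4 : (J2 : ℝ) ≤ K2 := by exact_mod_cast h2
  have f0 := mul_le_mul_of_nonneg_right hβ0 J0.coe_nonneg
  have f1 := mul_le_mul_of_nonneg_right hβ1 (add_nonneg J1.coe_nonneg J2.coe_nonneg)
  have f2 := mul_le_mul_of_nonneg_right hR1 J2.coe_nonneg
  rw [e0, e1]
  nlinarith

/-- The integral transport estimate behind the perturbation bound: if `P` at the dilated point
`s * (1 - ζ + ζ * t)` is controlled by `Q s` and `P t`, then `∫ P / s` is controlled by
`∫ Q / s`. -/
lemma mul_le_of_lintegral_div {P Q : ℝ → ℝ} {ζ a DP DQ : ℝ} (hζ : 0 < ζ) (hζ1 : ζ < 1)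
    (ha : 1 ≤ a) (hζa : ζ * a ≤ 1) (hPm : Measurable P) (hP : ∀ s, 0 ≤ P s) (hQ : ∀ s, 0 ≤ Q s)
    (h0 : ∀ s t, 0 ≤ s → s ≤ 1 → t ≤ 1 → P (s * (1 - ζ + ζ * t)) ≤ Q s + s * ζ * P t)
    (h1 : ∀ s t, 1 ≤ s → 1 ≤ t → P (s * (1 - ζ + ζ * t)) ≤ Q s + s * ζ * P t)
    (h2 : ∀ s, 1 ≤ s → P (s * (1 - ζ + ζ * a ^ 2)) ≤ Q s) (hDP : 0 ≤ DP) (hDQ : 0 ≤ DQ)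
    (hPI : ∫⁻ s in Ioi (0 : ℝ), ENNReal.ofReal (P s / s) = ENNReal.ofReal DP)
    (hQI : ∫⁻ s in Ioi (0 : ℝ), ENNReal.ofReal (Q s / s) = ENNReal.ofReal DQ)
    {β : ℝ} (hβ0 : β ≤ 1 / (1 + ζ) - ζ)
    (hβ1 : β ≤ (1 + ζ * (a ^ 2 - 1)) / (1 + 2 * (ζ * (a ^ 2 - 1)) + ζ * a) - ζ * a) :
    β * DP ≤ DQ := by
  have ha0 : 0 < a := by linarith
  have ha2 : 1 ≤ a ^ 2 := by nlinarith
  set m : ℝ := 1 + (a ^ 2 - 1) / a with hm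
  set g : ℝ := 1 - ζ + ζ * a ^ 2 with hg
  have hm1 : 1 ≤ m := by
    have : 0 ≤ (a ^ 2 - 1) / a := div_nonneg (by linarith) ha0.le
    linarith
  have ham : a * (m - 1) = a ^ 2 - 1 := by rw [hm]; field_simp; ring
  have hg1 : 1 ≤ g := by nlinarith
  have hmg : 1 ≤ m * g := by nlinarith
  have hsplit : ∀ (F : ℝ → ℝ) (x : ℝ), 1 ≤ x → ∫⁻ s in Ioi (0 : ℝ), ENNReal.ofReal (F s)
      = (∫⁻ s in Ioc 0 1, ENNReal.ofReal (F s)) + ((∫⁻ s in Ioc 1 x, ENNReal.ofReal (F s))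
        + ∫⁻ s in Ioi x, ENNReal.ofReal (F s)) := by
    intro F x hx
    rw [← Ioc_union_Ioi_eq_Ioi (zero_le_one' ℝ), ← Ioc_union_Ioi_eq_Ioi hx,
      lintegral_union (measurableSet_Ioc.union measurableSet_Ioi),
      lintegral_union measurableSet_Ioi]
    · exact Ioc_disjoint_Ioi le_rfl
    · rw [Ioc_union_Ioi_eq_Ioi hx]
      exact Ioc_disjoint_Ioi le_rfl
  have hA0 : ENNReal.ofReal (1 / (1 + ζ)) * ∫⁻ s in Ioc (0 : ℝ) 1, ENNReal.ofReal (P s / s)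
      ≤ (∫⁻ s in Ioc (0 : ℝ) 1, ENNReal.ofReal (Q s / s))
        + ENNReal.ofReal ζ * ∫⁻ s in Ioc (0 : ℝ) 1, ENNReal.ofReal (P s / s) := by
    refine (lintegral_image_le_of_deriv_le (A := Ioc 0 1)
      (g := fun s => Q s / s + ζ * (P s / s))
      (u := fun s => s * (1 - ζ + ζ * s)) (u' := fun s => 1 - ζ + 2 * ζ * s)
      measurableSet_Ioc ?_ ?_ ?_ (by positivity) ?_).trans ?_
    · intro s _
      refine ((hasDerivAt_id s).mul (((hasDerivAt_id s).const_mul ζ).const_add (1 - ζ))).congr_deriv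
        ?_
      simp only [id]; ring
    · intro s hs t ht hst
      simp only at hst
      have : (s - t) * (1 - ζ + ζ * (s + t)) = 0 := by linear_combination hst
      rcases mul_eq_zero.1 this with h | h
      · linarith
      · nlinarith [hs.1, ht.1]
    · have := intermediate_value_Ioc (zero_le_one' ℝ) (f := fun s => s * (1 - ζ + ζ * s))
        (by fun_prop)
      have e0 : (0 : ℝ) * (1 - ζ + ζ * 0) = 0 := by ring
      have e1 : (1 : ℝ) * (1 - ζ + ζ * 1) = 1 := by ring
      rwa [e0, e1] at this
    · intro s hs
      have hs0 := hs.1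
      have hb : 0 < 1 - ζ + ζ * s := by nlinarith
      have hb' : 0 < 1 - ζ + 2 * ζ * s := by nlinarith
      have hu := h0 s s hs0.le hs.2 hs.2
      rw [abs_of_pos hb']
      have hk : 1 / (1 + ζ) * (1 - ζ + 2 * ζ * s) / (s * (1 - ζ + ζ * s)) ≤ 1 / s := by
        rw [div_le_div_iff₀ (by positivity) hs0, one_div_mul_eq_div, div_mul_eq_mul_div,
          div_le_iff₀ (by positivity)]
        nlinarith [mul_nonneg hs0.le (mul_nonneg (mul_nonneg hζ.le (sub_nonneg.2 hs.2))
          (sub_nonneg.2 hζ1.le))]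
      calc _ = 1 / (1 + ζ) * (1 - ζ + 2 * ζ * s) / (s * (1 - ζ + ζ * s))
            * P (s * (1 - ζ + ζ * s)) := by ring
        _ ≤ 1 / s * (Q s + s * ζ * P s) := by
            gcongr
            exact hP _
        _ = Q s / s + ζ * P s := by field_simp
        _ ≤ _ := by
            gcongr
            rw [le_div_iff₀ hs0]
            nlinarith [hP s, hs.2]
    · rw [← lintegral_const_mul' _ _ ENNReal.ofReal_ne_top, ← lintegral_add_right _ (by fun_prop)]
      refine setLIntegral_mono' measurableSet_Ioc fun s hs => ?_
      have hs0 := hs.1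
      rw [ENNReal.ofReal_add (div_nonneg (hQ s) hs0.le)
        (mul_nonneg hζ.le (div_nonneg (hP s) hs0.le)), ENNReal.ofReal_mul hζ.le]
  set w : ℝ := ζ * (a ^ 2 - 1) with hw
  have hw0 : 0 ≤ w := mul_nonneg hζ.le (by linarith)
  set R : ℝ := (1 + w) / (1 + 2 * w + ζ * a) with hRdef
  have hR0 : 0 ≤ R := by positivity
  have hA1 : ENNReal.ofReal R * ∫⁻ s in Ioc (1 : ℝ) (m * g), ENNReal.ofReal (P s / s)
      ≤ (∫⁻ s in Ioc (1 : ℝ) m, ENNReal.ofReal (Q s / s))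
        + ∫⁻ s in Ioc (1 : ℝ) m, ENNReal.ofReal (ζ * P (1 + a * (s - 1))) := by
    refine (lintegral_image_le_of_deriv_le (A := Ioc 1 m)
      (g := fun s => Q s / s + ζ * P (1 + a * (s - 1)))
      (u := fun s => s * (1 + ζ * a * (s - 1))) (u' := fun s => 1 + ζ * a * (2 * s - 1))
      measurableSet_Ioc ?_ ?_ ?_ hR0 ?_).trans ?_
    · intro s _
      refine ((hasDerivAt_id s).mul
        ((((hasDerivAt_id s).sub_const 1).const_mul (ζ * a)).const_add 1)).congr_deriv ?_
      simp only [id]; ring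
    · intro s hs t ht hst
      simp only at hst
      have hz : 0 < ζ * a := by positivity
      have : (s - t) * (1 - ζ * a + ζ * a * (s + t)) = 0 := by linear_combination hst
      rcases mul_eq_zero.1 this with h | h
      · linarith
      · nlinarith [hs.1, ht.1]
    · have := intermediate_value_Ioc hm1 (f := fun s => s * (1 + ζ * a * (s - 1)))
        (by fun_prop)
      have e0 : (1 : ℝ) * (1 + ζ * a * (1 - 1)) = 1 := by ring
      have e1 : 1 + ζ * a * (m - 1) = g := by rw [mul_assoc, ham, hg]; ring
      rwa [e0, e1] at this
    · intro s hs
      have hs0 : 0 < s := by linarith [hs.1]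
      set v : ℝ := ζ * a * (s - 1) with hv
      have hv0 : 0 ≤ v := mul_nonneg (by positivity) (by linarith [hs.1])
      have hvw : v ≤ w := by
        rw [hv, hw, ← ham, mul_assoc]
        have := hs.2
        gcongr
      have hu' : 1 + ζ * a * (2 * s - 1) = 1 + 2 * v + ζ * a := by rw [hv]; ring
      have hu := h1 s (1 + a * (s - 1)) hs.1.le (by nlinarith [hs.1])
      have hue : 1 - ζ + ζ * (1 + a * (s - 1)) = 1 + v := by rw [hv]; ring
      rw [hue] at hu
      rw [hu', abs_of_pos (by positivity)]
      have hk : R * (1 + 2 * v + ζ * a) / (s * (1 + v)) ≤ 1 / s := by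
        rw [div_le_div_iff₀ (by positivity) hs0, hRdef, div_mul_eq_mul_div, div_mul_eq_mul_div,
          div_le_iff₀ (by positivity)]
        nlinarith [mul_nonneg hs0.le (mul_nonneg (sub_nonneg.2 hvw) (sub_nonneg.2 hζa))]
      calc _ = R * (1 + 2 * v + ζ * a) / (s * (1 + v)) * P (s * (1 + v)) := by ring
        _ ≤ 1 / s * (Q s + s * ζ * P (1 + a * (s - 1))) := by
            gcongr
            exact hP _
        _ = _ := by field_simp
    · rw [← lintegral_add_right _ (by fun_prop)]
      refine setLIntegral_mono' measurableSet_Ioc fun s hs => ?_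
      rw [ENNReal.ofReal_add (div_nonneg (hQ s) (by linarith [hs.1])) (mul_nonneg hζ.le (hP _))]
  have hA1' : ∫⁻ s in Ioc (1 : ℝ) m, ENNReal.ofReal (ζ * P (1 + a * (s - 1)))
      ≤ ENNReal.ofReal (ζ * a) * ∫⁻ s in Ioi (1 : ℝ), ENNReal.ofReal (P s / s) := by
    have himg : (fun s => 1 + a * (s - 1)) '' Ioc 1 m ⊆ Ioi 1 := by
      rintro _ ⟨s, hs, rfl⟩
      simp only [mem_Ioi]
      nlinarith [hs.1]
    calc _ ≤ ENNReal.ofReal (ζ * a) * ∫⁻ s in (fun s => 1 + a * (s - 1)) '' Ioc 1 m,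
          ENNReal.ofReal (P s / s) := by
          rw [lintegral_image_eq_lintegral_abs_deriv_mul (f := fun s => 1 + a * (s - 1))
            (f' := fun _ => a) measurableSet_Ioc
            (fun s _ => ((((hasDerivAt_id s).sub_const 1).const_mul a).const_add
              1).congr_deriv (by ring) |>.hasDerivWithinAt)
            (fun s _ t _ hst => by
              have : a * (s - t) = 0 := by simp only at hst; linear_combination hst
              rcases mul_eq_zero.1 this with h | h <;> linarith),
            ← lintegral_const_mul' _ _ ENNReal.ofReal_ne_top]
          refine setLIntegral_mono' measurableSet_Ioc fun s hs => ?_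
          have ht : 0 < 1 + a * (s - 1) := by nlinarith [hs.1]
          have ht2 : 1 + a * (s - 1) ≤ a ^ 2 := by
            have : a * (s - 1) ≤ a * (m - 1) := by have := hs.2; gcongr
            linarith
          rw [abs_of_pos ha0, ← ENNReal.ofReal_mul ha0.le, ← ENNReal.ofReal_mul (by positivity)]
          refine ENNReal.ofReal_le_ofReal ?_
          have : P (1 + a * (s - 1)) ≤ a ^ 2 * (P (1 + a * (s - 1)) / (1 + a * (s - 1))) := by
            rw [mul_div_assoc', le_div_iff₀ ht, mul_comm]
            exact mul_le_mul_of_nonneg_right ht2 (hP _)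
          calc _ ≤ ζ * (a ^ 2 * (P (1 + a * (s - 1)) / (1 + a * (s - 1)))) := by gcongr
            _ = _ := by ring
      _ ≤ _ := by gcongr
  have hA2 : ∫⁻ s in Ioi (m * g), ENNReal.ofReal (P s / s)
      ≤ ∫⁻ s in Ioi m, ENNReal.ofReal (Q s / s) := by
    have hg0 : 0 < g := by linarith
    have := lintegral_image_le_of_deriv_le (f := fun s => P s / s) (g := fun s => Q s / s)
      (A := Ioi m) (B := Ioi (m * g)) (u := fun s => s * g) (u' := fun _ => g) (R := 1)
      measurableSet_Ioi (fun s _ => by simpa using (hasDerivAt_id s).mul_const g)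
      (fun s _ t _ hst => mul_right_cancel₀ hg0.ne' hst)
      (fun x hx => ⟨x / g, by rw [mem_Ioi, lt_div_iff₀ hg0]; exact hx, by field_simp⟩)
      zero_le_one (fun s hs => by
        have hs1 : 1 ≤ s := hm1.trans (le_of_lt hs)
        have hs0 : 0 < s := by linarith
        rw [abs_of_pos hg0, one_mul]
        calc _ = P (s * g) / s := by field_simp
          _ ≤ _ := by gcongr; exact h2 s hs1)
    simpa using this
  have hR1 : R ≤ 1 := by
    rw [hRdef, div_le_one (by positivity)]
    nlinarith
  have hPs := hsplit (fun s => P s / s) (m * g) hmg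
  have hQs := hsplit (fun s => Q s / s) m hm1
  rw [hPI] at hPs
  rw [hQI] at hQs
  rw [← Ioc_union_Ioi_eq_Ioi hmg, lintegral_union measurableSet_Ioi (Ioc_disjoint_Ioi le_rfl)]
    at hA1'
  exact mul_le_of_lintegral_pieces hζ.le (by positivity) (by positivity) hR0 hR1 hDP hDQ hPs hQs hA0
    (hA1.trans (add_le_add_right hA1' _)) hA2 hβ0 hβ1

lemma kappa_lower {q : ℝ} (hq : 1 < q) :
    0 < q ^ 4 * (Real.log (q ^ 4) - 1) + 1 ∧
    (q + 1) * (q ^ 2 + 1) / 4 ≤ (q ^ 4 - 1) ^ 2 / (q ^ 4 * (Real.log (q ^ 4) - 1) + 1) := by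
  have hq0 : 0 < q := by linarith
  have hc : 1 < q ^ 4 := one_lt_pow₀ hq (by norm_num)
  have hlog : Real.log (q ^ 4) ≤ q ^ 4 - 1 := Real.log_le_sub_one_of_pos (by positivity)
  have hlog4 : Real.log (q ^ 4) ≤ 4 * (q - 1) := by
    have := Real.log_le_sub_one_of_pos hq0
    rw [Real.log_pow]
    push_cast
    linarith
  have hpos : 0 < q ^ 4 * (Real.log (q ^ 4) - 1) + 1 := by
    have h1 := Real.log_lt_sub_one_of_pos (inv_pos.2 (by positivity : 0 < q ^ 4))
      (by simpa using hc.ne')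
    rw [Real.log_inv] at h1
    have h2 : q ^ 4 * (q ^ 4)⁻¹ = 1 := mul_inv_cancel₀ (by positivity)
    nlinarith
  refine ⟨hpos, ?_⟩
  rw [le_div_iff₀ hpos]
  have h1 : q ^ 4 * (Real.log (q ^ 4) - 1) + 1 ≤ (q ^ 4 - 1) * (4 * (q - 1)) := by
    have := mul_le_mul_of_nonneg_left hlog4 (by linarith : 0 ≤ q ^ 4 - 1)
    nlinarith
  calc _ ≤ (q + 1) * (q ^ 2 + 1) / 4 * ((q ^ 4 - 1) * (4 * (q - 1))) := by gcongr
    _ = _ := by ring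

lemma numerator_le {ζ q κ : ℝ} (hζ : 0 < ζ)
    (hκ : (q + 1) * (q ^ 2 + 1) / 4 - 1 ≤ κ) (hκ0 : 0 ≤ κ) :
    1 - 3 * ζ * (2 + ζ) * κ - 8 * ζ - 2 * ζ ^ 2
      ≤ 1 - ζ * (3 / 2 * (q ^ 3 + q ^ 2 + q) + 7 / 2) := by
  have h1 := mul_nonneg hζ.le (sub_nonneg.2 hκ)
  have h2 := mul_nonneg (sq_nonneg ζ) hκ0
  nlinarith [sq_nonneg ζ]

lemma rate_le {ζ q N A : ℝ} (hζ : 0 < ζ) (hq : 1 ≤ q)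
    (hN : N ≤ 1 - ζ * (3 / 2 * (q ^ 3 + q ^ 2 + q) + 7 / 2)) (hN0 : 0 < N)
    (hA : 1 + ζ * (q ^ 4 + 1) ≤ A) :
    ζ * q ^ 2 ≤ 1 ∧ 1 / A * N ≤ 1 / (1 + ζ) - ζ ∧
    1 / A * N ≤ (1 + ζ * ((q ^ 2) ^ 2 - 1)) / (1 + 2 * (ζ * ((q ^ 2) ^ 2 - 1)) + ζ * q ^ 2)
      - ζ * q ^ 2 := by
  have hq0 : 0 < q := by linarith
  have hB : ζ * (3 / 2 * (q ^ 3 + q ^ 2 + q) + 7 / 2) < 1 := by linarith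
  have hq2 : 1 ≤ q ^ 2 := one_le_pow₀ hq
  have hq3 : 1 ≤ q ^ 3 := one_le_pow₀ hq
  have hq4 : 1 ≤ q ^ 4 := one_le_pow₀ hq
  have hζ8 : ζ * 8 ≤ 1 := by nlinarith
  have hζq : ζ * q ^ 2 ≤ 1 := by nlinarith [mul_pos hζ hq0, mul_pos hζ (pow_pos hq0 3)]
  have hζq4 : ζ * (q ^ 4 + 1) ≤ 2 / 3 * q := by
    have h1 := mul_le_mul_of_nonneg_right hB.le hq0.le
    have h2 : q ^ 4 + 1 ≤ 2 / 3 * ((3 / 2 * (q ^ 3 + q ^ 2 + q) + 7 / 2) * q) := by nlinarith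
    nlinarith [mul_le_mul_of_nonneg_left h2 hζ.le]
  set A' : ℝ := 1 + ζ * (q ^ 4 + 1) with hA'
  have hA'0 : 0 < A' := by positivity
  have hle : 1 / A * N ≤ N / A' := by
    rw [one_div_mul_eq_div]
    gcongr
  refine ⟨hζq, hle.trans ?_, hle.trans ?_⟩
  · have h1 : N / A' ≤ N := div_le_self hN0.le (by nlinarith)
    have h2 : 1 - ζ ≤ 1 / (1 + ζ) := by
      rw [le_div_iff₀ (by positivity)]
      nlinarith
    nlinarith
  · have hw : 0 ≤ ζ * ((q ^ 2) ^ 2 - 1) := mul_nonneg hζ.le (by nlinarith)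
    have hR : (1 - ζ * q ^ 2) / A' ≤ (1 + ζ * ((q ^ 2) ^ 2 - 1))
        / (1 + 2 * (ζ * ((q ^ 2) ^ 2 - 1)) + ζ * q ^ 2) := by
      rw [div_le_div_iff₀ hA'0 (by positivity)]
      have hx : 0 ≤ ζ * q ^ 2 := by positivity
      have hA'' : A' = 1 + ζ * ((q ^ 2) ^ 2 - 1) + 2 * ζ := by rw [hA']; ring
      rw [hA'']
      generalize ζ * q ^ 2 = x at hx
      generalize ζ * ((q ^ 2) ^ 2 - 1) = w at hw
      nlinarith [mul_nonneg hw hx, mul_nonneg hw hζ.le, sq_nonneg w, sq_nonneg x]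
    have h3 : N / A' ≤ (1 - ζ * q ^ 2) / A' - ζ * q ^ 2 := by
      rw [div_sub' hA'0.ne', div_le_div_iff_of_pos_right hA'0]
      have : ζ * q ^ 2 * A' ≤ ζ * (q ^ 2 + 2 / 3 * q ^ 3) := by
        have := mul_le_mul_of_nonneg_left hζq4 (by positivity : 0 ≤ ζ * q ^ 2)
        rw [hA']
        nlinarith
      nlinarith [mul_pos hζ hq0, mul_pos hζ (pow_pos hq0 3), mul_nonneg hζ.le (sub_nonneg.2 hq2),
        mul_nonneg hζ.le (mul_nonneg hq0.le (sq_nonneg (q - 1)))]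
    linarith

end

/-- **Corollary 1.5.** Multiplicative perturbation of subalgebra-relative entropy. -/
theorem multiplicative_perturbation_subalgebra_relEnt
    (d : ℕ)
    (E Φ : Matrix (Fin d) (Fin d) ℂ →ₗ[ℂ] Matrix (Fin d) (Fin d) ℂ)
    (hEpos : ∀ X : Matrix (Fin d) (Fin d) ℂ, X.PosSemidef → (E X).PosSemidef)
    (hEtr : ∀ X : Matrix (Fin d) (Fin d) ℂ, (E X).trace = X.trace)
    (hΦpos : ∀ X : Matrix (Fin d) (Fin d) ℂ, X.PosSemidef → (Φ X).PosSemidef)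
    (hΦtr : ∀ X : Matrix (Fin d) (Fin d) ℂ, (Φ X).trace = X.trace)
    (hΦE : ∀ X : Matrix (Fin d) (Fin d) ℂ, Φ (E X) = E X)
    (ρ : Matrix (Fin d) (Fin d) ℂ) (hρ : IsDensity ρ) (hEρ : (E ρ).PosDef)
    (ζ c : ℝ) (hζ : ζ ∈ Set.Ioo (0:ℝ) 1) (hc : 1 ≤ c)
    (hdom : (c • E ρ - Φ ρ).PosSemidef) :
    relEnt ρ ((1 - ζ) • E ρ + ζ • Φ ρ)
      ≥ (1 / (1 + ζ * (c + 1) + 2 * ζ ^ 2 * (c - 1)))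
          * (1 - 3 * ζ * (2 + ζ) * (c - 1) ^ 2 / (c * (Real.log c - 1) + 1)
              - 8 * ζ - 2 * ζ ^ 2)
        * relEnt ρ (E ρ) := by
  obtain ⟨hρ0, hρ1⟩ := hρ
  obtain ⟨hζ0, hζ1⟩ := hζ
  have hη0 : (Φ ρ).PosSemidef := hΦpos ρ hρ0
  have hη1 : (Φ ρ).trace = 1 := (hΦtr ρ).trans hρ1
  have hω1 : (E ρ).trace = 1 := (hEtr ρ).trans hρ1
  have hσ : ((1 - ζ) • E ρ + ζ • Φ ρ).PosDef :=
    (hEρ.smul (sub_pos.2 hζ1)).add_posSemidef (hη0.smul hζ0.le)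
  have hσ1 : ((1 - ζ) • E ρ + ζ • Φ ρ).trace = 1 := by
    rw [trace_add, trace_smul, trace_smul, hω1, hη1, ← add_smul, sub_add_cancel, one_smul]
  obtain ⟨hDP, hPI⟩ := relEnt_nonneg_and_lintegral hρ0 hEρ hρ1 hω1
  obtain ⟨hDQ, hQI⟩ := relEnt_nonneg_and_lintegral hρ0 hσ hρ1 hσ1
  obtain ⟨q, hq, rfl⟩ : ∃ q : ℝ, 1 ≤ q ∧ q ^ 4 = c :=
    ⟨√√c, Real.one_le_sqrt.2 (Real.one_le_sqrt.2 hc), by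
      rw [show (4 : ℕ) = 2 * 2 from rfl, pow_mul, Real.sq_sqrt (Real.sqrt_nonneg c),
        Real.sq_sqrt (by linarith)]⟩
  have hκ : (q + 1) * (q ^ 2 + 1) / 4 - 1
      ≤ (q ^ 4 - 1) ^ 2 / (q ^ 4 * (Real.log (q ^ 4) - 1) + 1) ∧
      0 ≤ (q ^ 4 - 1) ^ 2 / (q ^ 4 * (Real.log (q ^ 4) - 1) + 1) := by
    rcases hq.eq_or_lt with rfl | hq
    · norm_num
    · obtain ⟨hpos, hle⟩ := kappa_lower hq
      exact ⟨by linarith, div_nonneg (sq_nonneg _) hpos.le⟩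
  have hN := numerator_le hζ0 hκ.1 hκ.2
  rw [← mul_div_assoc] at hN
  have hA : 1 + ζ * (q ^ 4 + 1) ≤ 1 + ζ * (q ^ 4 + 1) + 2 * ζ ^ 2 * (q ^ 4 - 1) :=
    le_add_of_nonneg_right (mul_nonneg (by positivity) (sub_nonneg.2 hc))
  rcases le_or_gt (1 - 3 * ζ * (2 + ζ) * (q ^ 4 - 1) ^ 2 / (q ^ 4 * (Real.log (q ^ 4) - 1) + 1)
      - 8 * ζ - 2 * ζ ^ 2) 0 with hN0 | hN0
  · refine (mul_nonpos_of_nonpos_of_nonneg (mul_nonpos_of_nonneg_of_nonpos ?_ hN0) hDP).trans hDQ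
    exact one_div_nonneg.2 (le_trans (by positivity) hA)
  obtain ⟨hζq, hβ0, hβ1⟩ := rate_le hζ0 hq hN hN0 hA
  have hgap : ∀ t, relGap (Φ ρ) (E ρ) t ≤ relGap ρ (E ρ) t := fun t => by
    simpa only [hΦE] using relGap_map_le hΦpos hΦtr hρ0.1 hEρ.1 t
  refine mul_le_of_lintegral_div hζ0 hζ1 (one_le_pow₀ hq) hζq (measurable_relGap hρ0.1 hEρ.posSemidef)
    (relGap_nonneg hρ0.1 hEρ.1 hρ1 hω1) (relGap_nonneg hρ0.1 hσ.1 hρ1 hσ1) ?_ ?_ ?_ hDP hDQ hPI hQI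
    hβ0 hβ1
  · intro s t hs hs1 ht1
    exact (relGap_mix_le_of_le_one hρ0.1 hEρ.1 hη0.1 hζ0.le hs hs1 ht1).trans
      (add_le_add_right (mul_le_mul_of_nonneg_left (hgap t) (mul_nonneg hs hζ0.le)) _)
  · intro s t hs ht
    exact (relGap_mix_le_of_one_le hρ0.1 hEρ.1 hη0.1 hρ1 hω1 hη1 hζ0.le hs ht).trans
      (add_le_add_right (mul_le_mul_of_nonneg_left (hgap t)
        (mul_nonneg (zero_le_one.trans hs) hζ0.le)) _)
  · intro s hs
    have h := relGap_mix_le_of_one_le hρ0.1 hEρ.1 hη0.1 hρ1 hω1 hη1 hζ0.le hs hc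
    rwa [relGap_eq_zero_of_le hη0.1 hEρ.1 hη1 hω1 hc hdom, mul_zero, add_zero,
      show q ^ 4 = (q ^ 2) ^ 2 by ring] at h
end

section
/- Let ρ, σ, ω be densities on ℂ^d with σ positive definite, and let κ > 0 and c > 1 satisfy κσ ≤ ω ≤ cσ and ρ ≤ cσ in the Loewner order. Assume D(ω‖σ) ≤ D(ρ‖σ). Then D(ρ‖ω) ≤ (4(c−1)² / (κ·(c(ln c − 1) + 1))) · D(ρ‖σ). -/
open Matrix
open scoped ComplexOrder

/-- The matrix `U diag(a) Uᴴ`. -/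
noncomputable def unitaryDiag {d : ℕ} (U : Matrix (Fin d) (Fin d) ℂ) (a : Fin d → ℝ) :
    Matrix (Fin d) (Fin d) ℂ :=
  U * diagonal (fun i => (a i : ℂ)) * Uᴴ

lemma trace_diagonal_mul_diagonal_conjTranspose {d : ℕ} (f g : Fin d → ℝ)
    (W : Matrix (Fin d) (Fin d) ℂ) :
    (diagonal (fun i => (f i : ℂ)) * W * diagonal (fun i => (g i : ℂ)) * Wᴴ).trace =
      ((∑ i, ∑ j, f i * g j * Complex.normSq (W i j) : ℝ) : ℂ) := by
  rw [Matrix.trace, Complex.ofReal_sum]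
  refine Finset.sum_congr rfl fun i _ => ?_
  rw [diag_apply, mul_apply, Complex.ofReal_sum]
  refine Finset.sum_congr rfl fun j _ => ?_
  rw [mul_diagonal, diagonal_mul, conjTranspose_apply]
  push_cast
  rw [Complex.normSq_eq_conj_mul_self]
  simp only [RCLike.star_def]
  ring

lemma trace_unitaryDiag_mul_unitaryDiag {d : ℕ} (U V : Matrix (Fin d) (Fin d) ℂ)
    (f g : Fin d → ℝ) :
    (unitaryDiag U f * unitaryDiag V g).trace.re =
      ∑ i, ∑ j, f i * g j * Complex.normSq ((Uᴴ * V) i j) := by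
  have h := trace_diagonal_mul_diagonal_conjTranspose f g (Uᴴ * V)
  rw [← Complex.ofReal_re (∑ i, ∑ j, f i * g j * Complex.normSq ((Uᴴ * V) i j)), ← h]
  congr 1
  rw [unitaryDiag, unitaryDiag, conjTranspose_mul, conjTranspose_conjTranspose]
  rw [mul_assoc, mul_assoc, trace_mul_comm]
  simp only [mul_assoc]

lemma trace_unitaryDiag_mul_mul_conjTranspose {d : ℕ} {U V : Matrix (Fin d) (Fin d) ℂ}
    (hV : V * Vᴴ = 1) (a : Fin d → ℝ) (Y : Matrix (Fin d) (Fin d) ℂ) :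
    (unitaryDiag U a * (Y * Yᴴ)).trace.re =
      ∑ i, ∑ j, a i * Complex.normSq ((Uᴴ * Y * V) i j) := by
  have h := trace_unitaryDiag_mul_unitaryDiag U (Y * V) a 1
  have h1 : unitaryDiag (Y * V) 1 = Y * Yᴴ := by
    have : (diagonal fun i : Fin d => (((1 : Fin d → ℝ) i : ℝ) : ℂ)) = 1 := by simp
    rw [unitaryDiag, this, mul_one, conjTranspose_mul, mul_assoc, ← mul_assoc V, hV, one_mul]
  rw [h1] at h
  simpa [mul_assoc] using h

lemma trace_unitaryDiag_mul_conjTranspose_mul {d : ℕ} {U V : Matrix (Fin d) (Fin d) ℂ}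
    (hU : U * Uᴴ = 1) (b : Fin d → ℝ) (Y : Matrix (Fin d) (Fin d) ℂ) :
    (unitaryDiag V b * (Yᴴ * Y)).trace.re =
      ∑ i, ∑ j, b j * Complex.normSq ((Uᴴ * Y * V) i j) := by
  have h := trace_unitaryDiag_mul_mul_conjTranspose (U := V) hU b Yᴴ
  rw [conjTranspose_conjTranspose] at h
  rw [h, Finset.sum_comm]
  refine Finset.sum_congr rfl fun i _ => Finset.sum_congr rfl fun j _ => ?_
  have : (Vᴴ * Yᴴ * U) = (Uᴴ * Y * V)ᴴ := by
    simp [conjTranspose_mul, mul_assoc]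
  rw [this, conjTranspose_apply, RCLike.star_def, Complex.normSq_conj]

lemma trace_conjTranspose_mul {d : ℕ} {U V : Matrix (Fin d) (Fin d) ℂ}
    (hU : U * Uᴴ = 1) (hV : V * Vᴴ = 1) (X Y : Matrix (Fin d) (Fin d) ℂ) :
    (Xᴴ * Y).trace.re =
      ∑ i, ∑ j, (star ((Uᴴ * X * V) i j) * (Uᴴ * Y * V) i j).re := by
  have h : (Xᴴ * Y).trace = ((Uᴴ * X * V)ᴴ * (Uᴴ * Y * V)).trace := by
    have : (Uᴴ * X * V)ᴴ * (Uᴴ * Y * V) = Vᴴ * (Xᴴ * (U * Uᴴ) * Y * V) := by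
      simp [conjTranspose_mul, mul_assoc]
    rw [this, hU, mul_one, trace_mul_comm Vᴴ, mul_assoc _ V, hV, mul_one]
  rw [h, Matrix.trace, Finset.sum_comm, Complex.re_sum]
  refine Finset.sum_congr rfl fun j _ => ?_
  rw [diag_apply, mul_apply, Complex.re_sum]
  rfl

lemma re_trace_mul_nonneg {d : ℕ} {P Y : Matrix (Fin d) (Fin d) ℂ} (hP : P.PosSemidef) :
    0 ≤ (P * (Y * Yᴴ)).trace.re := by
  have h := (hP.conjTranspose_mul_mul_same Y).trace_nonneg
  rw [mul_assoc, trace_mul_comm, mul_assoc] at h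
  exact (Complex.le_def.1 h).1

/-- The form `X ↦ ⟨X, (p L_A + q R_B)⁻¹ X⟩`, with `L_A` and `R_B` the left and right
multiplications, is antitone in `A` and `B`. -/
lemma quadForm_antitone {d : ℕ} {U V U' V' : Matrix (Fin d) (Fin d) ℂ}
    (hU : U * Uᴴ = 1) (hV : V * Vᴴ = 1) (hU' : U' * U'ᴴ = 1) (hV' : V' * V'ᴴ = 1)
    {a b a' b' : Fin d → ℝ}
    (hA : (unitaryDiag U' a' - unitaryDiag U a).PosSemidef)
    (hB : (unitaryDiag V' b' - unitaryDiag V b).PosSemidef)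
    {p q : ℝ} (hp : 0 ≤ p) (hq : 0 ≤ q)
    (hm : ∀ i j, 0 < p * a i + q * b j) (hm' : ∀ i j, 0 < p * a' i + q * b' j)
    (X : Matrix (Fin d) (Fin d) ℂ) :
    ∑ i, ∑ j, (p * a' i + q * b' j)⁻¹ * Complex.normSq ((U'ᴴ * X * V') i j) ≤
      ∑ i, ∑ j, (p * a i + q * b j)⁻¹ * Complex.normSq ((Uᴴ * X * V) i j) := by
  set Y' : Matrix (Fin d) (Fin d) ℂ :=
    fun i j => ((p * a' i + q * b' j)⁻¹ : ℝ) * (U'ᴴ * X * V') i j with hY'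
  set Y := U' * Y' * V'ᴴ with hY
  have hYY : U'ᴴ * Y * V' = Y' := by
    have e : U'ᴴ * Y * V' = (U'ᴴ * U') * Y' * (V'ᴴ * V') := by simp [hY, mul_assoc]
    rw [e, mul_eq_one_comm.1 hU', mul_eq_one_comm.1 hV', one_mul, mul_one]
  have hposA := re_trace_mul_nonneg (Y := Y) hA
  have hposB := re_trace_mul_nonneg (Y := Yᴴ) hB
  rw [conjTranspose_conjTranspose] at hposB
  rw [sub_mul, trace_sub, Complex.sub_re] at hposA hposB
  rw [trace_unitaryDiag_mul_mul_conjTranspose hV',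
    trace_unitaryDiag_mul_mul_conjTranspose hV, hYY] at hposA
  rw [trace_unitaryDiag_mul_conjTranspose_mul hU',
    trace_unitaryDiag_mul_conjTranspose_mul hU, hYY] at hposB
  have hin := (trace_conjTranspose_mul hU' hV' X Y).symm.trans (trace_conjTranspose_mul hU hV X Y)
  rw [hYY] at hin
  have e1 : ∑ i, ∑ j, (p * a' i + q * b' j)⁻¹ * Complex.normSq ((U'ᴴ * X * V') i j) =
      2 * ∑ i, ∑ j, (star ((U'ᴴ * X * V') i j) * Y' i j).re
      - (p * ∑ i, ∑ j, a' i * Complex.normSq (Y' i j)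
        + q * ∑ i, ∑ j, b' j * Complex.normSq (Y' i j)) := by
    simp only [Finset.mul_sum, ← Finset.sum_add_distrib, ← Finset.sum_sub_distrib]
    refine Finset.sum_congr rfl fun i _ => Finset.sum_congr rfl fun j _ => ?_
    have := (hm' i j).ne'
    simp only [hY', Complex.normSq_apply, Complex.mul_re, Complex.mul_im, RCLike.star_def,
      Complex.conj_re, Complex.conj_im, Complex.ofReal_re, Complex.ofReal_im]
    field_simp
    ring
  have e2 : 2 * ∑ i, ∑ j, (star ((Uᴴ * X * V) i j) * (Uᴴ * Y * V) i j).re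
      - (p * ∑ i, ∑ j, a i * Complex.normSq ((Uᴴ * Y * V) i j)
        + q * ∑ i, ∑ j, b j * Complex.normSq ((Uᴴ * Y * V) i j)) ≤
      ∑ i, ∑ j, (p * a i + q * b j)⁻¹ * Complex.normSq ((Uᴴ * X * V) i j) := by
    simp only [Finset.mul_sum, ← Finset.sum_add_distrib, ← Finset.sum_sub_distrib]
    refine Finset.sum_le_sum fun i _ => Finset.sum_le_sum fun j _ => ?_
    generalize (Uᴴ * X * V) i j = x
    generalize (Uᴴ * Y * V) i j = y
    have hmpos := hm i j
    have key : (p * a i + q * b j)⁻¹ * Complex.normSq x - (2 * (star x * y).re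
        - (p * (a i * Complex.normSq y) + q * (b j * Complex.normSq y))) =
        (p * a i + q * b j)⁻¹ * Complex.normSq (x - ((p * a i + q * b j : ℝ) : ℂ) * y) := by
      have := hmpos.ne'
      simp only [Complex.normSq_apply, Complex.mul_re, Complex.mul_im, RCLike.star_def,
        Complex.conj_re, Complex.conj_im, Complex.ofReal_re, Complex.ofReal_im, Complex.sub_re,
        Complex.sub_im]
      field_simp
      ring
    have := mul_nonneg (inv_nonneg.2 hmpos.le)
      (Complex.normSq_nonneg (x - ((p * a i + q * b j : ℝ) : ℂ) * y))
    linarith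
  have hp' := mul_nonneg hp hposA
  have hq' := mul_nonneg hq hposB
  linarith

/-- The inverse of the logarithmic mean of two positive numbers. -/
noncomputable def invLogMean (a b : ℝ) : ℝ := ∫ u in (0 : ℝ)..1, (u * a + (1 - u) * b)⁻¹

lemma interp_pos {a b u : ℝ} (ha : 0 < a) (hb : 0 < b) (hu : u ∈ Set.Icc (0 : ℝ) 1) :
    0 < u * a + (1 - u) * b := by
  have h0 := hu.1
  have h1 := hu.2
  rcases h0.eq_or_lt with rfl | h
  · simpa using hb
  · have := mul_nonneg (sub_nonneg.2 h1) hb.le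
    positivity

lemma intervalIntegrable_inv_interp {a b : ℝ} (ha : 0 < a) (hb : 0 < b) :
    IntervalIntegrable (fun u => (u * a + (1 - u) * b)⁻¹) MeasureTheory.volume 0 1 := by
  apply ContinuousOn.intervalIntegrable
  rw [Set.uIcc_of_le zero_le_one]
  exact ContinuousOn.inv₀ (by fun_prop) fun u hu => (interp_pos ha hb hu).ne'

lemma sub_mul_invLogMean {a b : ℝ} (ha : 0 < a) (hb : 0 < b) :
    (a - b) * invLogMean a b = Real.log a - Real.log b := by
  have h : ∫ u in (0 : ℝ)..1, (a - b) * (u * a + (1 - u) * b)⁻¹ =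
      Real.log (1 * a + (1 - 1) * b) - Real.log (0 * a + (1 - 0) * b) := by
    refine intervalIntegral.integral_eq_sub_of_hasDerivAt
      (f := fun u => Real.log (u * a + (1 - u) * b)) (fun u hu => ?_)
      ((intervalIntegrable_inv_interp ha hb).const_mul _)
    rw [Set.uIcc_of_le zero_le_one] at hu
    have h1 : HasDerivAt (fun u : ℝ => u * a + (1 - u) * b) (1 * a + (-1) * b) u :=
      ((hasDerivAt_id u).mul_const a).add (((hasDerivAt_id u).const_sub 1).mul_const b)
    have h2 := h1.log (interp_pos ha hb hu).ne'
    rwa [div_eq_mul_inv, one_mul, neg_one_mul, ← sub_eq_add_neg] at h2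
  rw [intervalIntegral.integral_const_mul] at h
  rw [invLogMean, h]
  simp

lemma invLogMean_nonneg {a b : ℝ} (ha : 0 < a) (hb : 0 < b) : 0 ≤ invLogMean a b :=
  intervalIntegral.integral_nonneg zero_le_one fun _ hu => (inv_pos.2 (interp_pos ha hb hu)).le

lemma invLogMean_mul_mul {r : ℝ} (a b : ℝ) :
    invLogMean (r * a) (r * b) = r⁻¹ * invLogMean a b := by
  rw [invLogMean, invLogMean, ← intervalIntegral.integral_const_mul]
  refine intervalIntegral.integral_congr fun u _ => ?_
  simp only [← mul_inv]
  ring_nf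

/-- The form `X ↦ ∫₀^∞ tr (Xᴴ (A + r)⁻¹ X (B + r)⁻¹) dr` for `A = unitaryDiag U a`,
`B = unitaryDiag V b`. -/
noncomputable def logForm {d : ℕ} (U : Matrix (Fin d) (Fin d) ℂ) (a : Fin d → ℝ)
    (V : Matrix (Fin d) (Fin d) ℂ) (b : Fin d → ℝ) (X : Matrix (Fin d) (Fin d) ℂ) : ℝ :=
  ∑ i, ∑ j, invLogMean (a i) (b j) * Complex.normSq ((Uᴴ * X * V) i j)

lemma intervalIntegrable_sum_inv_interp {d : ℕ} {a b : Fin d → ℝ} (ha : ∀ i, 0 < a i)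
    (hb : ∀ i, 0 < b i) (x : Fin d → Fin d → ℝ) :
    IntervalIntegrable (fun u => ∑ i, ∑ j, (u * a i + (1 - u) * b j)⁻¹ * x i j)
      MeasureTheory.volume 0 1 := by
  apply ContinuousOn.intervalIntegrable
  rw [Set.uIcc_of_le zero_le_one]
  refine continuousOn_finsetSum _ fun i _ => continuousOn_finsetSum _ fun j _ => ?_
  exact (ContinuousOn.inv₀ (by fun_prop) fun u hu => (interp_pos (ha i) (hb j) hu).ne').mul
    continuousOn_const

lemma logForm_eq_integral {d : ℕ} (U : Matrix (Fin d) (Fin d) ℂ) {a : Fin d → ℝ}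
    (V : Matrix (Fin d) (Fin d) ℂ) {b : Fin d → ℝ} (ha : ∀ i, 0 < a i) (hb : ∀ i, 0 < b i)
    (X : Matrix (Fin d) (Fin d) ℂ) :
    logForm U a V b X = ∫ u in (0 : ℝ)..1,
      ∑ i, ∑ j, (u * a i + (1 - u) * b j)⁻¹ * Complex.normSq ((Uᴴ * X * V) i j) := by
  have hint := fun i j => (intervalIntegrable_inv_interp (ha i) (hb j)).mul_const
    (Complex.normSq ((Uᴴ * X * V) i j))
  simp only [← Fintype.sum_prod_type']
  rw [intervalIntegral.integral_finsetSum fun p _ => hint p.1 p.2, logForm,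
    ← Fintype.sum_prod_type']
  refine Finset.sum_congr rfl fun p _ => ?_
  rw [intervalIntegral.integral_mul_const, invLogMean]

lemma logForm_antitone {d : ℕ} {U V U' V' : Matrix (Fin d) (Fin d) ℂ}
    (hU : U * Uᴴ = 1) (hV : V * Vᴴ = 1) (hU' : U' * U'ᴴ = 1) (hV' : V' * V'ᴴ = 1)
    {a b a' b' : Fin d → ℝ} (ha : ∀ i, 0 < a i) (hb : ∀ i, 0 < b i)
    (ha' : ∀ i, 0 < a' i) (hb' : ∀ i, 0 < b' i)
    (hA : (unitaryDiag U' a' - unitaryDiag U a).PosSemidef)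
    (hB : (unitaryDiag V' b' - unitaryDiag V b).PosSemidef)
    (X : Matrix (Fin d) (Fin d) ℂ) :
    logForm U' a' V' b' X ≤ logForm U a V b X := by
  rw [logForm_eq_integral U V ha hb, logForm_eq_integral U' V' ha' hb']
  refine intervalIntegral.integral_mono_on zero_le_one
    (intervalIntegrable_sum_inv_interp ha' hb' _) (intervalIntegrable_sum_inv_interp ha hb _)
    fun u hu => ?_
  exact quadForm_antitone hU hV hU' hV' hA hB hu.1 (sub_nonneg.2 hu.2)
    (fun i j => interp_pos (ha i) (hb j) hu) (fun i j => interp_pos (ha' i) (hb' j) hu) X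

lemma conjTranspose_mul_unitaryDiag_sub_mul {d : ℕ} {U V : Matrix (Fin d) (Fin d) ℂ}
    (hU : U * Uᴴ = 1) (hV : V * Vᴴ = 1) (a b : Fin d → ℝ) (i j : Fin d) :
    (Uᴴ * (unitaryDiag U a - unitaryDiag V b) * V) i j = ((a i - b j : ℝ) : ℂ) * (Uᴴ * V) i j := by
  have h : Uᴴ * (unitaryDiag U a - unitaryDiag V b) * V =
      diagonal (fun i => (a i : ℂ)) * (Uᴴ * V) - (Uᴴ * V) * diagonal (fun i => (b i : ℂ)) := by
    have : Uᴴ * (unitaryDiag U a - unitaryDiag V b) * V =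
        (Uᴴ * U) * diagonal (fun i => (a i : ℂ)) * (Uᴴ * V)
          - (Uᴴ * V) * diagonal (fun i => (b i : ℂ)) * (Vᴴ * V) := by
      simp [unitaryDiag, mul_sub, sub_mul, mul_assoc]
    rw [this, mul_eq_one_comm.1 hU, mul_eq_one_comm.1 hV, one_mul, mul_one]
  rw [h, Matrix.sub_apply, diagonal_mul, mul_diagonal]
  push_cast
  ring

lemma exists_unitaryDiag {d : ℕ} {A : Matrix (Fin d) (Fin d) ℂ} (hA : A.PosSemidef) :
    ∃ (U : Matrix (Fin d) (Fin d) ℂ) (a : Fin d → ℝ), U * Uᴴ = 1 ∧ A = unitaryDiag U a ∧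
      matLog A = unitaryDiag U (fun i => Real.log (a i)) ∧ (∀ i, 0 ≤ a i) ∧
      (A.PosDef → ∀ i, 0 < a i) := by
  have hH := hA.isHermitian
  refine ⟨hH.eigenvectorUnitary, hH.eigenvalues, ?_, ?_, ?_, hA.eigenvalues_nonneg,
    fun h => h.eigenvalues_pos⟩
  · exact (Matrix.mem_unitaryGroup_iff.1 hH.eigenvectorUnitary.2)
  · exact hH.spectral_theorem
  · rw [matLog, dif_pos hH]
    rfl

lemma trace_unitaryDiag {d : ℕ} {U : Matrix (Fin d) (Fin d) ℂ} (hU : U * Uᴴ = 1)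
    (a : Fin d → ℝ) : (unitaryDiag U a).trace.re = ∑ i, a i := by
  rw [unitaryDiag, trace_mul_comm, ← mul_assoc, mul_eq_one_comm.1 hU, one_mul, trace_diagonal,
    Complex.re_sum]
  simp

lemma smul_unitaryDiag {d : ℕ} (r : ℝ) (U : Matrix (Fin d) (Fin d) ℂ) (a : Fin d → ℝ) :
    r • unitaryDiag U a = unitaryDiag U (fun i => r * a i) := by
  have : diagonal (fun i => ((r * a i : ℝ) : ℂ)) = r • diagonal (fun i => (a i : ℂ)) := by
    rw [← diagonal_smul]
    congr 1
    ext i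
    simp
  rw [unitaryDiag, unitaryDiag, this, mul_smul_comm, smul_mul_assoc]

lemma normSq_smul_apply {d : ℕ} (U V X : Matrix (Fin d) (Fin d) ℂ) (r : ℝ) (i j : Fin d) :
    Complex.normSq ((Uᴴ * (r • X) * V) i j) = r ^ 2 * Complex.normSq ((Uᴴ * X * V) i j) := by
  rw [mul_smul_comm, smul_mul_assoc, Matrix.smul_apply, Complex.real_smul, Complex.normSq_mul,
    Complex.normSq_ofReal, sq]

lemma logForm_smul {d : ℕ} (U : Matrix (Fin d) (Fin d) ℂ) (a : Fin d → ℝ)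
    (V : Matrix (Fin d) (Fin d) ℂ) (b : Fin d → ℝ) (r : ℝ) (X : Matrix (Fin d) (Fin d) ℂ) :
    logForm U a V b (r • X) = r ^ 2 * logForm U a V b X := by
  simp only [logForm, normSq_smul_apply, Finset.mul_sum]
  refine Finset.sum_congr rfl fun i _ => Finset.sum_congr rfl fun j _ => ?_
  ring

lemma logForm_mul_mul {d : ℕ} (U : Matrix (Fin d) (Fin d) ℂ) (a : Fin d → ℝ)
    (V : Matrix (Fin d) (Fin d) ℂ) (b : Fin d → ℝ) (r : ℝ) (X : Matrix (Fin d) (Fin d) ℂ) :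
    logForm U (fun i => r * a i) V (fun i => r * b i) X = r⁻¹ * logForm U a V b X := by
  simp only [logForm, invLogMean_mul_mul, Finset.mul_sum, mul_assoc]

lemma logForm_nonneg {d : ℕ} (U : Matrix (Fin d) (Fin d) ℂ) {a : Fin d → ℝ}
    (V : Matrix (Fin d) (Fin d) ℂ) {b : Fin d → ℝ} (ha : ∀ i, 0 < a i) (hb : ∀ i, 0 < b i)
    (X : Matrix (Fin d) (Fin d) ℂ) : 0 ≤ logForm U a V b X :=
  Finset.sum_nonneg fun i _ => Finset.sum_nonneg fun j _ =>
    mul_nonneg (invLogMean_nonneg (ha i) (hb j)) (Complex.normSq_nonneg _)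

lemma logForm_sub_le {d : ℕ} (U : Matrix (Fin d) (Fin d) ℂ) {a : Fin d → ℝ}
    (V : Matrix (Fin d) (Fin d) ℂ) {b : Fin d → ℝ} (ha : ∀ i, 0 < a i) (hb : ∀ i, 0 < b i)
    (X Y : Matrix (Fin d) (Fin d) ℂ) :
    logForm U a V b (X - Y) ≤ 2 * logForm U a V b X + 2 * logForm U a V b Y := by
  simp only [logForm, Finset.mul_sum, ← Finset.sum_add_distrib]
  refine Finset.sum_le_sum fun i _ => Finset.sum_le_sum fun j _ => ?_
  have h : Complex.normSq ((Uᴴ * (X - Y) * V) i j) ≤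
      2 * Complex.normSq ((Uᴴ * X * V) i j) + 2 * Complex.normSq ((Uᴴ * Y * V) i j) := by
    rw [mul_sub, sub_mul, Matrix.sub_apply]
    simp only [Complex.normSq_apply, Complex.sub_re, Complex.sub_im]
    nlinarith [sq_nonneg (((Uᴴ * X * V) i j).re + ((Uᴴ * Y * V) i j).re),
      sq_nonneg (((Uᴴ * X * V) i j).im + ((Uᴴ * Y * V) i j).im)]
  have := mul_le_mul_of_nonneg_left h (invLogMean_nonneg (ha i) (hb j))
  linarith

lemma sum_eq_sum_mul_normSq_left {d : ℕ} {U V : Matrix (Fin d) (Fin d) ℂ}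
    (hU : U * Uᴴ = 1) (hV : V * Vᴴ = 1) (f : Fin d → ℝ) :
    ∑ i, f i = ∑ i, ∑ j, f i * Complex.normSq ((Uᴴ * V) i j) := by
  have h := trace_unitaryDiag_mul_mul_conjTranspose (U := U) hV f 1
  simpa [trace_unitaryDiag hU] using h

lemma sum_eq_sum_mul_normSq_right {d : ℕ} {U V : Matrix (Fin d) (Fin d) ℂ}
    (hU : U * Uᴴ = 1) (hV : V * Vᴴ = 1) (f : Fin d → ℝ) :
    ∑ j, f j = ∑ i, ∑ j, f j * Complex.normSq ((Uᴴ * V) i j) := by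
  have h := trace_unitaryDiag_mul_conjTranspose_mul (V := V) hU f 1
  simpa [trace_unitaryDiag hV] using h

lemma trace_unitaryDiag_mul_self {d : ℕ} {U : Matrix (Fin d) (Fin d) ℂ} (hU : U * Uᴴ = 1)
    (f g : Fin d → ℝ) : (unitaryDiag U f * unitaryDiag U g).trace.re = ∑ i, f i * g i := by
  rw [trace_unitaryDiag_mul_unitaryDiag, mul_eq_one_comm.1 hU]
  simp [Matrix.one_apply, apply_ite]

lemma trace_sub_mul_log_sub_log {d : ℕ} {U V : Matrix (Fin d) (Fin d) ℂ}
    (hU : U * Uᴴ = 1) (hV : V * Vᴴ = 1) {a b : Fin d → ℝ} (ha : ∀ i, 0 < a i)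
    (hb : ∀ i, 0 < b i) :
    ((unitaryDiag U a - unitaryDiag V b) * (unitaryDiag U (fun i => Real.log (a i)) -
      unitaryDiag V (fun i => Real.log (b i)))).trace.re =
      logForm U a V b (unitaryDiag U a - unitaryDiag V b) := by
  rw [sub_mul, mul_sub, mul_sub, trace_sub, trace_sub, trace_sub, Complex.sub_re, Complex.sub_re,
    Complex.sub_re, trace_unitaryDiag_mul_self hU, trace_unitaryDiag_mul_self hV,
    sum_eq_sum_mul_normSq_left hU hV fun i => a i * Real.log (a i),
    sum_eq_sum_mul_normSq_right hU hV fun i => b i * Real.log (b i), trace_mul_comm (unitaryDiag V b),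
    trace_unitaryDiag_mul_unitaryDiag, trace_unitaryDiag_mul_unitaryDiag, logForm]
  simp only [← Finset.sum_sub_distrib]
  refine Finset.sum_congr rfl fun i _ => Finset.sum_congr rfl fun j _ => ?_
  rw [conjTranspose_mul_unitaryDiag_sub_mul hU hV, Complex.normSq_mul, Complex.normSq_ofReal]
  linear_combination (-(a i - b j) * Complex.normSq ((Uᴴ * V) i j)) *
    sub_mul_invLogMean (ha i) (hb j)

lemma relEnt_eq_sum {d : ℕ} {A B U V : Matrix (Fin d) (Fin d) ℂ} {a b : Fin d → ℝ}
    (hU : U * Uᴴ = 1) (hV : V * Vᴴ = 1) (hA : A = unitaryDiag U a) (hB : B = unitaryDiag V b)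
    (hlA : matLog A = unitaryDiag U (fun i => Real.log (a i)))
    (hlB : matLog B = unitaryDiag V (fun i => Real.log (b i))) (htr : A.trace = B.trace) :
    relEnt A B = ∑ i, ∑ j, (a i * (Real.log (a i) - Real.log (b j)) - a i + b j) *
      Complex.normSq ((Uᴴ * V) i j) := by
  have htr' : ∑ i, a i = ∑ j, b j := by
    rw [← trace_unitaryDiag hU, ← trace_unitaryDiag hV, ← hA, ← hB, htr]
  rw [sum_eq_sum_mul_normSq_left hU hV a, sum_eq_sum_mul_normSq_right hU hV b] at htr'
  rw [relEnt, hlA, hlB, mul_sub, trace_sub, Complex.sub_re, hA,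
    trace_unitaryDiag_mul_self hU, trace_unitaryDiag_mul_unitaryDiag,
    sum_eq_sum_mul_normSq_left hU hV fun i => a i * Real.log (a i)]
  rw [← sub_add_cancel (_ - _) (∑ i, ∑ j, a i * Complex.normSq ((Uᴴ * V) i j))]
  nth_rewrite 2 [htr']
  simp only [← Finset.sum_sub_distrib, ← Finset.sum_add_distrib]
  refine Finset.sum_congr rfl fun i _ => Finset.sum_congr rfl fun j _ => ?_
  ring

lemma mul_log_sub_log_nonneg {a b : ℝ} (ha : 0 ≤ a) (hb : 0 < b) :
    0 ≤ a * (Real.log a - Real.log b) - a + b := by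
  rcases ha.eq_or_lt with rfl | ha
  · simpa using hb.le
  · have h := Real.log_le_sub_one_of_pos (div_pos hb ha)
    rw [Real.log_div hb.ne' ha.ne'] at h
    have := mul_le_mul_of_nonneg_left h ha.le
    have e : a * (b / a - 1) = b - a := by field_simp
    linarith

lemma mul_log_sub_log_le {a b : ℝ} (ha : 0 ≤ a) (hb : 0 < b) :
    a * (Real.log a - Real.log b) - a + b ≤ b⁻¹ * (a - b) ^ 2 := by
  rcases ha.eq_or_lt with rfl | ha
  · simp [sq, hb.ne']
  · have h := Real.log_le_sub_one_of_pos (div_pos ha hb)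
    rw [Real.log_div ha.ne' hb.ne'] at h
    have := mul_le_mul_of_nonneg_left h ha.le
    have e : b⁻¹ * (a - b) ^ 2 = a * (a / b - 1) - a + b := by field_simp; ring
    linarith

lemma relEnt_nonneg {d : ℕ} {A B : Matrix (Fin d) (Fin d) ℂ} (hA : A.PosSemidef) (hB : B.PosDef)
    (htr : A.trace = B.trace) : 0 ≤ relEnt A B := by
  obtain ⟨U, a, hU, hAU, hlA, ha, -⟩ := exists_unitaryDiag hA
  obtain ⟨V, b, hV, hBV, hlB, -, hb⟩ := exists_unitaryDiag hB.posSemidef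
  rw [relEnt_eq_sum hU hV hAU hBV hlA hlB htr]
  exact Finset.sum_nonneg fun i _ => Finset.sum_nonneg fun j _ =>
    mul_nonneg (mul_log_sub_log_nonneg (ha i) (hb hB j)) (Complex.normSq_nonneg _)

lemma relEnt_le_trace {d : ℕ} {A B : Matrix (Fin d) (Fin d) ℂ} (hA : A.PosSemidef)
    (hB : B.PosDef) (htr : A.trace = B.trace) {S : Matrix (Fin d) (Fin d) ℂ} {s : Fin d → ℝ}
    (hS : S * Sᴴ = 1) (hs : ∀ i, 0 < s i) (hSB : (B - unitaryDiag S s).PosSemidef) :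
    relEnt A B ≤ (unitaryDiag S (fun i => (s i)⁻¹) * ((A - B)ᴴ * (A - B))).trace.re := by
  obtain ⟨U, a, hU, hAU, hlA, ha, -⟩ := exists_unitaryDiag hA
  obtain ⟨V, b, hV, hBV, hlB, -, hb⟩ := exists_unitaryDiag hB.posSemidef
  rw [relEnt_eq_sum hU hV hAU hBV hlA hlB htr, trace_unitaryDiag_mul_conjTranspose_mul hU]
  rw [hBV] at hSB
  have h := quadForm_antitone hU hS hU hV (a := a) (a' := a) (by simpa using PosSemidef.zero)
    hSB le_rfl zero_le_one (by simpa using fun i j => hs j) (by simpa using fun i j => hb hB j)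
    (A - B)
  simp only [zero_mul, one_mul, zero_add] at h
  refine le_trans (Finset.sum_le_sum fun i _ => Finset.sum_le_sum fun j _ => ?_) h
  rw [hAU, hBV, conjTranspose_mul_unitaryDiag_sub_mul hU hV, Complex.normSq_mul,
    Complex.normSq_ofReal, ← mul_assoc, ← sq]
  exact mul_le_mul_of_nonneg_right (mul_log_sub_log_le (ha i) (hb hB j)) (Complex.normSq_nonneg _)

lemma relEnt_sub_relEnt {d : ℕ} (A B C : Matrix (Fin d) (Fin d) ℂ) :
    relEnt A C - relEnt B C = relEnt A B + ((A - B) * (matLog B - matLog C)).trace.re := by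
  simp only [relEnt, ← Complex.sub_re, ← Complex.add_re, ← trace_sub, ← trace_add]
  congr 2
  noncomm_ring

lemma relEnt_self {d : ℕ} (A : Matrix (Fin d) (Fin d) ℂ) : relEnt A A = 0 := by
  simp [relEnt]

lemma inv_mul_logForm_le_trace {d : ℕ} {A B U : Matrix (Fin d) (Fin d) ℂ} {s : Fin d → ℝ}
    (hA : A.PosDef) (hB : B.PosDef) (hU : U * Uᴴ = 1) (hs : ∀ i, 0 < s i) {r : ℝ} (hr : 0 < r)
    (hAS : (r • unitaryDiag U s - A).PosSemidef) (hBS : (r • unitaryDiag U s - B).PosSemidef) :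
    r⁻¹ * logForm U s U s (A - B) ≤ ((A - B) * (matLog A - matLog B)).trace.re := by
  obtain ⟨V, a, hV, hAV, hlA, -, ha⟩ := exists_unitaryDiag hA.posSemidef
  obtain ⟨W, b, hW, hBW, hlB, -, hb⟩ := exists_unitaryDiag hB.posSemidef
  rw [smul_unitaryDiag] at hAS hBS
  rw [hlA, hlB]
  have ha' := ha hA
  have hb' := hb hB
  clear hlA hlB ha hb
  subst hAV hBW
  rw [trace_sub_mul_log_sub_log hV hW ha' hb', ← logForm_mul_mul]
  exact logForm_antitone hV hW hU hU ha' hb' (fun i => mul_pos hr (hs i))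
    (fun i => mul_pos hr (hs i)) hAS hBS _

lemma trace_le_inv_mul_logForm {d : ℕ} {A B U : Matrix (Fin d) (Fin d) ℂ} {s : Fin d → ℝ}
    (hA : A.PosDef) (hB : B.PosDef) (hU : U * Uᴴ = 1) (hs : ∀ i, 0 < s i) {r : ℝ} (hr : 0 < r)
    (hAS : (A - r • unitaryDiag U s).PosSemidef) (hBS : (B - r • unitaryDiag U s).PosSemidef) :
    ((A - B) * (matLog A - matLog B)).trace.re ≤ r⁻¹ * logForm U s U s (A - B) := by
  obtain ⟨V, a, hV, hAV, hlA, -, ha⟩ := exists_unitaryDiag hA.posSemidef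
  obtain ⟨W, b, hW, hBW, hlB, -, hb⟩ := exists_unitaryDiag hB.posSemidef
  rw [smul_unitaryDiag] at hAS hBS
  rw [hlA, hlB]
  have ha' := ha hA
  have hb' := hb hB
  clear hlA hlB ha hb
  subst hAV hBW
  rw [trace_sub_mul_log_sub_log hV hW ha' hb', ← logForm_mul_mul]
  exact logForm_antitone hU hU hV hW (fun i => mul_pos hr (hs i))
    (fun i => mul_pos hr (hs i)) ha' hb' hAS hBS _

/-- A function whose increments are dominated by `(t' - t) (G t' - G t)` does not increase. -/
lemma le_of_sub_le_mul_sub {f G : ℝ → ℝ} {a b : ℝ} (hab : a ≤ b)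
    (h : ∀ t t', a ≤ t → t < t' → t' ≤ b → f t' - f t ≤ (t' - t) * (G t' - G t)) : f b ≤ f a := by
  rcases hab.eq_or_lt with rfl | hab
  · rfl
  have key : ∀ n : ℕ, f b - f a ≤ (b - a) * (G b - G a) / ((n : ℝ) + 1) := by
    intro n
    have hn : (0 : ℝ) < (n : ℝ) + 1 := by positivity
    set δ := (b - a) / ((n : ℝ) + 1) with hδ
    have hδ0 : 0 < δ := div_pos (sub_pos.2 hab) hn
    have hδn : ((n : ℝ) + 1) * δ = b - a := by rw [hδ]; field_simp
    have hf := Finset.sum_range_sub (fun k : ℕ => f (a + k * δ)) (n + 1)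
    have hG := Finset.sum_range_sub (fun k : ℕ => G (a + k * δ)) (n + 1)
    push_cast at hf hG
    simp only [hδn, zero_mul, add_zero, add_sub_cancel] at hf hG
    rw [mul_div_right_comm, ← hδ, ← hf, ← hG, Finset.mul_sum]
    refine Finset.sum_le_sum fun k hk => ?_
    have hk' : (k : ℝ) + 1 ≤ n + 1 := by exact_mod_cast Finset.mem_range.1 hk
    have h1 := h (a + k * δ) (a + (k + 1) * δ) (by nlinarith [mul_nonneg k.cast_nonneg hδ0.le])
      (by linarith) (by nlinarith [mul_le_mul_of_nonneg_right hk' hδ0.le])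
    have e : a + (k + 1) * δ - (a + k * δ) = δ := by ring
    rwa [e] at h1
  have hlim : Filter.Tendsto (fun n : ℕ => (b - a) * (G b - G a) / ((n : ℝ) + 1)) Filter.atTop
      (nhds 0) :=
    tendsto_const_nhds.div_atTop
      (Filter.tendsto_atTop_add_const_right _ _ tendsto_natCast_atTop_atTop)
  linarith [ge_of_tendsto' hlim key]

lemma add_smul_sub_eq {d : ℕ} (σ ρ : Matrix (Fin d) (Fin d) ℂ) (t : ℝ) :
    σ + t • (ρ - σ) = (1 - t) • σ + t • ρ := by
  module

lemma posDef_add_smul_sub {d : ℕ} {ρ σ : Matrix (Fin d) (Fin d) ℂ} (hρ : ρ.PosSemidef)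
    (hσ : σ.PosDef) {t : ℝ} (h0 : 0 ≤ t) (h1 : t < 1) : (σ + t • (ρ - σ)).PosDef := by
  rw [add_smul_sub_eq]
  exact (hσ.smul (sub_pos.2 h1)).add_posSemidef (hρ.smul h0)

lemma trace_add_smul_sub {d : ℕ} {ρ σ : Matrix (Fin d) (Fin d) ℂ} (htr : ρ.trace = σ.trace)
    (t : ℝ) : (σ + t • (ρ - σ)).trace = σ.trace := by
  rw [trace_add, trace_smul, trace_sub, htr, sub_self, smul_zero, add_zero]

lemma re_trace_smul_mul {d : ℕ} (r : ℝ) (X Y : Matrix (Fin d) (Fin d) ℂ) :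
    ((r • X) * Y).trace.re = r * (X * Y).trace.re := by
  rw [smul_mul_assoc, trace_smul, Complex.smul_re, smul_eq_mul]

lemma segment_sub_segment {d : ℕ} (σ X : Matrix (Fin d) (Fin d) ℂ) (t t' : ℝ) :
    σ + t' • X - (σ + t • X) = (t' - t) • X := by
  module

lemma posSemidef_smul_sub_segment {d : ℕ} {ρ σ : Matrix (Fin d) (Fin d) ℂ} (hσ : σ.PosSemidef)
    {c : ℝ} (hc : 1 ≤ c) (h : (c • σ - ρ).PosSemidef) {t t' : ℝ} (ht : 0 ≤ t) (htt' : t ≤ t') :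
    ((1 + t' * (c - 1)) • σ - (σ + t • (ρ - σ))).PosSemidef := by
  have e : (1 + t' * (c - 1)) • σ - (σ + t • (ρ - σ)) =
      t • (c • σ - ρ) + ((t' - t) * (c - 1)) • σ := by module
  rw [e]
  exact (h.smul ht).add (hσ.smul (mul_nonneg (sub_nonneg.2 htt') (sub_nonneg.2 hc)))

lemma posSemidef_segment_sub_smul {d : ℕ} {ρ σ : Matrix (Fin d) (Fin d) ℂ} (hρ : ρ.PosSemidef)
    (hσ : σ.PosSemidef) {t t' : ℝ} (ht : 0 ≤ t) (htt' : t ≤ t') :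
    (σ + t • (ρ - σ) - (1 - t') • σ).PosSemidef := by
  have e : σ + t • (ρ - σ) - (1 - t') • σ = t • ρ + (t' - t) • σ := by module
  rw [e]
  exact (hρ.smul ht).add (hσ.smul (sub_nonneg.2 htt'))

lemma log_sub_log_le {x y : ℝ} (hx : 0 < x) (hy : 0 < y) :
    Real.log y - Real.log x ≤ (y - x) / x := by
  have h := Real.log_le_sub_one_of_pos (div_pos hy hx)
  rw [Real.log_div hy.ne' hx.ne'] at h
  have : (y - x) / x = y / x - 1 := by field_simp
  linarith

/-- If `ρ ≤ c σ`, the relative entropy dominates a multiple of the Bogoliubov-Kubo-Mori norm of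
`ρ - σ` at `σ`. The proof compares increments along the segment from `σ` to `ρ`. -/
lemma mul_logForm_le_relEnt {d : ℕ} {ρ σ U : Matrix (Fin d) (Fin d) ℂ} {s : Fin d → ℝ}
    (hρ : ρ.PosSemidef) (hσ : σ.PosDef) (htr : ρ.trace = σ.trace) (hU : U * Uᴴ = 1)
    (hs : ∀ i, 0 < s i) (hσU : σ = unitaryDiag U s) {c : ℝ} (hc : 1 < c)
    (h : (c • σ - ρ).PosSemidef) :
    (c * (Real.log c - 1) + 1) / (c - 1) ^ 2 * logForm U s U s (ρ - σ) ≤ relEnt ρ σ := by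
  set X := ρ - σ with hX
  set N := logForm U s U s X with hN
  have hN0 : 0 ≤ N := logForm_nonneg U U hs hs X
  have hc0 : 0 < c - 1 := sub_pos.2 hc
  have hcpos : ∀ t : ℝ, 0 ≤ t → 0 < 1 + t * (c - 1) := fun t ht => by positivity
  set ψ : ℝ → ℝ := fun t => (X * (matLog (σ + t • X) - matLog σ)).trace.re with hψ
  have hψle : ∀ b, 0 ≤ b → b < 1 → N * Real.log (1 + b * (c - 1)) / (c - 1) ≤ ψ b := by
    intro b hb0 hb1
    have hmono := le_of_sub_le_mul_sub
      (f := fun t => N * Real.log (1 + t * (c - 1)) / (c - 1) - ψ t)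
      (G := fun t => -(N * (1 + t * (c - 1))⁻¹)) hb0 ?_
    · simp [hψ] at hmono
      simpa [hψ] using hmono
    intro t t' ht htt' ht'b
    have hA := posDef_add_smul_sub hρ hσ (ht.trans htt'.le) (ht'b.trans_lt hb1)
    have hB := posDef_add_smul_sub hρ hσ ht (htt'.trans_le (ht'b.trans hb1.le))
    have hAS := posSemidef_smul_sub_segment hσ.posSemidef hc.le h (ht.trans htt'.le) le_rfl
    have hBS := posSemidef_smul_sub_segment hσ.posSemidef hc.le h ht htt'.le
    have hpos' := hcpos t' (ht.trans htt'.le)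
    have hpos := hcpos t ht
    have key := inv_mul_logForm_le_trace hA hB hU hs hpos' (hσU ▸ hAS) (hσU ▸ hBS)
    rw [segment_sub_segment, logForm_smul, re_trace_smul_mul, ← hX] at key
    have hd : 0 < t' - t := sub_pos.2 htt'
    have key' : (t' - t) * (N * (1 + t' * (c - 1))⁻¹) ≤ ψ t' - ψ t := by
      have e : ψ t' - ψ t = (X * (matLog (σ + t' • X) - matLog (σ + t • X))).trace.re := by
        simp only [hψ, ← Complex.sub_re, ← trace_sub, ← mul_sub, sub_sub_sub_cancel_right]
      rw [e]
      refine le_of_mul_le_mul_left (le_of_eq_of_le ?_ key) hd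
      ring
    have hlog := mul_le_mul_of_nonneg_left (log_sub_log_le hpos hpos') (div_nonneg hN0 hc0.le)
    have e : N / (c - 1) * ((1 + t' * (c - 1) - (1 + t * (c - 1))) / (1 + t * (c - 1))) =
        (t' - t) * (N * (1 + t * (c - 1))⁻¹) := by
      field_simp
      ring
    have e' : N / (c - 1) * (Real.log (1 + t' * (c - 1)) - Real.log (1 + t * (c - 1))) =
        N * Real.log (1 + t' * (c - 1)) / (c - 1) - N * Real.log (1 + t * (c - 1)) / (c - 1) := by
      ring
    linarith
  have hmono := le_of_sub_le_mul_sub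
    (f := fun t => N / (c - 1) ^ 2 * ((1 + t * (c - 1)) * (Real.log (1 + t * (c - 1)) - 1) + 1)
      - relEnt (σ + t • X) σ)
    (G := fun t => N * Real.log (1 + t * (c - 1)) / (c - 1)) zero_le_one ?_
  · have e : σ + X = ρ := by rw [hX, add_sub_cancel]
    simp [relEnt_self, e] at hmono
    linarith [mul_comm N ((c * (Real.log c - 1) + 1) / (c - 1) ^ 2),
      mul_div_assoc N (c * (Real.log c - 1) + 1) ((c - 1) ^ 2),
      div_mul_eq_mul_div N ((c - 1) ^ 2) (c * (Real.log c - 1) + 1)]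
  intro t t' ht htt' ht'1
  have ht1 := htt'.trans_le ht'1
  have hd : 0 < t' - t := sub_pos.2 htt'
  have hpos' := hcpos t' (ht.trans htt'.le)
  have hpos := hcpos t ht
  have hA : (σ + t' • X).PosSemidef := by
    rw [hX, add_smul_sub_eq]
    exact (hσ.posSemidef.smul (sub_nonneg.2 ht'1)).add (hρ.smul (ht.trans htt'.le))
  have hB := posDef_add_smul_sub hρ hσ ht ht1
  have hnn := relEnt_nonneg hA hB
    ((trace_add_smul_sub htr t').trans (trace_add_smul_sub htr t).symm)
  have h3 := relEnt_sub_relEnt (σ + t' • X) (σ + t • X) σ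
  rw [segment_sub_segment, re_trace_smul_mul] at h3
  have h4 := mul_le_mul_of_nonneg_left (hψle t ht ht1) hd.le
  have hlog := mul_log_sub_log_nonneg hpos.le hpos'
  have e1 : N / (c - 1) ^ 2 *
      ((1 + t' * (c - 1)) * (Real.log (1 + t' * (c - 1)) - 1) + 1) -
      N / (c - 1) ^ 2 * ((1 + t * (c - 1)) * (Real.log (1 + t * (c - 1)) - 1) + 1) =
      (t' - t) * (N * Real.log (1 + t' * (c - 1)) / (c - 1)) -
      N / (c - 1) ^ 2 * ((1 + t * (c - 1)) * (Real.log (1 + t * (c - 1)) -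
        Real.log (1 + t' * (c - 1))) - (1 + t * (c - 1)) + (1 + t' * (c - 1))) := by
    field_simp
    ring
  have h5 := mul_nonneg (div_nonneg hN0 (sq_nonneg (c - 1))) hlog
  simp only [hψ] at h4
  linarith

/-- The relative entropy is at most the squared Bogoliubov-Kubo-Mori norm of `ρ - σ` at `σ`. -/
lemma relEnt_le_logForm {d : ℕ} {ρ σ U : Matrix (Fin d) (Fin d) ℂ} {s : Fin d → ℝ}
    (hρ : ρ.PosSemidef) (hσ : σ.PosDef) (htr : ρ.trace = σ.trace) (hU : U * Uᴴ = 1)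
    (hs : ∀ i, 0 < s i) (hσU : σ = unitaryDiag U s) :
    relEnt ρ σ ≤ logForm U s U s (ρ - σ) := by
  set X := ρ - σ with hX
  set N := logForm U s U s X with hN
  have hN0 : 0 ≤ N := logForm_nonneg U U hs hs X
  set ψ : ℝ → ℝ := fun t => (X * (matLog (σ + t • X) - matLog σ)).trace.re with hψ
  have hψle : ∀ b, 0 ≤ b → b < 1 → ψ b ≤ -(N * Real.log (1 - b)) := by
    intro b hb0 hb1
    have hmono := le_of_sub_le_mul_sub (f := fun t => ψ t + N * Real.log (1 - t))
      (G := fun t => N * (1 - t)⁻¹) hb0 ?_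
    · simp [hψ] at hmono
      simp only [hψ]
      linarith
    intro t t' ht htt' ht'b
    have hA := posDef_add_smul_sub hρ hσ (ht.trans htt'.le) (ht'b.trans_lt hb1)
    have hB := posDef_add_smul_sub hρ hσ ht (htt'.trans_le (ht'b.trans hb1.le))
    have hAS := posSemidef_segment_sub_smul hρ hσ.posSemidef (ht.trans htt'.le) le_rfl
    have hBS := posSemidef_segment_sub_smul hρ hσ.posSemidef ht htt'.le
    have hpos' : 0 < 1 - t' := by linarith
    have hpos : 0 < 1 - t := by linarith
    have key := trace_le_inv_mul_logForm hA hB hU hs hpos' (hσU ▸ hAS) (hσU ▸ hBS)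
    rw [segment_sub_segment, logForm_smul, re_trace_smul_mul, ← hX] at key
    have hd : 0 < t' - t := sub_pos.2 htt'
    have key' : ψ t' - ψ t ≤ (t' - t) * (N * (1 - t')⁻¹) := by
      have e : ψ t' - ψ t = (X * (matLog (σ + t' • X) - matLog (σ + t • X))).trace.re := by
        simp only [hψ, ← Complex.sub_re, ← trace_sub, ← mul_sub, sub_sub_sub_cancel_right]
      rw [e]
      refine le_of_mul_le_mul_left (key.trans_eq ?_) hd
      ring
    have hlog := mul_le_mul_of_nonneg_left (log_sub_log_le hpos hpos') hN0
    have e : N * ((1 - t' - (1 - t)) / (1 - t)) = -((t' - t) * (N * (1 - t)⁻¹)) := by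
      field_simp
      ring
    linarith
  have hφle : ∀ b, 0 ≤ b → b < 1 →
      relEnt (σ + b • X) σ ≤ N * ((1 - b) * Real.log (1 - b) + b) := by
    intro b hb0 hb1
    have hmono := le_of_sub_le_mul_sub
      (f := fun t => relEnt (σ + t • X) σ - N * ((1 - t) * Real.log (1 - t) + t))
      (G := fun t => -(N * Real.log (1 - t))) hb0 ?_
    · simp [relEnt_self] at hmono
      linarith
    intro t t' ht htt' ht'b
    have hd : 0 < t' - t := sub_pos.2 htt'
    have hpos' : 0 < 1 - t' := by linarith
    have hpos : 0 < 1 - t := by linarith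
    have hA := posDef_add_smul_sub hρ hσ (ht.trans htt'.le) (ht'b.trans_lt hb1)
    have hB := posDef_add_smul_sub hρ hσ ht (htt'.trans_le (ht'b.trans hb1.le))
    have hnn := relEnt_nonneg hB.posSemidef hA
      ((trace_add_smul_sub htr t).trans (trace_add_smul_sub htr t').symm)
    have h3 := relEnt_sub_relEnt (σ + t • X) (σ + t' • X) σ
    rw [segment_sub_segment, re_trace_smul_mul] at h3
    have h4 := mul_le_mul_of_nonneg_left (hψle t' (ht.trans htt'.le) (ht'b.trans_lt hb1)) hd.le
    have h5 := mul_nonneg hN0 (mul_log_sub_log_nonneg hpos'.le hpos)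
    simp only [hψ] at h4
    linarith
  set K := (unitaryDiag U (fun i => (s i)⁻¹) * (Xᴴ * X)).trace.re with hK
  have hbound : ∀ b, 0 ≤ b → b < 1 → relEnt ρ σ ≤ N * b + (1 - b) * K := by
    intro b hb0 hb1
    have hpos : 0 < 1 - b := sub_pos.2 hb1
    have hB := posDef_add_smul_sub hρ hσ hb0 hb1
    have hBS := posSemidef_segment_sub_smul hρ hσ.posSemidef hb0 le_rfl
    nth_rewrite 3 [hσU] at hBS
    rw [smul_unitaryDiag] at hBS
    have h1 := relEnt_le_trace hρ hB (htr.trans (trace_add_smul_sub htr b).symm) hU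
      (fun i => mul_pos hpos (hs i)) hBS
    have e : ρ - (σ + b • X) = (1 - b) • X := by rw [hX]; module
    have h3 := relEnt_sub_relEnt ρ (σ + b • X) σ
    have e2 : unitaryDiag U (fun i => ((1 - b) * s i)⁻¹) =
        (1 - b)⁻¹ • unitaryDiag U (fun i => (s i)⁻¹) := by
      simp only [smul_unitaryDiag, mul_inv]
    rw [← hX, e, e2, conjTranspose_smul, star_trivial, smul_mul_assoc, smul_mul_smul_comm,
      mul_smul_comm, smul_smul, trace_smul, Complex.smul_re, smul_eq_mul, ← hK] at h1
    have e3 : (1 - b)⁻¹ * ((1 - b) * (1 - b)) * K = (1 - b) * K := by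
      field_simp
    rw [e3] at h1
    rw [e, re_trace_smul_mul] at h3
    have h4 := mul_le_mul_of_nonneg_left (hψle b hb0 hb1) hpos.le
    simp only [hψ] at h4
    linarith [hφle b hb0 hb1]
  have hmem : Set.Ico (0 : ℝ) 1 ∈ nhdsWithin (1 : ℝ) (Set.Iio 1) :=
    Ico_mem_nhdsLT zero_lt_one
  have hlim : Filter.Tendsto (fun b : ℝ => N * b + (1 - b) * K) (nhdsWithin 1 (Set.Iio 1))
      (nhds N) := by
    have hcont : Continuous fun b : ℝ => N * b + (1 - b) * K := by fun_prop
    simpa using (hcont.tendsto 1).mono_left nhdsWithin_le_nhds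
  exact ge_of_tendsto hlim (Filter.mem_of_superset hmem fun b hb => hbound b hb.1 hb.2)

/-- **Proposition 1.6** (with `σ = E(ρ)`, `ω = Φ(ρ)` and the general constant `a = 4`). -/
theorem relEnt_comparable_densities_upper
    (d : ℕ) (ρ σ ω : Matrix (Fin d) (Fin d) ℂ)
    (hρ : IsDensity ρ) (hσ : IsDensity σ) (hω : IsDensity ω)
    (hσpd : σ.PosDef)
    (κ c : ℝ) (hκ : 0 < κ) (hc : 1 < c)
    (h₁ : (ω - κ • σ).PosSemidef)
    (h₂ : (c • σ - ω).PosSemidef)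
    (h₃ : (c • σ - ρ).PosSemidef)
    (hD : relEnt ω σ ≤ relEnt ρ σ) :
    relEnt ρ ω ≤ (4 * (c - 1) ^ 2 / (κ * (c * (Real.log c - 1) + 1))) * relEnt ρ σ := by
  have hc0 : 0 < c - 1 := sub_pos.2 hc
  have hk : 0 < c * (Real.log c - 1) + 1 := by
    have h := Real.log_lt_sub_one_of_pos (inv_pos.2 (one_pos.trans hc)) (inv_ne_one.2 hc.ne')
    rw [Real.log_inv] at h
    have h' := mul_lt_mul_of_pos_left h (one_pos.trans hc)
    have e : c * (c⁻¹ - 1) = 1 - c := by field_simp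
    linarith
  have hωpd : ω.PosDef := by
    have h := (hσpd.smul hκ).add_posSemidef h₁
    rwa [add_sub_cancel] at h
  obtain ⟨U, s, hU, hσU, -, -, hs⟩ := exists_unitaryDiag hσpd.posSemidef
  obtain ⟨V, w, hV, hωV, -, -, hw⟩ := exists_unitaryDiag hωpd.posSemidef
  replace hs := hs hσpd
  replace hw := hw hωpd
  have hρσ : ρ.trace = σ.trace := hρ.2.trans hσ.2.symm
  have hωσ : ω.trace = σ.trace := hω.2.trans hσ.2.symm
  have hlow₁ := mul_logForm_le_relEnt hρ.1 hσpd hρσ hU hs hσU hc h₃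
  have hlow₂ := mul_logForm_le_relEnt hω.1 hσpd hωσ hU hs hσU hc h₂
  have hup := relEnt_le_logForm hρ.1 hωpd (hρσ.trans hωσ.symm) hV hw hωV
  have hcomp : logForm V w V w (ρ - ω) ≤ κ⁻¹ * logForm U s U s (ρ - ω) := by
    rw [hσU, hωV, smul_unitaryDiag] at h₁
    rw [← logForm_mul_mul]
    exact logForm_antitone hU hU hV hV (fun i => mul_pos hκ (hs i)) (fun i => mul_pos hκ (hs i))
      hw hw h₁ h₁ _
  have htri := logForm_sub_le U U hs hs (ρ - σ) (ω - σ)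
  rw [sub_sub_sub_cancel_right] at htri
  set k := c * (Real.log c - 1) + 1
  set N := logForm U s U s (ρ - ω)
  have hN : k / (c - 1) ^ 2 * N ≤ 4 * relEnt ρ σ := by
    have := mul_le_mul_of_nonneg_left htri (by positivity : 0 ≤ k / (c - 1) ^ 2)
    linarith
  calc relEnt ρ ω ≤ κ⁻¹ * N := hup.trans hcomp
    _ = (c - 1) ^ 2 / (κ * k) * (k / (c - 1) ^ 2 * N) := by
      field_simp
    _ ≤ (c - 1) ^ 2 / (κ * k) * (4 * relEnt ρ σ) := by gcongr
    _ = _ := by ring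
end

section
/- Let d ≥ 1 and let ρ and σ be densities on ℂ^d such that ρ majorizes σ. (i) If 0 ≤ ζ < 15/(25d + 56), then D(ρ ‖ (1−ζ)·I/d + ζσ) ≥ (1 − 32(d+1)ζ/(15 + (7d−24)ζ)) · D(ρ ‖ I/d). (ii) If 0 ≤ ζ ≤ 15/(57d + 88), then D(ρ ‖ (1−ζ)·I/d + ζσ) ≥ (1/2) · D(ρ ‖ I/d). -/
open Matrix
open scoped ComplexOrder

open Finset in
/-- Abel summation: an antitone weight preserves nonnegativity of partial sums. -/
lemma mul_sum_le_sum_mul_of_antitone {n : ℕ} (a b : Fin n → ℝ) (ha : Antitone a)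
    (hb : ∀ k ≤ n, 0 ≤ ∑ i with i.val < k, b i) (c : ℝ) (hc : ∀ i, c ≤ a i) :
    c * ∑ i, b i ≤ ∑ i, a i * b i := by
  induction n generalizing c with
  | zero => simp
  | succ n ih =>
    have h := ih (fun i => a i.castSucc) (fun i => b i.castSucc)
      (fun i j hij => ha (Fin.castSucc_le_castSucc_iff.mpr hij))
      (fun k hk => by
        have := hb k (by omega)
        rw [sum_filter, Fin.sum_univ_castSucc] at this
        rw [sum_filter]
        simpa [hk.not_gt] using this)
      (a (Fin.last n)) (fun i => ha (Fin.le_last _))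
    have htot : 0 ≤ ∑ i, b i := by
      have := hb (n + 1) le_rfl
      rwa [filter_true_of_mem (fun i _ => i.isLt)] at this
    calc c * ∑ i, b i ≤ a (Fin.last n) * ∑ i, b i := by gcongr; exact hc _
      _ ≤ _ := by
        rw [Fin.sum_univ_castSucc, Fin.sum_univ_castSucc, mul_add]
        linarith

open Finset in
/-- For an antitone tuple the initial segment maximizes sums over sets of given cardinality. -/
lemma sum_le_sum_filter_lt_of_antitone {n : ℕ} (a : Fin n → ℝ) (ha : Antitone a)
    (S : Finset (Fin n)) : ∑ i ∈ S, a i ≤ ∑ i with i.val < #S, a i := by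
  rcases S.eq_empty_or_nonempty with rfl | hS
  · simp
  have hpos : 0 < #S := hS.card_pos
  have hle : #S ≤ n := by simpa using card_le_univ S
  set t := a ⟨#S - 1, by omega⟩ with ht
  have hcard : #{i : Fin n | i.val < #S} = #S := by
    rw [Fin.card_filter_val_lt]; omega
  have key : ∑ i ∈ S, (a i - t) ≤ ∑ i with i.val < #S, (a i - t) := by
    rw [sum_filter, ← univ_inter S, ← sum_ite_mem, univ_inter]
    refine sum_le_sum fun i _ => ?_
    by_cases hi : i.val < #S
    · have : t ≤ a i := ha (by rw [Fin.le_def]; simp only; omega)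
      rw [if_pos hi]
      split_ifs <;> linarith
    · have : a i ≤ t := ha (by rw [Fin.le_def]; simp only; omega)
      rw [if_neg hi]
      split_ifs <;> linarith
  simp only [sum_sub_distrib, sum_const, hcard] at key
  linarith

open Finset in
/-- If `p` majorizes `q`, then pairing `p` with a rearrangement of `q` is at most `∑ pᵢ²`. -/
lemma sum_mul_perm_le_sum_mul_self {n : ℕ} (p q : Fin n → ℝ) (hp : ∀ i, 0 ≤ p i)
    (h : ∀ T : Finset (Fin n), ∃ S : Finset (Fin n), #S = #T ∧ ∑ i ∈ T, q i ≤ ∑ i ∈ S, p i)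
    (π : Equiv.Perm (Fin n)) : ∑ i, p i * q (π i) ≤ ∑ i, p i * p i := by
  obtain ⟨e, he⟩ : ∃ e : Equiv.Perm (Fin n), Antitone (p ∘ e) :=
    ⟨Tuple.sort (fun i => -p i), fun i j hij => by
      have := Tuple.monotone_sort (fun i => -p i) hij
      simpa using this⟩
  have key := mul_sum_le_sum_mul_of_antitone (p ∘ e) (fun i => p (e i) - q (π (e i))) he
    (fun k hk => by
      obtain ⟨S, hS, hle⟩ := h (({i : Fin n | i.val < k} : Finset (Fin n)).map
        (e.trans π).toEmbedding)
      have hcard : #(S.map e.symm.toEmbedding) = k := by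
        rw [card_map, hS, card_map, Fin.card_filter_val_lt]; omega
      have := sum_le_sum_filter_lt_of_antitone (p ∘ e) he (S.map e.symm.toEmbedding)
      rw [hcard] at this
      simp only [sum_map, Equiv.coe_toEmbedding, Function.comp_apply, Equiv.apply_symm_apply,
        Equiv.trans_apply] at this hle
      rw [sum_sub_distrib]
      linarith) 0 (fun i => hp _)
  rw [zero_mul] at key
  simp only [Function.comp_apply, mul_sub, sum_sub_distrib] at key
  rw [← Equiv.sum_comp e (fun i => p i * q (π i)), ← Equiv.sum_comp e (fun i => p i * p i)]
  linarith

/-- Bilinear pairing through a doubly stochastic matrix is at most `∑ pᵢ²` under majorization. -/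
lemma sum_mul_doublyStochastic_le {n : ℕ} (p q : Fin n → ℝ) (hp : ∀ i, 0 ≤ p i)
    (h : ∀ T : Finset (Fin n), ∃ S : Finset (Fin n), S.card = T.card ∧
      ∑ i ∈ T, q i ≤ ∑ i ∈ S, p i)
    {B : Matrix (Fin n) (Fin n) ℝ} (hB : B ∈ doublyStochastic ℝ (Fin n)) :
    ∑ i, ∑ j, p i * B i j * q j ≤ ∑ i, p i * p i := by
  obtain ⟨w, hw, hw1, rfl⟩ := exists_eq_sum_perm_of_mem_doublyStochastic hB
  calc _ = ∑ π : Equiv.Perm (Fin n), w π * ∑ i, p i * q (π i) := by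
        simp only [Matrix.sum_apply, Matrix.smul_apply, smul_eq_mul, Finset.mul_sum,
          Finset.sum_mul]
        rw [Finset.sum_comm]
        simp_rw [Finset.sum_comm (s := Finset.univ (α := Fin n))
          (t := Finset.univ (α := Equiv.Perm (Fin n)))]
        refine Finset.sum_congr rfl fun π _ => ?_
        rw [Finset.sum_comm]
        refine Finset.sum_congr rfl fun i _ => ?_
        simp [Equiv.Perm.permMatrix, PEquiv.toMatrix_apply, mul_left_comm, mul_assoc]
    _ ≤ ∑ π : Equiv.Perm (Fin n), w π * ∑ i, p i * p i := by
        exact Finset.sum_le_sum fun π _ =>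
          mul_le_mul_of_nonneg_left (sum_mul_perm_le_sum_mul_self p q hp h π) (hw π)
    _ = _ := by rw [← Finset.sum_mul, hw1, one_mul]

/-- Squared moduli of the entries of a unitary matrix form a doubly stochastic matrix. -/
lemma normSq_mem_doublyStochastic {n : ℕ} (W : Matrix.unitaryGroup (Fin n) ℂ) :
    (Matrix.of fun i j => Complex.normSq (W.1 i j)) ∈ doublyStochastic ℝ (Fin n) := by
  rw [mem_doublyStochastic_iff_sum]
  refine ⟨fun i j => Complex.normSq_nonneg _, fun i => ?_, fun j => ?_⟩
  · have := congrFun₂ (Matrix.mem_unitaryGroup_iff.mp W.2) i i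
    simp only [Matrix.mul_apply, Matrix.star_apply, Matrix.one_apply_eq, RCLike.star_def,
      Complex.mul_conj] at this
    exact_mod_cast this
  · have := congrFun₂ (Matrix.mem_unitaryGroup_iff'.mp W.2) j j
    simp only [Matrix.mul_apply, Matrix.star_apply, Matrix.one_apply_eq, RCLike.star_def,
      ← Complex.normSq_eq_conj_mul_self] at this
    exact_mod_cast this

/-- `tr (A f(B))` in terms of eigenvalues and the doubly stochastic overlap matrix. -/
lemma exists_doublyStochastic_trace_mul_cfc {n : ℕ} {A B : Matrix (Fin n) (Fin n) ℂ}
    (hA : A.IsHermitian) (hB : B.IsHermitian) :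
    ∃ M ∈ doublyStochastic ℝ (Fin n), ∀ f : ℝ → ℝ, ((A * hB.cfc f).trace).re =
      ∑ i, ∑ j, hA.eigenvalues i * M i j * f (hB.eigenvalues j) := by
  set U := hA.eigenvectorUnitary
  set V := hB.eigenvectorUnitary
  refine ⟨_, normSq_mem_doublyStochastic (star U * V), fun f => ?_⟩
  have htr : (A * hB.cfc f).trace =
      (Matrix.diagonal (RCLike.ofReal ∘ hA.eigenvalues) * (star U * V : Matrix.unitaryGroup (Fin n) ℂ).1 *
        Matrix.diagonal (RCLike.ofReal ∘ f ∘ hB.eigenvalues) *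
          star (star U * V : Matrix.unitaryGroup (Fin n) ℂ).1).trace := by
    conv_lhs => rw [hA.spectral_theorem]
    rw [Matrix.IsHermitian.cfc, Unitary.conjStarAlgAut_apply, Unitary.conjStarAlgAut_apply, mul_assoc,
      mul_assoc, Matrix.trace_mul_comm]
    simp [U, V, mul_assoc]
  rw [htr]
  rw [Matrix.trace, Complex.re_sum]
  refine Finset.sum_congr rfl fun i _ => ?_
  rw [Matrix.diag_apply, Matrix.mul_apply, Complex.re_sum]
  refine Finset.sum_congr rfl fun j _ => ?_
  rw [Matrix.mul_diagonal, Matrix.diagonal_mul, Matrix.star_apply, Matrix.of_apply,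
    mul_right_comm, mul_assoc (_ : ℂ) _ (star _), RCLike.star_def, Complex.mul_conj]
  simp

lemma trace_mul_cfc_self {n : ℕ} {A : Matrix (Fin n) (Fin n) ℂ} (hA : A.IsHermitian)
    (f : ℝ → ℝ) : ((A * hA.cfc f).trace).re = ∑ i, hA.eigenvalues i * f (hA.eigenvalues i) := by
  have : (A * hA.cfc f).trace = (Matrix.diagonal (RCLike.ofReal ∘ hA.eigenvalues) *
      Matrix.diagonal (RCLike.ofReal ∘ f ∘ hA.eigenvalues) : Matrix (Fin n) (Fin n) ℂ).trace := by
    have hid : hA.cfc id = A := hA.spectral_theorem.symm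
    nth_rw 1 [← hid]
    rw [Matrix.IsHermitian.cfc, Matrix.IsHermitian.cfc, ← map_mul, Unitary.conjStarAlgAut_apply, Matrix.trace_mul_comm]
    simp [← mul_assoc]
  rw [this]
  simp [Matrix.trace, Matrix.diagonal_mul_diagonal]

lemma matLog_smul_one {d : ℕ} (r : ℝ) :
    matLog (r • (1 : Matrix (Fin d) (Fin d) ℂ)) = Real.log r • 1 := by
  have h : (r • (1 : Matrix (Fin d) (Fin d) ℂ)).IsHermitian := by
    simp [Matrix.IsHermitian, Matrix.conjTranspose_smul]
  rw [matLog, dif_pos h, ← h.cfc_eq, ← Algebra.algebraMap_eq_smul_one,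
    ← Algebra.algebraMap_eq_smul_one, cfc_algebraMap]

lemma sub_one_sq_le_mul_klFun {x D : ℝ} (hx : 0 ≤ x) (hxD : x ≤ D) :
    (x - 1) ^ 2 ≤ (√D + 1) ^ 2 * (x * Real.log x - x + 1) := by
  obtain ⟨s, hs, rfl⟩ : ∃ s : ℝ, 0 ≤ s ∧ x = s ^ 2 :=
    ⟨√x, Real.sqrt_nonneg x, (Real.sq_sqrt hx).symm⟩
  have hsD : s ≤ √D := Real.le_sqrt_of_sq_le hxD
  have hkl : (s - 1) ^ 2 ≤ s ^ 2 * Real.log (s ^ 2) - s ^ 2 + 1 := by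
    rcases hs.eq_or_lt with rfl | hs
    · simp
    · have h1 := Real.one_sub_inv_le_log_of_pos hs
      have h2 : s ^ 2 * (1 - s⁻¹) = s ^ 2 - s := by field_simp
      have h3 := mul_le_mul_of_nonneg_left h1 (sq_nonneg s)
      rw [Real.log_pow]
      push_cast
      nlinarith
  calc (s ^ 2 - 1) ^ 2 = (s + 1) ^ 2 * (s - 1) ^ 2 := by ring
    _ ≤ _ := by gcongr

/-- The `χ²`-divergence from the uniform distribution is controlled by the relative entropy. -/
lemma mul_sum_sq_sub_one_le {d : ℕ} (hd : 1 ≤ d) (p : Fin d → ℝ) (hp : ∀ i, 0 ≤ p i)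
    (hp1 : ∑ i, p i = 1) :
    d * ∑ i, p i * p i - 1 ≤ (√d + 1) ^ 2 * (∑ i, p i * Real.log (p i) + Real.log d) := by
  have hd0 : (0 : ℝ) < d := by exact_mod_cast hd
  have hpt : ∀ i, d * (p i * p i) - 2 * p i + (d : ℝ)⁻¹ ≤
      (√d + 1) ^ 2 * (p i * Real.log (p i) + p i * Real.log d - p i + (d : ℝ)⁻¹) := by
    intro i
    have hle : p i ≤ 1 := hp1 ▸ Finset.single_le_sum (fun j _ => hp j) (Finset.mem_univ i)
    have h := sub_one_sq_le_mul_klFun (x := d * p i) (D := d) (mul_nonneg hd0.le (hp i))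
      (by nlinarith)
    have hlog : p i * Real.log (d * p i) = p i * Real.log (p i) + p i * Real.log d := by
      rcases (hp i).eq_or_lt with h0 | h0
      · simp [← h0]
      · rw [Real.log_mul hd0.ne' h0.ne']; ring
    rw [mul_assoc (d : ℝ), hlog] at h
    have h2 := mul_le_mul_of_nonneg_left h (inv_nonneg.mpr hd0.le)
    have hl : d * (p i * p i) - 2 * p i + (d : ℝ)⁻¹ = (d : ℝ)⁻¹ * (d * p i - 1) ^ 2 := by
      field_simp
      ring
    rw [hl]
    refine h2.trans_eq ?_
    field_simp
  have hsum := Finset.sum_le_sum fun i (_ : i ∈ Finset.univ) => hpt i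
  rw [← Finset.mul_sum] at hsum
  simp only [Finset.sum_add_distrib, Finset.sum_sub_distrib, ← Finset.mul_sum,
    ← Finset.sum_mul, hp1, Finset.sum_const, Finset.card_univ, Fintype.card_fin, nsmul_eq_mul,
    mul_inv_cancel₀ hd0.ne'] at hsum
  linarith

lemma relEnt_uniform {d : ℕ} {ρ : Matrix (Fin d) (Fin d) ℂ} (hρ : IsDensity ρ) :
    relEnt ρ ((d : ℝ)⁻¹ • (1 : Matrix (Fin d) (Fin d) ℂ)) =
      ∑ i, hρ.1.1.eigenvalues i * Real.log (hρ.1.1.eigenvalues i) + Real.log d := by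
  rw [relEnt, matLog_smul_one, mul_sub, Matrix.trace_sub, Complex.sub_re, matLog,
    dif_pos hρ.1.1, trace_mul_cfc_self]
  rw [mul_smul_comm, mul_one, Matrix.trace_smul, Complex.smul_re, congrArg Complex.re hρ.2, Real.log_inv]
  simp

lemma sum_eigenvalues_eq_one {d : ℕ} {ρ : Matrix (Fin d) (Fin d) ℂ} (hρ : IsDensity ρ) :
    ∑ i, hρ.1.1.eigenvalues i = 1 := by
  have := hρ.1.1.trace_eq_sum_eigenvalues
  simpa using congrArg Complex.re (this.symm.trans hρ.2)

lemma re_trace_mul_le_of_majorizes {d : ℕ} {ρ σ : Matrix (Fin d) (Fin d) ℂ}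
    (hρ : ρ.PosSemidef) (hσ : σ.IsHermitian) (hmaj : Majorizes hρ.1 hσ) :
    ((ρ * σ).trace).re ≤ ∑ i, hρ.1.eigenvalues i * hρ.1.eigenvalues i := by
  obtain ⟨M, hM, h⟩ := exists_doublyStochastic_trace_mul_cfc hρ.1 hσ
  have hid : hσ.cfc id = σ := hσ.spectral_theorem.symm
  have := h id
  rw [hid] at this
  rw [this]
  exact sum_mul_doublyStochastic_le _ _ hρ.eigenvalues_nonneg
    (fun T => hmaj T.card (by simpa using T.card_le_univ) T rfl) hM

/-- Linearization of the logarithm: `tr (ρ log τ) ≤ d tr (ρ τ) - 1 - log d`. -/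
lemma re_trace_mul_matLog_le {d : ℕ} (hd : 1 ≤ d) {ρ τ : Matrix (Fin d) (Fin d) ℂ}
    (hρ : IsDensity ρ) (hτ : τ.PosDef) :
    ((ρ * matLog τ).trace).re ≤ d * ((ρ * τ).trace).re - 1 - Real.log d := by
  have hd0 : (0 : ℝ) < d := by exact_mod_cast hd
  obtain ⟨M, hM, h⟩ := exists_doublyStochastic_trace_mul_cfc hρ.1.1 hτ.1
  have hid : hτ.1.cfc id = τ := hτ.1.spectral_theorem.symm
  have hτe := h id
  rw [hid] at hτe
  have hone : ∑ i, ∑ j, hρ.1.1.eigenvalues i * M i j = 1 := by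
    simp_rw [← Finset.mul_sum, (mem_doublyStochastic_iff_sum.mp hM).2.1, mul_one]
    exact sum_eigenvalues_eq_one hρ
  rw [matLog, dif_pos hτ.1, h, hτe]
  calc _ ≤ ∑ i, ∑ j, hρ.1.1.eigenvalues i * M i j *
        (d * hτ.1.eigenvalues j - (1 + Real.log d)) := by
        gcongr with i _ j
        · exact mul_nonneg (hρ.1.eigenvalues_nonneg i) (hM.1 i j)
        · have h1 := hτ.eigenvalues_pos j
          have h2 := Real.log_le_sub_one_of_pos (mul_pos hd0 h1)
          rw [Real.log_mul hd0.ne' h1.ne'] at h2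
          linarith
    _ = _ := by
        simp_rw [mul_sub, Finset.sum_sub_distrib, ← Finset.sum_mul, hone, Finset.mul_sum]
        simp only [id, one_mul, ← sub_sub]
        congr 2
        exact Finset.sum_congr rfl fun i _ => Finset.sum_congr rfl fun j _ => by ring

/-- Perturbation bound with the constant `(√d + 1)²`. -/
lemma relEnt_perturbed_ge {d : ℕ} (hd : 1 ≤ d) {ρ σ : Matrix (Fin d) (Fin d) ℂ}
    (hρ : IsDensity ρ) (hσ : IsDensity σ) (hmaj : Majorizes hρ.1.1 hσ.1.1)
    {ζ : ℝ} (h0 : 0 ≤ ζ) (h1 : ζ < 1) :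
    (1 - ζ * (√d + 1) ^ 2) * relEnt ρ ((d : ℝ)⁻¹ • (1 : Matrix (Fin d) (Fin d) ℂ)) ≤
      relEnt ρ ((1 - ζ) • ((d : ℝ)⁻¹ • (1 : Matrix (Fin d) (Fin d) ℂ)) + ζ • σ) := by
  have hd0 : (0 : ℝ) < d := by exact_mod_cast hd
  set τ := (1 - ζ) • ((d : ℝ)⁻¹ • (1 : Matrix (Fin d) (Fin d) ℂ)) + ζ • σ with hτdef
  have hτ : τ.PosDef := by
    refine Matrix.PosDef.add_posSemidef ?_ (hσ.1.smul h0)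
    exact (Matrix.PosDef.one.smul (inv_pos.mpr hd0)).smul (sub_pos.mpr h1)
  have htr : ((ρ * τ).trace).re = (1 - ζ) * (d : ℝ)⁻¹ + ζ * ((ρ * σ).trace).re := by
    simp [hτdef, mul_add, Matrix.trace_add, hρ.2]
  have hlog := re_trace_mul_matLog_le hd hρ hτ
  have hle := re_trace_mul_le_of_majorizes hρ.1 hσ.1.1 hmaj
  have hchi := mul_sum_sq_sub_one_le hd _ hρ.1.eigenvalues_nonneg (sum_eigenvalues_eq_one hρ)
  have hrel : relEnt ρ τ = ∑ i, hρ.1.1.eigenvalues i * Real.log (hρ.1.1.eigenvalues i) -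
      ((ρ * matLog τ).trace).re := by
    rw [relEnt, mul_sub, Matrix.trace_sub, Complex.sub_re, ← trace_mul_cfc_self, matLog,
      dif_pos hρ.1.1]
  rw [htr] at hlog
  rw [hrel, relEnt_uniform hρ]
  have h2 := mul_le_mul_of_nonneg_left hchi h0
  have h3 := mul_le_mul_of_nonneg_left hle (mul_nonneg hd0.le h0)
  have h4 : d * ((1 - ζ) * (d : ℝ)⁻¹ + ζ * ((ρ * σ).trace).re) =
      (1 - ζ) + d * ζ * ((ρ * σ).trace).re := by field_simp
  rw [h4] at hlog
  linarith

lemma relEnt_uniform_nonneg {d : ℕ} (hd : 1 ≤ d) {ρ : Matrix (Fin d) (Fin d) ℂ}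
    (hρ : IsDensity ρ) : 0 ≤ relEnt ρ ((d : ℝ)⁻¹ • (1 : Matrix (Fin d) (Fin d) ℂ)) := by
  rw [relEnt_uniform hρ]
  have hchi := mul_sum_sq_sub_one_le hd _ hρ.1.eigenvalues_nonneg (sum_eigenvalues_eq_one hρ)
  have hcs := sq_sum_le_card_mul_sum_sq (s := Finset.univ) (f := hρ.1.1.eigenvalues)
  simp only [sum_eigenvalues_eq_one hρ, Finset.card_univ, Fintype.card_fin, sq] at hcs
  exact nonneg_of_mul_nonneg_right (by linarith) (by positivity : 0 < (√(d : ℝ) + 1) ^ 2)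

/-- **Corollary 2.5.** Explicit constants for the multiplicative perturbation of the relative
entropy to the complete mixture. -/
theorem relEnt_perturbed_complete_mixture_explicit
    (d : ℕ) (hd : 1 ≤ d) (ρ σ : Matrix (Fin d) (Fin d) ℂ)
    (hρ : IsDensity ρ) (hσ : IsDensity σ)
    (hmaj : Majorizes hρ.1.1 hσ.1.1) :
    (∀ ζ : ℝ, 0 ≤ ζ → ζ < 15 / (25 * d + 56) →
      relEnt ρ ((1 - ζ) • ((d : ℝ)⁻¹ • (1 : Matrix (Fin d) (Fin d) ℂ)) + ζ • σ)
        ≥ (1 - 32 * (d + 1) * ζ / (15 + (7 * d - 24) * ζ))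
            * relEnt ρ ((d : ℝ)⁻¹ • (1 : Matrix (Fin d) (Fin d) ℂ))) ∧
    (∀ ζ : ℝ, 0 ≤ ζ → ζ ≤ 15 / (57 * d + 88) →
      relEnt ρ ((1 - ζ) • ((d : ℝ)⁻¹ • (1 : Matrix (Fin d) (Fin d) ℂ)) + ζ • σ)
        ≥ (1 / 2) * relEnt ρ ((d : ℝ)⁻¹ • (1 : Matrix (Fin d) (Fin d) ℂ))) := by
  have hd1 : (1 : ℝ) ≤ d := by exact_mod_cast hd
  have hD := relEnt_uniform_nonneg hd hρ
  have hs : √(d : ℝ) ^ 2 = d := Real.sq_sqrt (by positivity)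
  constructor
  · intro ζ h0 h1
    have h1' := h1
    rw [lt_div_iff₀ (by positivity)] at h1'
    have hζ : ζ < 1 := by nlinarith
    refine ge_iff_le.mpr (le_trans ?_ (relEnt_perturbed_ge hd hρ hσ hmaj h0 hζ))
    refine mul_le_mul_of_nonneg_right (sub_le_sub_left ?_ 1) hD
    have hden : 0 < 15 + (7 * d - 24) * ζ := by nlinarith [mul_nonneg (zero_le_one.trans hd1) h0]
    rw [le_div_iff₀ hden]
    have hK : (√(d : ℝ) + 1) ^ 2 * (15 + (7 * d - 24) * ζ) ≤ 32 * (d + 1) := by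
      rcases le_total (7 * (d : ℝ) - 24) 0 with hd24 | hd24
      · have h2 : 15 + (7 * d - 24) * ζ ≤ 15 := by nlinarith
        calc _ ≤ (√(d : ℝ) + 1) ^ 2 * 15 := by gcongr
          _ ≤ _ := by nlinarith [sq_nonneg (√(d : ℝ) - 1)]
      · have h2 : 15 * (√(d : ℝ) + 1) ^ 2 ≤ 25 * d + 56 := by
          nlinarith [sq_nonneg (10 * √(d : ℝ) - 15)]
        have h3 := mul_le_mul_of_nonneg_right h2 hden.le
        nlinarith [mul_le_mul_of_nonneg_left h1'.le hd24]
    nlinarith [mul_le_mul_of_nonneg_left hK h0]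
  · intro ζ h0 h1
    have h1' := h1
    rw [le_div_iff₀ (by positivity)] at h1'
    have hζ : ζ < 1 := by nlinarith
    refine ge_iff_le.mpr (le_trans ?_ (relEnt_perturbed_ge hd hρ hσ hmaj h0 hζ))
    refine mul_le_mul_of_nonneg_right ?_ hD
    have hK : 30 * (√(d : ℝ) + 1) ^ 2 ≤ 57 * d + 88 := by
      nlinarith [sq_nonneg (27 * √(d : ℝ) - 30)]
    nlinarith [mul_le_mul_of_nonneg_left hK h0]
end

section
/- Let p, w ∈ ℝ^d be probability vectors with all entries of w strictly positive. Let i ≠ j be indices with p_i ≥ p_j and p_i·w_j ≥ p_j·w_i, and let δ satisfy 0 < δ < w_i. Define w̃ by w̃_i = w_i − δ, w̃_j = w_j + δ, and w̃_k = w_k for k ∉ {i,j}. Then D(p‖w) ≤ D(p‖w̃), where D(p‖q) := Σ_k p_k·(log p_k − log q_k) is the classical relative entropy (with the convention 0·log 0 = 0, e.g. using Real.log 0 = 0). -/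
/-- Classical relative entropy `D(p‖q) = ∑ₖ pₖ (log pₖ − log qₖ)`
(with the convention `Real.log 0 = 0`, so `0 · log 0 = 0`). -/
noncomputable def classRelEnt {d : ℕ} (p q : Fin d → ℝ) : ℝ :=
  ∑ k, p k * (Real.log (p k) - Real.log (q k))

/-- The logarithm lies below its tangent line at `a`. -/
theorem log_sub_log_le_sub_div {a b : ℝ} (ha : 0 < a) (hb : 0 < b) :
    Real.log b - Real.log a ≤ (b - a) / a := by
  rw [← Real.log_div hb.ne' ha.ne', sub_div, div_self ha.ne']
  exact Real.log_le_sub_one_of_pos (div_pos hb ha)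

/-- **Lemma 2.1 (Flattening).** Moving weight `δ` in the reference distribution from an index
where `p/w` is larger to one where it is smaller only increases the relative entropy. -/
theorem flattening_lemma
    (d : ℕ) (p w : Fin d → ℝ)
    (hp0 : ∀ k, 0 ≤ p k) (hp1 : ∑ k, p k = 1)
    (hw0 : ∀ k, 0 < w k) (hw1 : ∑ k, w k = 1)
    (i j : Fin d) (hij : i ≠ j)
    (hpij : p j ≤ p i) (hratio : p j * w i ≤ p i * w j)
    (δ : ℝ) (hδ0 : 0 < δ) (hδw : δ < w i) :
    classRelEnt p w
      ≤ classRelEnt p (Function.update (Function.update w i (w i - δ)) j (w j + δ)) := by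
  unfold classRelEnt
  rw [← sub_nonneg, ← Finset.sum_sub_distrib, Fintype.sum_eq_add i j hij]
  · simp only [Function.update_self, Function.update_of_ne hij]
    have hi := mul_le_mul_of_nonneg_left
      (log_sub_log_le_sub_div (hw0 i) (sub_pos.2 hδw)) (hp0 i)
    have hj := mul_le_mul_of_nonneg_left
      (log_sub_log_le_sub_div (hw0 j) (add_pos (hw0 j) hδ0)) (hp0 j)
    have hdiv : p j / w j ≤ p i / w i := (div_le_div_iff₀ (hw0 j) (hw0 i)).2 hratio
    have hlin : p i * ((w i - δ - w i) / w i) + p j * ((w j + δ - w j) / w j)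
        = δ * (p j / w j - p i / w i) := by ring
    have hneg : δ * (p j / w j - p i / w i) ≤ 0 :=
      mul_nonpos_of_nonneg_of_nonpos hδ0.le (sub_nonpos.2 hdiv)
    linarith
  · rintro k ⟨hki, hkj⟩
    simp [Function.update_of_ne hki, Function.update_of_ne hkj]
end

section
/- Let b ≥ 0, a ∈ [0,1], and let ζ satisfy 0 ≤ ζ ≤ a/(1+b). Then a · log(1 + b) ≥ log(1 + ζ·b). -/
/-- **Lemma 2.3.** For `b ≥ 0`, `a ∈ [0,1]` and `0 ≤ ζ ≤ a/(1+b)`,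
`a log(1+b) ≥ log(1+ζb)`. -/
theorem scalar_log_comparison
    (a b ζ : ℝ) (hb : 0 ≤ b) (ha : a ∈ Set.Icc (0:ℝ) 1)
    (hζ0 : 0 ≤ ζ) (hζ : ζ ≤ a / (1 + b)) :
    a * Real.log (1 + b) ≥ Real.log (1 + ζ * b) := by
  have hb1 : 0 < 1 + b := by positivity
  calc Real.log (1 + ζ * b) ≤ ζ * b := by
        linarith [Real.log_le_sub_one_of_pos (show 0 < 1 + ζ * b by positivity)]
    _ ≤ a / (1 + b) * b := by gcongr
    _ = a * (1 - (1 + b)⁻¹) := by field_simp; ring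
    _ ≤ a * Real.log (1 + b) :=
        mul_le_mul_of_nonneg_left (Real.one_sub_inv_le_log_of_pos hb1) ha.1
end

section
/- Let n ≥ 1 be a natural number (regarded as a real number), let a, b ∈ (0,1), and let ζ satisfy 0 ≤ ζ ≤ a · min{(1−b)/(n + a(1−b) + 1), b/((1 − a·b)·n + a·b + 1)}. Define g : ℝ → ℝ by g(t) = t·(a·log(n·t) − log((1−ζ) + ζ·n·t)). Then for all real x, y with 0 < y ≤ 1/n ≤ x ≤ 1, the derivatives satisfy g′(x) ≥ g′(y), i.e. deriv g x − deriv g y ≥ 0. -/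
open Set in
/-- The function `t ↦ a log (n t) + a - log (c + k t) - k t / (c + k t)`, with the last fraction
written as `1 - c / (c + k t)`, is monotone where its derivative is nonnegative. -/
lemma monotoneOn_mul_log_sub_log_add_div {n a c k T : ℝ} (hn : 0 < n) (hc : 0 < c) (hk : 0 ≤ k)
    (hT : ∀ t, 0 < t → t ≤ T → k * t * (2 * c + k * t) ≤ a * (c + k * t) ^ 2) :
    MonotoneOn (fun t => a * Real.log (n * t) + a - Real.log (c + k * t) - 1 + c / (c + k * t))
      (Ioc 0 T) := by
  have hder : ∀ t, 0 < t → HasDerivAt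
      (fun t => a * Real.log (n * t) + a - Real.log (c + k * t) - 1 + c / (c + k * t))
      (a * (n / (n * t)) - k / (c + k * t) + (0 * (c + k * t) - c * k) / (c + k * t) ^ 2) t := by
    intro t ht
    have hD : 0 < c + k * t := by positivity
    have h1 : HasDerivAt (fun t : ℝ => n * t) n t := by
      simpa using (hasDerivAt_id t).const_mul n
    have h2 : HasDerivAt (fun t : ℝ => c + k * t) k t := by
      simpa using ((hasDerivAt_id t).const_mul k).const_add c
    exact (((((h1.log (mul_pos hn ht).ne').const_mul a).add_const a).sub
      (h2.log hD.ne')).sub_const 1).add ((hasDerivAt_const t c).div h2 hD.ne')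
  refine monotoneOn_of_hasDerivWithinAt_nonneg (convex_Ioc 0 T)
    (fun t ht => (hder t ht.1).continuousAt.continuousWithinAt)
    (fun t ht => (hder t (interior_subset ht).1).hasDerivWithinAt) fun t ht => ?_
  obtain ⟨ht0, htT⟩ := interior_subset ht
  have hD : 0 < c + k * t := by positivity
  have heq : a * (n / (n * t)) - k / (c + k * t) + (0 * (c + k * t) - c * k) / (c + k * t) ^ 2
      = (a * (c + k * t) ^ 2 - k * t * (2 * c + k * t)) / (t * (c + k * t) ^ 2) := by
    field_simp
    ring
  rw [heq]
  exact div_nonneg (sub_nonneg.2 (hT t ht0 htT)) (by positivity)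

lemma hasDerivAt_mul_log_sub_log {n a c k t : ℝ} (hn : 0 < n) (hc : 0 < c) (hk : 0 ≤ k)
    (ht : 0 < t) :
    HasDerivAt (fun t => t * (a * Real.log (n * t) - Real.log (c + k * t)))
      (a * Real.log (n * t) + a - Real.log (c + k * t) - 1 + c / (c + k * t)) t := by
  have hD : 0 < c + k * t := by positivity
  have h1 : HasDerivAt (fun t : ℝ => n * t) n t := by
    simpa using (hasDerivAt_id t).const_mul n
  have h2 : HasDerivAt (fun t : ℝ => c + k * t) k t := by
    simpa using ((hasDerivAt_id t).const_mul k).const_add c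
  refine ((hasDerivAt_id t).mul (((h1.log (mul_pos hn ht).ne').const_mul a).sub
    (h2.log hD.ne'))).congr_deriv ?_
  simp only [id, Pi.sub_apply]
  field_simp
  ring

/-- **Lemma 2.4.** The variational derivative comparison underlying Theorem 1.2, in scalar form:
for `g(t) = t (a log(n t) − log((1−ζ) + ζ n t))` and eigenvalues `x ≥ 1/n ≥ y > 0`,
the derivative of `g` at `x` dominates the derivative at `y`. -/
theorem deriv_comparison_towards_identity
    (n : ℕ) (hn : 1 ≤ n) (a b ζ : ℝ)
    (ha : a ∈ Set.Ioo (0:ℝ) 1) (hb : b ∈ Set.Ioo (0:ℝ) 1)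
    (hζ0 : 0 ≤ ζ)
    (hζ : ζ ≤ a * min ((1 - b) / (n + a * (1 - b) + 1))
      (b / ((1 - a * b) * n + a * b + 1)))
    (g : ℝ → ℝ)
    (hg : ∀ t : ℝ, g t = t * (a * Real.log (n * t) - Real.log ((1 - ζ) + ζ * n * t))) :
    ∀ x y : ℝ, 0 < y → y ≤ 1 / n → 1 / n ≤ x → x ≤ 1 →
      deriv g x - deriv g y ≥ 0 := by
  intro x y hy hyn hnx hx
  obtain ⟨ha0, ha1⟩ := ha
  obtain ⟨hb0, hb1⟩ := hb
  have hn0 : (0 : ℝ) < n := by exact_mod_cast hn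
  have hab : 0 < a * b := mul_pos ha0 hb0
  have hab1 : a * b < 1 := mul_lt_one_of_nonneg_of_lt_one_left ha0.le ha1 hb1.le
  have hab' : 0 < a * (1 - b) := mul_pos ha0 (sub_pos.2 hb1)
  have h1 : ζ * (n + a * (1 - b) + 1) ≤ a * (1 - b) := by
    rw [← le_div_iff₀ (by positivity), mul_div_assoc]
    exact hζ.trans (mul_le_mul_of_nonneg_left (min_le_left _ _) ha0.le)
  have hden : 0 < (1 - a * b) * n + a * b + 1 := by
    have := mul_pos (sub_pos.2 hab1) hn0
    linarith
  have h2 : ζ * ((1 - a * b) * n + a * b + 1) ≤ a * b := by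
    rw [← le_div_iff₀ hden, mul_div_assoc]
    exact hζ.trans (mul_le_mul_of_nonneg_left (min_le_right _ _) ha0.le)
  have hc : 0 < 1 - ζ := by
    by_contra! h
    nlinarith
  have hk : 0 ≤ ζ * n := by positivity
  have hT : ∀ t : ℝ, 0 < t → t ≤ 1 →
      ζ * n * t * (2 * (1 - ζ) + ζ * n * t) ≤ a * ((1 - ζ) + ζ * n * t) ^ 2 := by
    intro t ht0 ht1
    have hu0 : 0 ≤ ζ * n * t := by positivity
    have hun : ζ * n * t ≤ ζ * n := mul_le_of_le_one_right hk ht1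
    have hu1 : ζ * n * t ≤ a * (1 - b) * (1 - ζ) := by linarith
    have hu2 : ζ * n * t ≤ a * b * ((1 - ζ) + ζ * n * t) := by
      have := mul_le_mul_of_nonneg_left hun (sub_pos.2 hab1).le
      linarith
    generalize ζ * n * t = u at *
    generalize 1 - ζ = c at *
    have e1 := mul_le_mul_of_nonneg_right hu1 (add_nonneg hc.le hu0)
    have e2 := mul_le_mul_of_nonneg_right hu2 hc.le
    have e3 := mul_nonneg (mul_nonneg ha0.le hu0) (add_nonneg hc.le hu0)
    linarith
  have hyx : y ≤ x := hyn.trans hnx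
  rw [funext hg, (hasDerivAt_mul_log_sub_log hn0 hc hk (hy.trans_le hyx)).deriv,
    (hasDerivAt_mul_log_sub_log hn0 hc hk hy).deriv]
  exact sub_nonneg.2 (monotoneOn_mul_log_sub_log_add_div hn0 hc hk hT
    ⟨hy, hyx.trans hx⟩ ⟨hy.trans_le hyx, hx⟩ hyx)
end

section
/- Let N be a unital *-subalgebra of the d×d complex matrices, and let E be the orthogonal projection of the space of d×d complex matrices onto N with respect to the Hilbert–Schmidt (Frobenius) inner product ⟨X,Y⟩ = tr(XᴴY). Then for every positive definite density ρ and every positive definite density ω with ω ∈ N: D(ρ‖ω) = D(ρ‖E(ρ)) + D(E(ρ)‖ω). -/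
open Matrix
open scoped ComplexOrder

/-- A star subalgebra of complex matrices is closed under the matrix logarithm. -/
lemma matLog_mem {d : ℕ} (N : StarSubalgebra ℂ (Matrix (Fin d) (Fin d) ℂ))
    {A : Matrix (Fin d) (Fin d) ℂ} (hA : A ∈ N) : matLog A ∈ N := by
  unfold matLog
  split_ifs with h
  · have : IsClosed (N : Set (Matrix (Fin d) (Fin d) ℂ)) :=
      (Subalgebra.toSubmodule N.toSubalgebra).closed_of_finiteDimensional
    rw [← h.cfc_eq]
    exact cfc_mem (𝕜' := ℂ) Real.log hA
  · exact zero_mem N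

/-- **Lemma 3.1 (Chain rule, tracial case).**  Here `E` is the orthogonal projection onto the
unital *-subalgebra `N` with respect to the Hilbert–Schmidt inner product
`⟨X, Y⟩ = tr (Xᴴ Y)`, characterized by: it maps into `N`, fixes `N`, and `X − E X` is
orthogonal to `N`. -/
theorem relEnt_chain_rule
    (d : ℕ) (N : StarSubalgebra ℂ (Matrix (Fin d) (Fin d) ℂ))
    (E : Matrix (Fin d) (Fin d) ℂ →ₗ[ℂ] Matrix (Fin d) (Fin d) ℂ)
    (hEmem : ∀ X : Matrix (Fin d) (Fin d) ℂ, E X ∈ N)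
    (hEfix : ∀ X ∈ N, E X = X)
    (hEorth : ∀ X : Matrix (Fin d) (Fin d) ℂ, ∀ Y ∈ N, (Yᴴ * (X - E X)).trace = 0)
    (ρ ω : Matrix (Fin d) (Fin d) ℂ)
    (hρ : ρ.PosDef) (hρtr : ρ.trace = 1)
    (hω : ω.PosDef) (hωtr : ω.trace = 1) (hωN : ω ∈ N) :
    relEnt ρ ω = relEnt ρ (E ρ) + relEnt (E ρ) ω := by
  have hL : matLog (E ρ) - matLog ω ∈ N :=
    sub_mem (matLog_mem N (hEmem ρ)) (matLog_mem N hωN)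
  have h := hEorth ρ _ (star_mem hL)
  rw [star_eq_conjTranspose, conjTranspose_conjTranspose, trace_mul_comm] at h
  unfold relEnt
  rw [← Complex.add_re, ← sub_eq_zero, ← Complex.sub_re, ← trace_add, ← trace_sub]
  have key : ρ * (matLog ρ - matLog ω) - (ρ * (matLog ρ - matLog (E ρ)) +
      E ρ * (matLog (E ρ) - matLog ω)) = (ρ - E ρ) * (matLog (E ρ) - matLog ω) := by
    noncomm_ring
  rw [key, h, Complex.zero_re]
end
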